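/- arXiv:2106.02499 — 7 statements merged into one kernel-verified Lean document; each statement's English description precedes it below -/
import Mathlib

section
/- Let R(t) denote the number of pairs (a,b) of integers with a² + b² ≤ t. Then |R(t) − πt| = O(t^{1/3}) as t → ∞, i.e. there exist constants C > 0 and t₀ such that |R(t) − πt| ≤ C·t^{1/3} for all t ≥ t₀. -/
noncomputable def ee (x : ℝ) : ℂ := Complex.exp ((2 * Real.pi * x : ℝ) * Complex.I)

lemma ee_norm (x : ℝ) : ‖ee x‖ = 1 := Complex.norm_exp_ofReal_mul_I _

lemma ee_add (x y : ℝ) : ee (x + y) = ee x * ee y := by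
  unfold ee
  rw [← Complex.exp_add]; congr 1; push_cast; ring

lemma ee_int (m : ℤ) : ee m = 1 := by
  unfold ee
  rw [Complex.exp_eq_one_iff]
  exact ⟨m, by push_cast; ring⟩

noncomputable def qq (D : ℝ) : ℝ := Real.cos (Real.pi * D) / Real.sin (Real.pi * D)
noncomputable def cc (D : ℝ) : ℂ := (1 + (qq D : ℂ) * Complex.I) / 2

lemma sin_lower {D θ : ℝ} (hθ : 0 < θ) (h1 : θ ≤ D) (h2 : D ≤ 1 - θ) :
    2 * θ ≤ Real.sin (Real.pi * D) := by
  have hpi := Real.pi_pos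
  rcases le_total D (1/2) with h | h
  · have := Real.mul_le_sin (x := Real.pi * D) (by nlinarith) (by nlinarith)
    have e : 2 / Real.pi * (Real.pi * D) = 2 * D := by field_simp
    linarith
  · have := Real.mul_le_sin (x := Real.pi * (1 - D)) (by nlinarith) (by nlinarith)
    have e : 2 / Real.pi * (Real.pi * (1 - D)) = 2 * (1 - D) := by field_simp
    have e2 : Real.sin (Real.pi * (1 - D)) = Real.sin (Real.pi * D) := by
      rw [show Real.pi * (1 - D) = Real.pi - Real.pi * D by ring, Real.sin_pi_sub]
    linarith

lemma cc_mul {D : ℝ} (h : Real.sin (Real.pi * D) ≠ 0) : cc D * (1 - ee D) = 1 := by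
  have e : ee D = (Real.cos (Real.pi * D) + Real.sin (Real.pi * D) * Complex.I) ^ 2 := by
    unfold ee
    rw [show ((2 * Real.pi * D : ℝ) : ℂ) * Complex.I = ((Real.pi * D : ℝ) : ℂ) * Complex.I +
      ((Real.pi * D : ℝ) : ℂ) * Complex.I by push_cast; ring, Complex.exp_add, Complex.exp_mul_I]
    push_cast; ring
  have hs : (Real.sin (Real.pi * D) : ℂ) ≠ 0 := by exact_mod_cast h
  have hp : (Real.sin (Real.pi * D) : ℂ) ^ 2 + (Real.cos (Real.pi * D) : ℂ) ^ 2 = 1 := by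
    exact_mod_cast Real.sin_sq_add_cos_sq (Real.pi * D)
  rw [e]
  unfold cc qq
  set s := Real.sin (Real.pi * D)
  set c := Real.cos (Real.pi * D)
  push_cast
  field_simp
  have hI : Complex.I ^ 2 = -1 := Complex.I_sq
  have hc : (c:ℂ)^2 = 1 - (s:ℂ)^2 := by linear_combination hp
  linear_combination ((s:ℂ) - c * Complex.I) * hp + (-(s:ℂ)^3 - 2 * s * c^2 - c * s^2 * Complex.I) * hI

lemma qq_bound {D θ : ℝ} (hθ : 0 < θ) (h1 : θ ≤ D) (h2 : D ≤ 1 - θ) : |qq D| ≤ 1 / (2 * θ) := by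
  have := sin_lower hθ h1 h2
  unfold qq
  rw [abs_div, abs_of_pos (a := Real.sin _) (by linarith)]
  gcongr
  exact Real.abs_cos_le_one _

lemma cc_bound {D θ : ℝ} (hθ : 0 < θ) (h1 : θ ≤ D) (h2 : D ≤ 1 - θ) : ‖cc D‖ ≤ 1 / (2 * θ) := by
  have hq := qq_bound hθ h1 h2
  have h3 : (1:ℝ) ≤ 1 / (2 * θ) := by rw [le_div_iff₀ (by linarith)]; linarith
  unfold cc
  rw [norm_div]
  have : ‖(1 + (qq D : ℂ) * Complex.I)‖ ≤ 1 + |qq D| := by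
    refine (norm_add_le _ _).trans ?_
    simp
  have h2 : ‖(2:ℂ)‖ = 2 := by simp
  rw [h2]; linarith

lemma cc_sub {D D' θ : ℝ} (hθ : 0 < θ) (h1 : θ ≤ D) (h2 : D ≤ D') (h3 : D' ≤ 1 - θ) :
    ‖cc D' - cc D‖ = (qq D - qq D') / 2 := by
  have s1 := sin_lower hθ h1 (h2.trans h3)
  have s2 := sin_lower hθ (h1.trans h2) h3
  have hq : 0 ≤ qq D - qq D' := by
    unfold qq
    rw [div_sub_div _ _ (by linarith) (by linarith)]
    apply div_nonneg _ (mul_nonneg (by linarith) (by linarith))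
    have : Real.cos (Real.pi * D) * Real.sin (Real.pi * D') - Real.sin (Real.pi * D) * Real.cos (Real.pi * D')
        = Real.sin (Real.pi * (D' - D)) := by
      rw [mul_sub, Real.sin_sub]; ring
    rw [this]
    apply Real.sin_nonneg_of_nonneg_of_le_pi
    · have := Real.pi_pos; nlinarith
    · have := Real.pi_pos; nlinarith
  unfold cc
  rw [show (1 + (qq D' : ℂ) * Complex.I) / 2 - (1 + (qq D : ℂ) * Complex.I) / 2
    = (-((qq D - qq D') / 2 : ℝ) : ℂ) * Complex.I by push_cast; ring]
  rw [norm_mul, Complex.norm_I, norm_neg, Complex.norm_real, Real.norm_eq_abs, abs_of_nonneg (by linarith)]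
  ring

lemma kl_core (y : ℕ → ℝ) (m : ℤ) (θ : ℝ) (hθ : 0 < θ) (L : ℕ)
    (hm : ∀ n, n + 1 ≤ L → y (n+1) - y n ≤ y (n+2) - y (n+1))
    (hd : ∀ n ≤ L, m + θ ≤ y (n+1) - y n ∧ y (n+1) - y n ≤ m + 1 - θ) :
    ‖∑ j ∈ Finset.range (L+1), ee (y j) + cc (y (L+1) - y L - m) * ee (y (L+1))‖ ≤
      ‖cc (y 1 - y 0 - m)‖ + (qq (y 1 - y 0 - m) - qq (y (L+1) - y L - m)) / 2 := by
  have key : ∀ n ≤ L, ee (y n) + cc (y (n+1) - y n - m) * ee (y (n+1))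
      = cc (y (n+1) - y n - m) * ee (y n) := by
    intro n hn
    obtain ⟨h1, h2⟩ := hd n hn
    have hs := sin_lower (D := y (n+1) - y n - m) hθ (by linarith) (by linarith)
    have := cc_mul (D := y (n+1) - y n - m) (by linarith)
    have e : ee (y (n+1)) = ee (y n) * ee (y (n+1) - y n - m) := by
      rw [← ee_add, ← mul_one (ee (y n + _)), ← ee_int m, ← ee_add]; congr 1; ring
    rw [e]; linear_combination (-ee (y n)) * this
  induction L with
  | zero =>
    have := key 0 le_rfl
    simp only [zero_add, Finset.sum_range_one] at this ⊢
    rw [this, norm_mul, ee_norm]; simp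
  | succ L ih =>
    have ih := ih (fun n hn => hm n (by omega)) (fun n hn => hd n (by omega)) (fun n hn => key n (by omega))
    have k := key (L+1) le_rfl
    rw [Finset.sum_range_succ, add_assoc, k]
    obtain ⟨h1, h2⟩ := hd L (by omega)
    obtain ⟨h3, h4⟩ := hd (L+1) (by omega)
    have h5 := hm L (by omega)
    have hc := cc_sub (D := y (L+1) - y L - m) (D' := y (L+1+1) - y (L+1) - m) hθ (by linarith)
      (by linarith) (by linarith)
    have e : ∑ j ∈ Finset.range (L+1), ee (y j) + cc (y (L+1+1) - y (L+1) - m) * ee (y (L+1))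
      = (∑ j ∈ Finset.range (L+1), ee (y j) + cc (y (L+1) - y L - m) * ee (y (L+1)))
        + (cc (y (L+1+1) - y (L+1) - m) - cc (y (L+1) - y L - m)) * ee (y (L+1)) := by ring
    rw [e]
    refine (norm_add_le _ _).trans ?_
    rw [norm_mul, ee_norm, hc]
    linarith

lemma kl (y : ℕ → ℝ) (m : ℤ) (θ : ℝ) (hθ : 0 < θ) (a b : ℕ)
    (hm : ∀ n, a ≤ n → n + 1 < b → y (n+1) - y n ≤ y (n+2) - y (n+1))
    (hd : ∀ n, a ≤ n → n < b → m + θ ≤ y (n+1) - y n ∧ y (n+1) - y n ≤ m + 1 - θ) :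
    ‖∑ j ∈ Finset.Ico a b, ee (y j)‖ ≤ 2 / θ := by
  rcases le_or_gt b a with h | h
  · rw [Finset.Ico_eq_empty (by omega)]; simp; positivity
  obtain ⟨L, rfl⟩ : ∃ L, b = a + (L + 1) := ⟨b - a - 1, by omega⟩
  rw [Finset.sum_Ico_eq_sum_range]
  have hdz : ∀ n ≤ L, m + θ ≤ y (a + (n+1)) - y (a + n) ∧ y (a + (n+1)) - y (a + n) ≤ m + 1 - θ :=
    fun n hn => hd (a + n) (by omega) (by omega)
  have := kl_core (fun j => y (a + j)) m θ hθ L (fun n hn => hm (a + n) (by omega) (by omega)) hdz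
  rw [show a + (L + 1) - a = L + 1 by omega]
  obtain ⟨h1, h2⟩ := hdz 0 (by omega)
  obtain ⟨h3, h4⟩ := hdz L (by omega)
  simp only [zero_add] at h1 h2
  have b1 := cc_bound (D := y (a + 1) - y (a + 0) - m) hθ (by linarith) (by linarith)
  have b2 := cc_bound (D := y (a + (L+1)) - y (a + L) - m) hθ (by linarith) (by linarith)
  have b3 := abs_le.1 (qq_bound (D := y (a + 1) - y (a + 0) - m) hθ (by linarith) (by linarith))
  have b4 := abs_le.1 (qq_bound (D := y (a + (L+1)) - y (a + L) - m) hθ (by linarith) (by linarith))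
  have tri := norm_sub_le (∑ j ∈ Finset.range (L+1), ee (y (a + j)) + cc (y (a + (L+1)) - y (a + L) - m) * ee (y (a + (L+1)))) (cc (y (a + (L+1)) - y (a + L) - m) * ee (y (a + (L+1))))
  rw [add_sub_cancel_right, norm_mul _ (ee _), ee_norm] at tri
  have e : 2 / θ = 4 * (1 / (2 * θ)) := by field_simp; ring
  rw [e]
  have : 0 < 1 / (2*θ) := by positivity
  linarith [b3.1, b3.2, b4.1, b4.2]

lemma card_gap (S : Finset ℕ) (l w : ℝ) (hl : 0 < l) (hw : 0 ≤ w)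
    (h : ∀ i ∈ S, ∀ j ∈ S, i ≤ j → ((j:ℝ) - i) * l ≤ w) : (S.card : ℝ) ≤ w / l + 1 := by
  rcases S.eq_empty_or_nonempty with rfl | hne
  · simp; positivity
  have h1 := h _ (S.min'_mem hne) _ (S.max'_mem hne) (S.min'_le _ (S.max'_mem hne))
  have hsub : S ⊆ Finset.Icc (S.min' hne) (S.max' hne) := fun i hi =>
    Finset.mem_Icc.2 ⟨S.min'_le _ hi, S.le_max' _ hi⟩
  have hc := Finset.card_le_card hsub
  rw [Nat.card_Icc] at hc
  have hle : S.min' hne ≤ S.max' hne := S.min'_le _ (S.max'_mem hne)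
  have : (S.card : ℝ) + S.min' hne ≤ S.max' hne + 1 := by exact_mod_cast (by omega)
  rw [← le_div_iff₀ hl] at h1
  linarith

lemma ordc_eq_Ico (S : Finset ℕ) (h : ∀ i ∈ S, ∀ j ∈ S, ∀ k, i ≤ k → k ≤ j → k ∈ S) :
    ∃ a b, S = Finset.Ico a b := by
  rcases S.eq_empty_or_nonempty with rfl | hne
  · exact ⟨0, 0, by simp⟩
  refine ⟨S.min' hne, S.max' hne + 1, ?_⟩
  ext k
  rw [Finset.mem_Ico]
  constructor
  · intro hk
    exact ⟨S.min'_le _ hk, Nat.lt_succ_of_le (S.le_max' _ hk)⟩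
  · rintro ⟨h1, h2⟩
    exact h _ (S.min'_mem hne) _ (S.max'_mem hne) k h1 (Nat.le_of_lt_succ h2)

lemma norm_sum_ee_le (S : Finset ℕ) (x : ℕ → ℝ) : ‖∑ n ∈ S, ee (x n)‖ ≤ S.card := by
  refine (norm_sum_le _ _).trans ?_
  simp [ee_norm]

lemma vdc (x : ℕ → ℝ) (N : ℕ) (l u : ℝ) (hl : 0 < l) (hlu : l ≤ u)
    (h : ∀ n, n + 2 ≤ N → l ≤ x (n+2) - 2 * x (n+1) + x n ∧ x (n+2) - 2 * x (n+1) + x n ≤ u) :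
    ‖∑ n ∈ Finset.range N, ee (x n)‖ ≤ 7 * (N * u + 2) / √l := by
  have hsl : 0 < √l := Real.sqrt_pos.2 hl
  have hsq : √l * √l = l := Real.mul_self_sqrt hl.le
  rcases le_or_gt 1 l with h1 | h1
  · refine (norm_sum_ee_le _ _).trans ?_
    rw [Finset.card_range, le_div_iff₀ hsl]
    have : √l ≤ l := by nlinarith [Real.one_le_sqrt.2 h1]
    have hN : (0:ℝ) ≤ N := by positivity
    nlinarith [mul_le_mul_of_nonneg_left (this.trans hlu) hN, mul_nonneg hN (hl.le.trans hlu)]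
  have hs1 : √l ≤ 1 := Real.sqrt_le_iff.2 ⟨by norm_num, by linarith⟩
  set d : ℕ → ℝ := fun n => x (n+1) - x n with hd
  have gap : ∀ i j, i ≤ j → j < N → ((j:ℝ) - i) * l ≤ d j - d i ∧ d j - d i ≤ ((j:ℝ) - i) * u := by
    intro i j hij
    induction j, hij using Nat.le_induction with
    | base => intro _; simp
    | succ j hij ih =>
      intro hj
      obtain ⟨a1, a2⟩ := ih (by omega)
      obtain ⟨b1, b2⟩ := h j (by omega)
      simp only [hd] at *
      push_cast
      constructor
      · nlinarith
      · nlinarith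
  rcases Nat.eq_zero_or_pos N with rfl | hN
  · simp; positivity
  set θ := √l / 2 with hθ
  have hθ0 : 0 < θ := by positivity
  set I := Finset.Icc ⌊d 0⌋ ⌊d (N-1)⌋ with hI
  have dmono : ∀ i j, i ≤ j → j < N → d i ≤ d j := by
    intro i j hij hj
    have := (gap i j hij hj).1
    have h0 : (0:ℝ) ≤ (j:ℝ) - i := by rw [sub_nonneg]; exact_mod_cast hij
    nlinarith [mul_nonneg h0 hl.le]
  have hmaps : ∀ n ∈ Finset.range N, ⌊d n⌋ ∈ I := by
    intro n hn
    rw [Finset.mem_range] at hn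
    exact Finset.mem_Icc.2 ⟨Int.floor_le_floor (dmono _ _ (by omega) hn),
      Int.floor_le_floor (dmono _ _ (by omega) (by omega))⟩
  have hIc : (I.card : ℝ) ≤ N * u + 2 := by
    have h0 := dmono 0 (N-1) (by omega) (by omega)
    have hf := Int.floor_le_floor h0
    have e : (I.card : ℤ) = ⌊d (N-1)⌋ + 1 - ⌊d 0⌋ := by
      rw [hI, Int.card_Icc]; omega
    have e' : (I.card : ℝ) = ⌊d (N-1)⌋ + 1 - ⌊d 0⌋ := by exact_mod_cast e
    rw [e']
    have g := (gap 0 (N-1) (by omega) (by omega)).2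
    have f1 := Int.floor_le (d (N-1))
    have f2 := Int.lt_floor_add_one (d 0)
    have e3 : ((N - 1 : ℕ) : ℝ) = N - 1 := by rw [Nat.cast_sub hN]; simp
    rw [e3] at g
    simp only [Nat.cast_zero, sub_zero] at g
    nlinarith
  have hcls : ∀ m ∈ I, ‖∑ n ∈ (Finset.range N).filter (fun n => ⌊d n⌋ = m), ee (x n)‖ ≤ 7 / √l := by
    intro m _
    set F := (Finset.range N).filter (fun n => ⌊d n⌋ = m) with hF
    have memF : ∀ n ∈ F, n < N ∧ (m:ℝ) ≤ d n ∧ d n < m + 1 := by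
      intro n hn
      rw [hF, Finset.mem_filter, Finset.mem_range] at hn
      exact ⟨hn.1, Int.floor_eq_iff.1 hn.2⟩
    set A := F.filter (fun n => d n < m + θ) with hA
    set B := F.filter (fun n => ¬ d n < m + θ) with hB
    set B1 := B.filter (fun n => m + 1 - θ < d n) with hB1
    set B2 := B.filter (fun n => ¬ m + 1 - θ < d n) with hB2
    rw [← Finset.sum_filter_add_sum_filter_not F (fun n => d n < m + θ),
      ← Finset.sum_filter_add_sum_filter_not B (fun n => m + 1 - θ < d n)]
    have hAc : (A.card : ℝ) ≤ θ / l + 1 := by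
      apply card_gap A l θ hl hθ0.le
      intro i hi j hj hij
      rw [hA, Finset.mem_filter] at hi hj
      have := (gap i j hij (memF j hj.1).1).1
      linarith [(memF i hi.1).2.1]
    have hB1c : (B1.card : ℝ) ≤ θ / l + 1 := by
      apply card_gap B1 l θ hl hθ0.le
      intro i hi j hj hij
      rw [hB1, Finset.mem_filter, hB, Finset.mem_filter] at hi hj
      have := (gap i j hij (memF j hj.1.1).1).1
      linarith [(memF j hj.1.1).2.2]
    have memB2 : ∀ n, n ∈ B2 ↔ n < N ∧ m + θ ≤ d n ∧ d n ≤ m + 1 - θ := by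
      intro n
      rw [hB2, Finset.mem_filter, hB, Finset.mem_filter, hF, Finset.mem_filter, Finset.mem_range,
        Int.floor_eq_iff, not_lt, not_lt]
      constructor
      · rintro ⟨⟨⟨a, b⟩, c⟩, e⟩; exact ⟨a, c, e⟩
      · rintro ⟨a, b, c⟩; exact ⟨⟨⟨a, by linarith, by linarith⟩, b⟩, c⟩
    have hB2s : ‖∑ n ∈ B2, ee (x n)‖ ≤ 2 / θ := by
      obtain ⟨a, b, hab⟩ := ordc_eq_Ico B2 (by
        intro i hi j hj k hik hkj
        rw [memB2] at *
        refine ⟨by omega, hi.2.1.trans (dmono _ _ hik (by omega)), (dmono _ _ hkj hj.1).trans hj.2.2⟩)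
      rw [hab]
      have memab : ∀ n, a ≤ n → n < b → n < N ∧ m + θ ≤ d n ∧ d n ≤ m + 1 - θ := by
        intro n h1 h2
        rw [← memB2, hab, Finset.mem_Ico]; exact ⟨h1, h2⟩
      apply kl x m θ hθ0 a b
      · intro n h1 h2
        exact dmono n (n+1) (by omega) (memab _ (by omega) h2).1
      · intro n h1 h2
        exact (memab n h1 h2).2
    have t1 := norm_add_le (∑ n ∈ A, ee (x n)) (∑ n ∈ B1, ee (x n) + ∑ n ∈ B2, ee (x n))
    have t2 := norm_add_le (∑ n ∈ B1, ee (x n)) (∑ n ∈ B2, ee (x n))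
    have t3 := norm_sum_ee_le A x
    have t4 := norm_sum_ee_le B1 x
    have e1 : θ / l = 1 / 2 * (1 / √l) := by
      rw [hθ]; nth_rewrite 2 [← hsq]; field_simp
    have e2 : 2 / θ = 4 * (1 / √l) := by rw [hθ]; field_simp; norm_num
    have e3 : 7 / √l = 7 * (1 / √l) := by ring
    have e4 : 1 ≤ 1 / √l := by rw [le_div_iff₀ hsl]; linarith
    rw [e3]
    linarith
  rw [← Finset.sum_fiberwise_of_maps_to hmaps]
  refine (norm_sum_le _ _).trans ((Finset.sum_le_sum hcls).trans ?_)
  rw [Finset.sum_const, nsmul_eq_mul]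
  calc (I.card : ℝ) * (7 / √l) ≤ (N * u + 2) * (7 / √l) := by gcongr
    _ = _ := by ring

noncomputable def PP (x : ℝ) : ℝ := Int.fract x ^ 2 - Int.fract x + 1 / 6

lemma PP_eq (x y : ℝ) (m : ℤ) (h0 : 0 ≤ y) (h1 : y ≤ 1) (h : x = y + m) : PP x = y ^ 2 - y + 1 / 6 := by
  rcases eq_or_lt_of_le h1 with h2 | h2
  · subst h2
    have : Int.fract x = 0 := by rw [Int.fract_eq_iff]; exact ⟨le_rfl, by norm_num, m + 1, by rw [h]; push_cast; ring⟩
    unfold PP; rw [this]; norm_num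
  · have : Int.fract x = y := by rw [Int.fract_eq_iff]; exact ⟨h0, h2, m, by rw [h]; ring⟩
    unfold PP; rw [this]

lemma saw_upper (x δ : ℝ) (h0 : 0 < δ) (h1 : δ ≤ 1) :
    Int.fract x - 1 / 2 ≤ δ + (PP x - PP (x - δ)) / (2 * δ) := by
  have hx := Int.fract_add_floor x
  have f0 := Int.fract_nonneg x
  have f1 := Int.fract_lt_one x
  set s := Int.fract x with hs
  have e1 : PP x = s ^ 2 - s + 1 / 6 := rfl
  rw [← sub_le_iff_le_add', le_div_iff₀ (by linarith)]
  rcases le_or_gt δ s with h | h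
  · rw [e1, PP_eq (x - δ) (s - δ) ⌊x⌋ (by linarith) (by linarith) (by linarith)]
    nlinarith
  · rw [e1, PP_eq (x - δ) (s - δ + 1) (⌊x⌋ - 1) (by linarith) (by linarith) (by push_cast; linarith)]
    nlinarith

lemma saw_lower (x δ : ℝ) (h0 : 0 < δ) (h1 : δ ≤ 1) :
    -δ + (PP (x + δ) - PP x) / (2 * δ) ≤ Int.fract x - 1 / 2 := by
  have hx := Int.fract_add_floor x
  have f0 := Int.fract_nonneg x
  have f1 := Int.fract_lt_one x
  set s := Int.fract x with hs
  have e1 : PP x = s ^ 2 - s + 1 / 6 := rfl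
  rw [← le_sub_iff_add_le', div_le_iff₀ (by linarith)]
  rcases le_or_gt (s + δ) 1 with h | h
  · rw [e1, PP_eq (x + δ) (s + δ) ⌊x⌋ (by linarith) (by linarith) (by linarith)]
    nlinarith
  · rw [e1, PP_eq (x + δ) (s + δ - 1) (⌊x⌋ + 1) (by linarith) (by linarith) (by push_cast; linarith)]
    nlinarith

lemma bern2 (x : ℝ) : (Polynomial.map (algebraMap ℚ ℝ) (Polynomial.bernoulli 2)).eval x = x ^ 2 - x + 1 / 6 := by
  rw [Polynomial.bernoulli]
  simp [Finset.sum_range_succ, bernoulli_two]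
  ring

lemma PP_hasSum (x : ℝ) :
    HasSum (fun k : ℕ => 1 / (k : ℝ) ^ 2 * (ee (k * x)).re) (Real.pi ^ 2 * PP x) := by
  have := hasSum_one_div_nat_pow_mul_cos (k := 1) one_ne_zero (x := Int.fract x)
    ⟨Int.fract_nonneg x, (Int.fract_lt_one x).le⟩
  rw [mul_one, bern2] at this
  convert this using 1
  · funext k
    congr 1
    have e : ee (k * x) = ee (k * Int.fract x) := by
      rw [show (k * x : ℝ) = k * Int.fract x + ((k * ⌊x⌋ : ℤ) : ℝ) by
        push_cast; rw [← mul_add, Int.fract_add_floor], ee_add, ee_int, mul_one]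
    rw [e, ee, Complex.exp_ofReal_mul_I_re]
    congr 1; ring
  · unfold PP; rw [show Nat.factorial 2 = 2 from rfl]; push_cast; ring

lemma ee_sub_one_bound (x : ℝ) : ‖ee x - 1‖ ≤ 2 * Real.pi * min 1 |x| := by
  have hpi := Real.pi_gt_three
  rw [mul_min_of_nonneg _ _ (by positivity)]
  apply le_min
  · refine (norm_sub_le _ _).trans ?_
    rw [ee_norm]; simp; linarith
  · have := Real.norm_exp_I_mul_ofReal_sub_one_le (x := 2 * Real.pi * x)
    rw [mul_comm] at this
    refine this.trans (le_of_eq ?_)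
    rw [Real.norm_eq_abs, abs_mul, abs_of_pos (by positivity : 0 < 2 * Real.pi)]

lemma tele_bound (δ : ℝ) (h0 : 0 < δ) (K : ℕ) :
    ∑ k ∈ Finset.range K, min 1 ((k + 1 : ℝ) * δ) / ((k + 1 : ℝ) * √(k + 1)) ≤ 8 * √δ := by
  set r := √(1 / δ) with hr
  have hr0 : 0 < r := Real.sqrt_pos.2 (by positivity)
  have hr2 : r ^ 2 = 1 / δ := Real.sq_sqrt (by positivity)
  have hδ : √δ = 1 / r := by rw [hr, Real.sqrt_div (by norm_num)]; simp
  have hδ2 : δ = 1 / r ^ 2 := by rw [hr2]; simp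
  have key : ∑ k ∈ Finset.range K, min 1 ((k + 1 : ℝ) * δ) / ((k + 1 : ℝ) * √(k + 1)) ≤
      8 / r * (√K / (r + √K)) := by
    induction K with
    | zero => simp
    | succ K ih =>
      rw [Finset.sum_range_succ]
      push_cast
      have p0 : 0 ≤ √(K:ℝ) := Real.sqrt_nonneg _
      have q0 : 0 < √(K + 1 : ℝ) := Real.sqrt_pos.2 (by positivity)
      have p2 : √(K:ℝ) ^ 2 = K := Real.sq_sqrt (by positivity)
      have q2 : √(K + 1 : ℝ) ^ 2 = K + 1 := Real.sq_sqrt (by positivity)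
      have pq : √(K:ℝ) ≤ √(K + 1 : ℝ) := Real.sqrt_le_sqrt (by linarith)
      set p := √(K:ℝ)
      set q := √(K + 1 : ℝ)
      rw [hδ2] at ih
      rw [← q2, hδ2]
      have hdiff : 8 / r * (q / (r + q)) - 8 / r * (p / (r + p)) = 8 * (q - p) / ((r + q) * (r + p)) := by
        field_simp; ring
      have hqp : q - p = 1 / (q + p) := by
        rw [eq_div_iff (by positivity)]; nlinarith
      have step1 : 2 / (q * (r ^ 2 + q ^ 2)) ≤ 8 * (q - p) / ((r + q) * (r + p)) := by
        rw [hqp, mul_one_div, div_div, div_le_div_iff₀ (by positivity) (by positivity)]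
        have a1 : (q + p) ≤ 2 * q := by linarith
        have a2 : (r + q) * (r + p) ≤ 2 * (r ^ 2 + q ^ 2) := by nlinarith [sq_nonneg (r - q)]
        have := mul_le_mul a1 a2 (by positivity) (by positivity)
        nlinarith
      have step2 : min 1 (q ^ 2 * (1 / r ^ 2)) / (q ^ 2 * q) ≤ 2 / (q * (r ^ 2 + q ^ 2)) := by
        rw [div_le_div_iff₀ (by positivity) (by positivity)]
        have m1 := min_le_left 1 (q ^ 2 * (1 / r ^ 2))
        have m2 := min_le_right 1 (q ^ 2 * (1 / r ^ 2))
        set m := min 1 (q ^ 2 * (1 / r ^ 2))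
        have m3 : m * r ^ 2 ≤ q ^ 2 := by
          calc m * r ^ 2 ≤ (q ^ 2 * (1 / r ^ 2)) * r ^ 2 := by gcongr
            _ = q ^ 2 := by field_simp
        have m4 : m * q ^ 2 ≤ q ^ 2 := by nlinarith [sq_nonneg q]
        nlinarith
      linarith
  refine key.trans ?_
  rw [hδ]
  have : √(K:ℝ) / (r + √K) ≤ 1 := by rw [div_le_one (by positivity)]; linarith
  calc 8 / r * (√(K:ℝ) / (r + √K)) ≤ 8 / r * 1 := by gcongr
    _ = _ := by ring

/-- Fourier bound. -/
lemma PP_diff_bound (y : ℕ → ℝ) (N : ℕ) (U V δ η : ℝ) (h0 : 0 < δ) (h1 : δ ≤ 1) (hU : 0 ≤ U) (hV : 0 ≤ V)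
    (hη : |η| = δ)
    (hS : ∀ k : ℕ, 1 ≤ k → ‖∑ n ∈ Finset.range N, ee (k * y n)‖ ≤ U * √k + V / √k) :
    |∑ n ∈ Finset.range N, (PP (y n + η) - PP (y n))| ≤ 16 * (U * √δ + V * δ) := by
  have hsum : HasSum (fun k : ℕ => 1 / (k:ℝ) ^ 2 *
      ((ee (k * η) - 1) * ∑ n ∈ Finset.range N, ee (k * y n)).re)
      (Real.pi ^ 2 * ∑ n ∈ Finset.range N, (PP (y n + η) - PP (y n))) := by
    have := hasSum_sum (s := Finset.range N) (fun n _ => (PP_hasSum (y n + η)).sub (PP_hasSum (y n)))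
    convert this using 1
    · rfl
    · funext k
      rw [Finset.mul_sum, Complex.re_sum, Finset.mul_sum]
      refine Finset.sum_congr rfl fun n _ => ?_
      rw [← mul_sub, ← Complex.sub_re, mul_add, ee_add]
      congr 2; ring
    · rw [Finset.mul_sum]; exact Finset.sum_congr rfl fun n _ => by ring
  have hb : ∀ K : ℕ, |∑ k ∈ Finset.range (K + 1), 1 / (k:ℝ) ^ 2 *
      ((ee (k * η) - 1) * ∑ n ∈ Finset.range N, ee (k * y n)).re| ≤
      2 * Real.pi * (8 * (U * √δ + V * δ)) := by
    intro K
    rw [Finset.sum_range_succ']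
    simp only [Nat.cast_zero, ne_eq, OfNat.ofNat_ne_zero, not_false_eq_true, zero_pow, div_zero, zero_mul, add_zero]
    refine (Finset.abs_sum_le_sum_abs _ _).trans ?_
    have hterm : ∀ k ∈ Finset.range K, |1 / ((k + 1 : ℕ) :ℝ) ^ 2 *
      ((ee ((k + 1 : ℕ) * η) - 1) * ∑ n ∈ Finset.range N, ee ((k + 1 : ℕ) * y n)).re| ≤
        2 * Real.pi * (U * (min 1 ((k + 1 : ℝ) * δ) / ((k + 1 : ℝ) * √(k + 1)))
          + V * δ * (min 1 ((k + 1 : ℝ) * 1) / ((k + 1 : ℝ) * √(k + 1)))) := by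
      intro k _
      have hk := hS (k+1) (by omega)
      have he := ee_sub_one_bound ((k + 1 : ℕ) * η)
      rw [abs_mul, hη] at he
      have hre := Complex.abs_re_le_norm ((ee ((k + 1 : ℕ) * η) - 1) * ∑ n ∈ Finset.range N, ee ((k + 1 : ℕ) * y n))
      rw [norm_mul] at hre
      push_cast at *
      have hkp : (0:ℝ) < k + 1 := by positivity
      rw [abs_of_pos hkp] at he
      have q0 : 0 < √(k + 1 : ℝ) := Real.sqrt_pos.2 (by positivity)
      have q2 : √(k + 1 : ℝ) ^ 2 = k + 1 := Real.sq_sqrt (by positivity)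
      have m1 : min 1 ((k + 1 : ℝ) * 1) = 1 := min_eq_left (by linarith [(Nat.cast_nonneg k : (0:ℝ) ≤ k)])
      rw [m1, abs_mul, abs_of_pos (by positivity : 0 < 1 / ((k:ℝ) + 1) ^ 2)]
      have m2 := min_le_right 1 ((k + 1 : ℝ) * δ)
      have m0 : 0 ≤ min 1 ((k + 1 : ℝ) * δ) := le_min (by norm_num) (by positivity)
      set m := min 1 ((k + 1 : ℝ) * δ)
      set q := √(k + 1 : ℝ)
      have hprod := mul_le_mul he hk (norm_nonneg _) (by positivity)
      calc _ ≤ 1 / ((k:ℝ) + 1) ^ 2 * (2 * Real.pi * m * (U * q + V / q)) := by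
            gcongr; exact hre.trans hprod
        _ = 2 * Real.pi * (U * (m / ((k + 1 : ℝ) * q)) + V * (m / ((k + 1) ^ 2 * q))) := by
            rw [← q2]; field_simp
        _ ≤ 2 * Real.pi * (U * (m / ((k + 1 : ℝ) * q)) + V * (((k + 1 : ℝ) * δ) / ((k + 1) ^ 2 * q))) := by
            gcongr
        _ = _ := by field_simp
    refine (Finset.sum_le_sum hterm).trans ?_
    rw [← Finset.mul_sum, Finset.sum_add_distrib, ← Finset.mul_sum, ← Finset.mul_sum]
    have t1 := mul_le_mul_of_nonneg_left (tele_bound δ h0 K) hU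
    have t2 := mul_le_mul_of_nonneg_left (tele_bound 1 one_pos K) (mul_nonneg hV h0.le)
    rw [Real.sqrt_one] at t2
    gcongr
    linarith
  have hlim := ((hsum.tendsto_sum_nat).comp (Filter.tendsto_add_atTop_nat 1)).abs
  have := le_of_tendsto' hlim hb
  rw [abs_mul, abs_of_pos (by positivity : 0 < Real.pi ^ 2)] at this
  have hpi := Real.pi_gt_three
  have hnn : 0 ≤ U * √δ + V * δ := by positivity
  set Z := |∑ n ∈ Finset.range N, (PP (y n + η) - PP (y n))|
  have h3 : Real.pi * Z ≤ 16 * (U * √δ + V * δ) := by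
    have : Real.pi * (Real.pi * Z) ≤ Real.pi * (16 * (U * √δ + V * δ)) := by linarith
    exact le_of_mul_le_mul_left this Real.pi_pos
  have : 0 ≤ Z := abs_nonneg _
  nlinarith

lemma saw_sum_bound (y : ℕ → ℝ) (N : ℕ) (U V δ : ℝ) (h0 : 0 < δ) (h1 : δ ≤ 1) (hU : 0 ≤ U) (hV : 0 ≤ V)
    (hS : ∀ k : ℕ, 1 ≤ k → ‖∑ n ∈ Finset.range N, ee (k * y n)‖ ≤ U * √k + V / √k) :
    |∑ n ∈ Finset.range N, (Int.fract (y n) - 1 / 2)| ≤ N * δ + 8 * (U / √δ + V) := by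
  have hs : √δ * √δ = δ := Real.mul_self_sqrt h0.le
  have hs0 : 0 < √δ := Real.sqrt_pos.2 h0
  have e : 16 * (U * √δ + V * δ) / (2 * δ) = 8 * (U / √δ + V) := by
    have : U / √δ = U * √δ / δ := by
      rw [div_eq_div_iff hs0.ne' h0.ne', mul_assoc, hs]
    rw [this]; field_simp; ring
  have b1 := PP_diff_bound y N U V δ (-δ) h0 h1 hU hV (by rw [abs_neg, abs_of_pos h0]) hS
  have b2 := PP_diff_bound y N U V δ δ h0 h1 hU hV (abs_of_pos h0) hS
  have u := Finset.sum_le_sum (s := Finset.range N) (fun n _ => saw_upper (y n) δ h0 h1)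
  have l := Finset.sum_le_sum (s := Finset.range N) (fun n _ => saw_lower (y n) δ h0 h1)
  rw [Finset.sum_add_distrib, ← Finset.sum_div] at u l
  simp only [Finset.sum_const, Finset.card_range, nsmul_eq_mul] at u l
  rw [← e]
  have h2 : 0 < 2 * δ := by linarith
  have b1' : (∑ n ∈ Finset.range N, (PP (y n) - PP (y n - δ))) / (2 * δ) ≤ 16 * (U * √δ + V * δ) / (2 * δ) := by
    gcongr
    have := (abs_le.1 b1).1
    have e2 : ∑ n ∈ Finset.range N, (PP (y n) - PP (y n - δ)) = - ∑ n ∈ Finset.range N, (PP (y n + -δ) - PP (y n)) := by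
      rw [← Finset.sum_neg_distrib]
      exact Finset.sum_congr rfl fun n _ => by rw [← sub_eq_add_neg]; ring
    linarith
  have b2' : -(16 * (U * √δ + V * δ)) / (2 * δ) ≤ (∑ n ∈ Finset.range N, (PP (y n + δ) - PP (y n))) / (2 * δ) := by
    gcongr
    exact (abs_le.1 b2).1
  rw [neg_div] at b2'
  rw [abs_le]
  constructor <;> linarith

lemma norm_sum_ee_neg (S : Finset ℕ) (x : ℕ → ℝ) : ‖∑ n ∈ S, ee (-x n)‖ = ‖∑ n ∈ S, ee (x n)‖ := by
  have h : ∀ z, ee (-z) = (starRingEnd ℂ) (ee z) := by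
    intro z
    unfold ee
    rw [← Complex.exp_conj, map_mul, Complex.conj_ofReal, Complex.conj_I]
    congr 1; push_cast; ring
  simp only [h]
  rw [← map_sum, Complex.norm_conj]

noncomputable def ff (t x : ℝ) : ℝ := √(t - x ^ 2)

lemma second_diff {X Y u v w n : ℝ} (hX : 0 < X) (hY : 0 < Y) (hXY : X ^ 2 = 2 * Y ^ 2) (hn : 0 ≤ n) (hnY : n + 2 ≤ Y)
    (hu : Y ≤ u) (hv : Y ≤ v) (hw : Y ≤ w) (hu' : u ≤ X) (hv' : v ≤ X) (hw' : w ≤ X)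
    (eu : u ^ 2 = X ^ 2 - n ^ 2) (ev : v ^ 2 = X ^ 2 - (n + 1) ^ 2) (ew : w ^ 2 = X ^ 2 - (n + 2) ^ 2) :
    1 / X ≤ 2 * v - u - w ∧ 2 * v - u - w ≤ 3 / X := by
  have key : (2 * v - u - w) * (2 * v + u + w) = 4 + (u - w) ^ 2 := by nlinarith
  have hpos : 0 < 2 * v + u + w := by linarith
  have huw : (u - w) * (u + w) = 4 * (n + 1) := by nlinarith
  have huwp : 0 < u + w := by linarith
  have h0 : 0 ≤ u - w := by
    by_contra hc
    push Not at hc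
    have := mul_neg_of_neg_of_pos hc huwp
    linarith
  have h2 : u - w ≤ 2 := by
    by_contra hc
    push Not at hc
    have := mul_lt_mul_of_pos_right hc huwp
    linarith
  have e : 2 * v - u - w = (4 + (u - w) ^ 2) / (2 * v + u + w) := by
    rw [eq_div_iff hpos.ne', key]
  have hXY2 : 2 * X ≤ 3 * Y := by
    apply (sq_le_sq₀ (by linarith) (by linarith)).1
    nlinarith [sq_nonneg Y]
  rw [e]
  constructor
  · rw [div_le_div_iff₀ hX hpos]; nlinarith only [mul_nonneg (sq_nonneg (u - w)) hX.le, hu', hv', hw']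
  · rw [div_le_div_iff₀ hpos hX]
    have : (u - w) ^ 2 ≤ 4 := by nlinarith only [h0, h2]
    have := mul_le_mul_of_nonneg_right this hX.le
    linarith

lemma ff_bounds {t Y x : ℝ} (hY : 0 < Y) (ht : t = 2 * Y ^ 2) (h0 : 0 ≤ x) (h1 : x ≤ Y) :
    Y ≤ ff t x ∧ ff t x ≤ √t ∧ ff t x ^ 2 = t - x ^ 2 := by
  have h2 : x ^ 2 ≤ Y ^ 2 := by gcongr
  refine ⟨?_, ?_, ?_⟩
  · apply Real.le_sqrt_of_sq_le; linarith
  · apply Real.sqrt_le_sqrt; nlinarith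
  · apply Real.sq_sqrt; nlinarith

lemma exp_sum_bound {t Y : ℝ} {M : ℕ} (hY : 0 < Y) (ht : t = 2 * Y ^ 2) (hM : (M:ℝ) ≤ Y) (k : ℕ) (hk : 1 ≤ k) :
    ‖∑ n ∈ Finset.range M, ee (k * ff t n)‖ ≤ (21 * √(√t)) * √k + (14 * √(√t)) / √k := by
  have htp : 0 < t := by rw [ht]; positivity
  have hX : 0 < √t := Real.sqrt_pos.2 htp
  have hX2 : √t ^ 2 = t := Real.sq_sqrt htp.le
  have hkp : (0:ℝ) < k := by exact_mod_cast hk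
  rw [← norm_sum_ee_neg]
  have hMX : (M:ℝ) ≤ √t := hM.trans (Real.le_sqrt_of_sq_le (by nlinarith))
  set X := √t with hXdef
  have := vdc (fun n => -(k * ff t n)) M (k / X) (3 * k / X) (by positivity) (by gcongr; linarith) (by
    intro n hn
    have hn2 : (n:ℝ) + 2 ≤ Y := le_trans (by exact_mod_cast hn) hM
    have hn0 : (0:ℝ) ≤ n := by positivity
    obtain ⟨a1, a2, a3⟩ := ff_bounds hY ht hn0 (by linarith)
    obtain ⟨b1, b2, b3⟩ := ff_bounds (x := (n:ℝ) + 1) hY ht (by linarith) (by linarith)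
    obtain ⟨c1, c2, c3⟩ := ff_bounds (x := (n:ℝ) + 2) hY ht (by linarith) (by linarith)
    have sd := second_diff hX hY (by rw [hX2, ht]) hn0 hn2 a1 b1 c1 a2 b2 c2 (by rw [hX2]; exact a3)
      (by rw [hX2]; exact b3) (by rw [hX2]; exact c3)
    push_cast
    have e1 := mul_le_mul_of_nonneg_left sd.1 hkp.le
    have e2 := mul_le_mul_of_nonneg_left sd.2 hkp.le
    rw [mul_div_assoc', mul_one] at e1
    rw [mul_div_assoc', mul_comm (k:ℝ) 3] at e2
    constructor <;> linarith)
  refine this.trans ?_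
  have hsk : 0 < √(k:ℝ) := Real.sqrt_pos.2 hkp
  have hsX : 0 < √X := Real.sqrt_pos.2 hX
  have hk2 : √(k:ℝ) ^ 2 = k := Real.sq_sqrt hkp.le
  rw [Real.sqrt_div hkp.le]
  have hb : M * (3 * k / X) + 2 ≤ 3 * k + 2 := by
    have : M * (3 * k / X) ≤ X * (3 * k / X) := by gcongr
    have e : X * (3 * k / X) = 3 * k := by field_simp
    linarith
  calc 7 * (M * (3 * k / X) + 2) / (√(k:ℝ) / √X) ≤ 7 * (3 * k + 2) / (√(k:ℝ) / √X) := by gcongr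
    _ = _ := by
      rw [← hk2, Real.sqrt_sq hsk.le]
      field_simp
      ring

lemma ff_cont (t : ℝ) : Continuous (ff t) := by unfold ff; fun_prop

lemma integral_ff {t Y : ℝ} (hY : 0 < Y) (ht : t = 2 * Y ^ 2) :
    ∫ x in (0:ℝ)..Y, ff t x = Real.pi * t / 8 + t / 4 := by
  have htp : 0 < t := by rw [ht]; positivity
  have hX : 0 < √t := Real.sqrt_pos.2 htp
  have hX2 : √t ^ 2 = t := Real.sq_sqrt htp.le
  have hder : ∀ x ∈ Set.uIcc 0 Y, HasDerivAt (fun x => (x * √(t - x ^ 2) + t * Real.arcsin (x / √t)) / 2) (ff t x) x := by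
    intro x hx
    rw [Set.uIcc_of_le hY.le] at hx
    have hx2 : x ^ 2 ≤ Y ^ 2 := pow_le_pow_left₀ hx.1 hx.2 2
    have hp : 0 < t - x ^ 2 := by nlinarith
    have hxX : x / √t < 1 := by
      rw [div_lt_one hX]; apply Real.lt_sqrt_of_sq_lt; linarith
    have hxX0 : 0 ≤ x / √t := div_nonneg hx.1 hX.le
    have d1 : HasDerivAt (fun x => t - x ^ 2) (-(2 * x)) x := by
      simpa using (hasDerivAt_pow 2 x).const_sub t
    have d2 := d1.sqrt hp.ne'
    have d3 := (hasDerivAt_id x).mul d2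
    have d4 := (Real.hasDerivAt_arcsin (x := x / √t) (by linarith) hxX.ne).comp x ((hasDerivAt_id x).div_const √t)
    have d5 := (d3.add (d4.const_mul t)).div_const 2
    refine d5.congr_deriv ?_
    have e1 : √(1 - (x / √t) ^ 2) = √(t - x ^ 2) / √t := by
      rw [← Real.sqrt_div hp.le, div_pow, hX2]
      congr 1; field_simp
    have hs : 0 < √(t - x ^ 2) := Real.sqrt_pos.2 hp
    have hs2 : √(t - x ^ 2) ^ 2 = t - x ^ 2 := Real.sq_sqrt hp.le
    rw [e1]
    simp only [id, ff]
    field_simp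
    rw [hs2]; ring
  rw [intervalIntegral.integral_eq_sub_of_hasDerivAt hder ((ff_cont t).intervalIntegrable _ _)]
  have e1 : √(t - Y ^ 2) = Y := by
    rw [show t - Y ^ 2 = Y ^ 2 by rw [ht]; ring, Real.sqrt_sq hY.le]
  have e2 : Y / √t = Real.sin (Real.pi / 4) := by
    rw [Real.sin_pi_div_four, div_eq_div_iff hX.ne' (by norm_num)]
    rw [ht, Real.sqrt_mul (by norm_num), Real.sqrt_sq hY.le]
    have := Real.mul_self_sqrt (show (0:ℝ) ≤ 2 by norm_num)
    linear_combination (-Y) * this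
  rw [e1, e2, Real.arcsin_sin (by linarith [Real.pi_pos]) (by linarith [Real.pi_pos])]
  simp
  rw [ht]; ring

lemma chord {t x a b u v s : ℝ} (hs0 : 0 ≤ s) (hs1 : s ≤ 1) (hb : b = a + 1) (hx : x = a + s)
    (hu : u ^ 2 = t - a ^ 2) (hv : v ^ 2 = t - b ^ 2) : u + s * (v - u) ≤ ff t x := by
  apply Real.le_sqrt_of_sq_le
  subst hb hx
  nlinarith [mul_nonneg (mul_nonneg hs0 (sub_nonneg.2 hs1)) (sq_nonneg (u - v)), mul_nonneg hs0 (sub_nonneg.2 hs1)]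

lemma tangent {t x a u s : ℝ} (hu0 : 0 < u) (hx : x = a + s)
    (hu : u ^ 2 = t - a ^ 2) (hnn : 0 ≤ u - s * (a / u)) : ff t x ≤ u - s * (a / u) := by
  apply Real.sqrt_le_iff.2 ⟨hnn, ?_⟩
  have : (u - s * (a / u)) ^ 2 = u ^ 2 - 2 * s * a + (s * (a / u)) ^ 2 := by field_simp; ring
  rw [this, hx]
  nlinarith [sq_nonneg (s * (a / u)), sq_nonneg s]

lemma integral_lin (a c d : ℝ) : ∫ x in a..(a+1), (c + (x - a) * d) = c + d / 2 := by
  rw [intervalIntegral.integral_add (by simp) (by apply Continuous.intervalIntegrable; fun_prop),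
    intervalIntegral.integral_mul_const, intervalIntegral.integral_sub (by simp) (by simp)]
  simp
  ring

lemma trap {t Y : ℝ} {M : ℕ} (hY : 0 < Y) (ht : t = 2 * Y ^ 2) (hM : (M:ℝ) ≤ Y) :
    |∑ n ∈ Finset.range M, (ff t n + ff t (n+1)) / 2 - ∫ x in (0:ℝ)..M, ff t x| ≤ 1 / 2 := by
  have hint : ∀ a b, IntervalIntegrable (ff t) MeasureTheory.volume a b := fun a b => (ff_cont t).intervalIntegrable a b
  have key : ∀ K ≤ M, 0 ≤ (∫ x in (0:ℝ)..K, ff t x) - ∑ n ∈ Finset.range K, (ff t n + ff t (n+1)) / 2 ∧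
      (∫ x in (0:ℝ)..K, ff t x) - ∑ n ∈ Finset.range K, (ff t n + ff t (n+1)) / 2 ≤ (K / ff t K) / 2 := by
    intro K
    induction K with
    | zero => intro _; simp
    | succ K ih =>
      intro hK
      obtain ⟨i1, i2⟩ := ih (by omega)
      have hKY : (K:ℝ) + 1 ≤ Y := le_trans (by exact_mod_cast hK) hM
      have hK0 : (0:ℝ) ≤ K := by positivity
      obtain ⟨a1, a2, a3⟩ := ff_bounds hY ht hK0 (by linarith)
      obtain ⟨b1, b2, b3⟩ := ff_bounds (x := (K:ℝ) + 1) hY ht (by linarith) (by linarith)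
      rw [Finset.sum_range_succ]
      push_cast
      rw [← intervalIntegral.integral_add_adjacent_intervals (hint 0 K) (hint K (K+1))]
      set u := ff t K
      set v := ff t (K+1)
      have hu0 : 0 < u := by linarith
      have hv0 : 0 < v := by linarith
      have low : u + (v - u) / 2 ≤ ∫ x in (K:ℝ)..(K+1), ff t x := by
        rw [← integral_lin K u (v - u)]
        apply intervalIntegral.integral_mono_on (by linarith) (by apply Continuous.intervalIntegrable; fun_prop) (hint _ _)
        intro x hx
        exact chord (s := x - K) (by linarith [hx.1]) (by linarith [hx.2]) rfl (by ring) a3 b3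
      have hau : K / u ≤ 1 := by rw [div_le_one hu0]; linarith
      have hau0 : 0 ≤ K / u := by positivity
      have hY1 : 1 ≤ u := by linarith
      have up : (∫ x in (K:ℝ)..(K+1), ff t x) ≤ u + (-(K / u)) / 2 := by
        rw [← integral_lin K u (-(K / u))]
        apply intervalIntegral.integral_mono_on (by linarith) (hint _ _) (by apply Continuous.intervalIntegrable; fun_prop)
        intro x hx
        have := tangent (t := t) (x := x) (a := K) (u := u) (s := x - K) hu0 (by ring) a3 (by nlinarith [hx.1, hx.2])
        linarith
      have hd : u - v ≤ (K + 1) / v := by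
        rw [le_div_iff₀ hv0]
        nlinarith [sq_nonneg (u - v)]
      constructor <;> linarith
  obtain ⟨k1, k2⟩ := key M le_rfl
  obtain ⟨a1, a2, a3⟩ := ff_bounds hY ht (Nat.cast_nonneg M) hM
  have : (M:ℝ) / ff t M ≤ 1 := by rw [div_le_one (by linarith)]; linarith
  rw [abs_le]
  constructor <;> linarith

lemma end_int {t Y : ℝ} {M : ℕ} (hY : 0 < Y) (ht : t = 2 * Y ^ 2) (hM : (M:ℝ) ≤ Y) (hM' : Y < M + 1) :
    ff t M ≤ Y + 1 ∧ (Y - M) * Y ≤ ∫ x in (M:ℝ)..Y, ff t x ∧ ∫ x in (M:ℝ)..Y, ff t x ≤ (Y - M) * Y + 1 := by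
  have hint : ∀ a b, IntervalIntegrable (ff t) MeasureTheory.volume a b := fun a b => (ff_cont t).intervalIntegrable a b
  obtain ⟨a1, a2, a3⟩ := ff_bounds hY ht (Nat.cast_nonneg M) hM
  have hM0 : (0:ℝ) ≤ M := by positivity
  have h1 : ff t M ≤ Y + 1 := by
    by_contra hc
    push Not at hc
    nlinarith
  refine ⟨h1, ?_, ?_⟩
  · have := intervalIntegral.integral_mono_on (μ := MeasureTheory.volume) (f := fun _ => Y) (g := ff t) hM (by simp) (hint _ _) (fun x hx =>
      (ff_bounds hY ht (hM0.trans hx.1) hx.2).1)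
    simpa using this
  · have := intervalIntegral.integral_mono_on (μ := MeasureTheory.volume) (f := ff t) (g := fun _ => Y + 1) hM (hint _ _) (by simp) (fun x hx => by
      refine le_trans ?_ h1
      apply Real.sqrt_le_sqrt
      have := pow_le_pow_left₀ hM0 hx.1 2
      linarith)
    simp at this
    nlinarith

lemma sum_even (M : ℕ) (g : ℤ → ℤ) (hg : ∀ a, g (-a) = g a) :
    ∑ a ∈ Finset.Icc (-(M:ℤ)) M, g a = ∑ n ∈ Finset.range M, (g n + g (n + 1)) + g M := by
  induction M with
  | zero => simp
  | succ M ih =>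
    have e : Finset.Icc (-((M + 1 : ℕ):ℤ)) ((M + 1 : ℕ):ℤ) =
        insert (-((M:ℤ) + 1)) (insert ((M:ℤ) + 1) (Finset.Icc (-(M:ℤ)) M)) := by
      ext a
      simp only [Finset.mem_Icc, Finset.mem_insert]
      push_cast
      omega
    rw [e, Finset.sum_insert (by simp; omega), Finset.sum_insert (by simp), ih, Finset.sum_range_succ, hg]
    push_cast
    ring

lemma count {t Y : ℝ} {M : ℕ} (hY : 0 < Y) (ht : t = 2 * Y ^ 2) (hM : (M:ℝ) ≤ Y) (hM' : Y < M + 1) :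
    (({p : ℤ × ℤ | (p.1 : ℝ) ^ 2 + (p.2 : ℝ) ^ 2 ≤ t}.ncard : ℤ)) =
      2 * (∑ a ∈ Finset.Icc (-(M:ℤ)) M, (2 * ⌊ff t a⌋ + 1)) - (2 * M + 1) ^ 2 := by
  classical
  have hmemM : ∀ a : ℤ, a ∈ Finset.Icc (-(M:ℤ)) M ↔ (a:ℝ) ^ 2 ≤ Y ^ 2 := by
    intro a
    rw [Finset.mem_Icc, ← abs_le, sq_le_sq, abs_of_pos hY]
    have e : |(a:ℝ)| = ((|a| : ℤ) : ℝ) := by push_cast; rfl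
    rw [e]
    constructor
    · intro h
      exact le_trans (by exact_mod_cast h) hM
    · intro h
      have : ((|a| : ℤ) : ℝ) < ((M + 1 : ℤ) : ℝ) := by push_cast; push_cast at h; linarith
      have : |a| < (M:ℤ) + 1 := by exact_mod_cast this
      omega
  set I := Finset.Icc (-(M:ℤ)) M with hI
  set S1 : Finset (ℤ × ℤ) := (I.sigma (fun a => Finset.Icc (-⌊ff t a⌋) ⌊ff t a⌋)).map
    (Equiv.sigmaEquivProd ℤ ℤ).toEmbedding with hS1
  set S2 : Finset (ℤ × ℤ) := S1.map (Equiv.prodComm ℤ ℤ).toEmbedding with hS2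
  have m1 : ∀ p : ℤ × ℤ, p ∈ S1 ↔ (p.1:ℝ) ^ 2 ≤ Y ^ 2 ∧ (p.1 : ℝ) ^ 2 + (p.2 : ℝ) ^ 2 ≤ t := by
    rintro ⟨a, b⟩
    have : (a, b) ∈ S1 ↔ a ∈ I ∧ b ∈ Finset.Icc (-⌊ff t a⌋) ⌊ff t a⌋ := by
      rw [hS1, Finset.mem_map_equiv, Finset.mem_sigma]; rfl
    rw [this, hmemM]
    refine and_congr_right fun ha => ?_
    have hnn : 0 ≤ t - (a:ℝ) ^ 2 := by nlinarith only [ha, ht, sq_nonneg Y]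
    rw [Finset.mem_Icc, ← abs_le, Int.le_floor, ff, Real.le_sqrt (by positivity) hnn]
    push_cast
    rw [sq_abs, le_sub_iff_add_le']
  have m2 : ∀ p : ℤ × ℤ, p ∈ S2 ↔ (p.2:ℝ) ^ 2 ≤ Y ^ 2 ∧ (p.1 : ℝ) ^ 2 + (p.2 : ℝ) ^ 2 ≤ t := by
    rintro ⟨a, b⟩
    rw [hS2, Finset.mem_map_equiv, m1]
    simp [add_comm]
  have hU : {p : ℤ × ℤ | (p.1 : ℝ) ^ 2 + (p.2 : ℝ) ^ 2 ≤ t} = ((S1 ∪ S2 : Finset (ℤ × ℤ)) : Set (ℤ × ℤ)) := by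
    ext p
    rw [Finset.mem_coe, Finset.mem_union, m1, m2, Set.mem_ofPred_eq]
    constructor
    · intro h
      by_cases h1 : (p.1:ℝ) ^ 2 ≤ Y ^ 2
      · exact Or.inl ⟨h1, h⟩
      · exact Or.inr ⟨by push Not at h1; linarith, h⟩
    · rintro (h | h) <;> exact h.2
  have hInt : S1 ∩ S2 = I ×ˢ I := by
    ext p
    rw [Finset.mem_inter, m1, m2, Finset.mem_product, hmemM, hmemM]
    constructor
    · rintro ⟨h1, h2⟩; exact ⟨h1.1, h2.1⟩
    · rintro ⟨h1, h2⟩; exact ⟨⟨h1, by linarith⟩, ⟨h2, by linarith⟩⟩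
  have hc := Finset.card_union_add_card_inter S1 S2
  have hIc : (I.card : ℤ) = 2 * M + 1 := by rw [hI, Int.card_Icc]; omega
  have hS1c : (S1.card : ℤ) = ∑ a ∈ I, (2 * ⌊ff t a⌋ + 1) := by
    rw [hS1, Finset.card_map, Finset.card_sigma]
    push_cast
    refine Finset.sum_congr rfl fun a _ => ?_
    have : 0 ≤ ⌊ff t a⌋ := Int.floor_nonneg.2 (Real.sqrt_nonneg _)
    rw [Int.card_Icc]; omega
  have hS2c : S2.card = S1.card := by rw [hS2, Finset.card_map]
  rw [hU, Set.ncard_coe_finset, ← hS1c, ← hIc]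
  rw [hInt, hS2c, Finset.card_product] at hc
  have hc' : ((S1 ∪ S2).card : ℤ) + I.card * I.card = S1.card + S1.card := by exact_mod_cast hc
  linarith

lemma main_bound {s : ℝ} (hs : 1 ≤ s) {t : ℝ} (hst : t = s ^ 6) :
    |(({p : ℤ × ℤ | (p.1 : ℝ) ^ 2 + (p.2 : ℝ) ^ 2 ≤ t}.ncard : ℝ)) - Real.pi * t| ≤ 2300 * s ^ 2 := by
  have hs0 : 0 < s := by linarith
  have htp : 0 < t := by rw [hst]; positivity
  set Y := √(t / 2) with hYd
  have hY : 0 < Y := Real.sqrt_pos.2 (by linarith)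
  have ht : t = 2 * Y ^ 2 := by rw [hYd, Real.sq_sqrt (by linarith)]; ring
  set M := ⌊Y⌋₊ with hMd
  have hM : (M:ℝ) ≤ Y := Nat.floor_le hY.le
  have hM' : Y < M + 1 := Nat.lt_floor_add_one Y
  have hX : √t = s ^ 3 := by rw [hst, show s ^ 6 = (s ^ 3) ^ 2 by ring, Real.sqrt_sq (by positivity)]
  have hss : 0 < √s := Real.sqrt_pos.2 hs0
  have hss2 : √s ^ 2 = s := Real.sq_sqrt hs0.le
  have hXX : √(√t) = s * √s := by
    rw [hX, show s ^ 3 = s ^ 2 * s by ring, Real.sqrt_mul (by positivity), Real.sqrt_sq hs0.le]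
  have hMs : (M:ℝ) ≤ s ^ 3 := by
    rw [← hX]; exact hM.trans (Real.sqrt_le_sqrt (by linarith))
  -- sawtooth bound
  have saw := saw_sum_bound (fun n => ff t n) M (21 * √(√t)) (14 * √(√t)) (1 / s) (by positivity)
    (by rw [div_le_one hs0]; exact hs) (by positivity) (by positivity)
    (fun k hk => exp_sum_bound hY ht hM k hk)
  have sawb : |∑ n ∈ Finset.range M, (Int.fract (ff t n) - 1 / 2)| ≤ 281 * s ^ 2 := by
    refine saw.trans ?_
    rw [hXX, Real.sqrt_div (by norm_num), Real.sqrt_one]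
    have e1 : (M:ℝ) * (1 / s) ≤ s ^ 2 := by
      calc (M:ℝ) * (1 / s) ≤ s ^ 3 * (1 / s) := by gcongr
        _ = s ^ 2 := by field_simp
    have e2 : 21 * (s * √s) / (1 / √s) = 21 * s ^ 2 := by
      rw [div_div_eq_mul_div, div_one]; nlinarith
    have e3 : √s ≤ s := by rw [Real.sqrt_le_left hs0.le]; nlinarith
    have e4 : 14 * (s * √s) ≤ 14 * s ^ 2 := by nlinarith
    rw [e2]; linarith
  have cnt := count hY ht hM hM'
  rw [sum_even M (fun a => 2 * ⌊ff t a⌋ + 1) (by intro a; simp [ff])] at cnt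
  have cntR : (({p : ℤ × ℤ | (p.1 : ℝ) ^ 2 + (p.2 : ℝ) ^ 2 ≤ t}.ncard : ℝ)) =
      2 * (∑ n ∈ Finset.range M, ((2 * (⌊ff t n⌋ : ℝ) + 1) + (2 * (⌊ff t (n+1)⌋ : ℝ) + 1)) + (2 * (⌊ff t M⌋ : ℝ) + 1)) - (2 * M + 1) ^ 2 := by
    have := congrArg (Int.cast : ℤ → ℝ) cnt
    push_cast at this
    exact this
  have flo : ∀ x : ℝ, 2 * (⌊x⌋ : ℝ) + 1 = 2 * x - 2 * (Int.fract x - 1 / 2) := by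
    intro x
    have := Int.fract_add_floor x
    linarith
  simp only [flo] at cntR
  have tel : ∑ n ∈ Finset.range M, (Int.fract (ff t (n+1)) - 1 / 2) =
      ∑ n ∈ Finset.range M, (Int.fract (ff t n) - 1 / 2) + (Int.fract (ff t M) - Int.fract (ff t 0)) := by
    have := Finset.sum_range_sub (fun n : ℕ => Int.fract (ff t n) - 1 / 2) M
    rw [Finset.sum_sub_distrib] at this
    push_cast at this
    linarith
  have spl : ∑ n ∈ Finset.range M, ((2 * ff t n - 2 * (Int.fract (ff t n) - 1 / 2)) + (2 * ff t (n+1) - 2 * (Int.fract (ff t (n+1)) - 1 / 2)))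
      = 4 * ∑ n ∈ Finset.range M, (ff t n + ff t (n+1)) / 2 - 2 * ∑ n ∈ Finset.range M, (Int.fract (ff t n) - 1 / 2)
        - 2 * ∑ n ∈ Finset.range M, (Int.fract (ff t (n+1)) - 1 / 2) := by
    rw [Finset.mul_sum, Finset.mul_sum, Finset.mul_sum, ← Finset.sum_sub_distrib, ← Finset.sum_sub_distrib]
    exact Finset.sum_congr rfl fun n _ => by ring
  rw [spl, tel] at cntR
  have tr := trap hY ht hM
  obtain ⟨g1, g2, g3⟩ := end_int hY ht hM hM'
  have g0 := (ff_bounds hY ht (Nat.cast_nonneg M) hM).1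
  have J := integral_ff hY ht
  rw [← intervalIntegral.integral_add_adjacent_intervals ((ff_cont t).intervalIntegrable 0 M) ((ff_cont t).intervalIntegrable M Y)] at J
  have p0 := Int.fract_nonneg (ff t M)
  have p1 := (Int.fract_lt_one (ff t M)).le
  have q0 := Int.fract_nonneg (ff t 0)
  have q1 := (Int.fract_lt_one (ff t 0)).le
  rw [abs_le] at tr sawb
  obtain ⟨t1, t2⟩ := tr
  obtain ⟨w1, w2⟩ := sawb
  rw [cntR]
  generalize (∑ n ∈ Finset.range M, (Int.fract (ff t n) - 1 / 2)) = Ψ at *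
  generalize (∑ n ∈ Finset.range M, (ff t n + ff t (n+1)) / 2) = T at *
  generalize (∫ x in (0:ℝ)..M, ff t x) = J1 at *
  generalize (∫ x in (M:ℝ)..Y, ff t x) = J2 at *
  have hs2 : 1 ≤ s ^ 2 := by nlinarith
  have z1 : (2 * (M:ℝ) + 1) ^ 2 = 2 * t - 8 * ((Y - M) * Y) + 4 * Y + (4 * (Y - M) ^ 2 - 4 * (Y - M) + 1) := by
    rw [ht]; ring
  have z2 : 0 ≤ 4 * (Y - M) ^ 2 - 4 * (Y - M) + 1 := by nlinarith only [sq_nonneg (2 * (Y - M) - 1)]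
  have z3 : 4 * (Y - M) ^ 2 - 4 * (Y - M) + 1 ≤ 1 := by nlinarith only [hM, hM']
  rw [z1, abs_le]
  generalize 4 * (Y - M) ^ 2 - 4 * (Y - M) + 1 = Q at *
  constructor <;> linarith

/-- Sierpiński (1906): the number `R(t)` of integer points `(a,b)` with `a² + b² ≤ t`
satisfies `|R(t) − πt| = O(t^{1/3})` as `t → ∞`. -/
theorem sierpinski_circle_problem :
    ∃ C : ℝ, 0 < C ∧ ∃ t₀ : ℝ, ∀ t : ℝ, t₀ ≤ t →
      |(({p : ℤ × ℤ | (p.1 : ℝ) ^ 2 + (p.2 : ℝ) ^ 2 ≤ t}.ncard : ℝ)) - Real.pi * t|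
        ≤ C * t ^ ((1 : ℝ) / 3) := by
  refine ⟨2300, by norm_num, 1, fun t ht => ?_⟩
  have ht0 : 0 ≤ t := by linarith
  have h := main_bound (s := t ^ ((1:ℝ) / 6)) (Real.one_le_rpow ht (by norm_num)) (t := t) (by
    rw [← Real.rpow_natCast, ← Real.rpow_mul ht0]; norm_num)
  rw [← Real.rpow_natCast, ← Real.rpow_mul ht0] at h
  norm_num at h ⊢
  exact h
end

section
/- Let Γ be a finitely generated abelian group of free rank r (so Γ ≅ ℤ^r ⊕ T with T its finite torsion subgroup), and let S be a finite generating set of Γ. Writing β(k) for the cardinality of the ball (S ∪ (−S) ∪ {0}) summed with itself k times (the set of sums of at most k elements of S ∪ (−S)), one has lim_{k→∞} (log β(k)) / (log k) = r. -/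
open Pointwise

/-- The `k`-fold iterated sumset of a subset `B` of an additive group:
`sumsetPow B 0 = {0}` and `sumsetPow B (k+1) = sumsetPow B k + B`. -/
def sumsetPow {A : Type*} [AddCommGroup A] (B : Set A) : ℕ → Set A
  | 0 => {0}
  | k + 1 => sumsetPow B k + B

theorem sp_add {A : Type*} [AddCommGroup A] (B : Set A) {m n : ℕ} {x y : A}
    (hx : x ∈ sumsetPow B m) (hy : y ∈ sumsetPow B n) : x + y ∈ sumsetPow B (m + n) := by
  induction n generalizing y with
  | zero =>
    have : y = 0 := hy
    subst this
    simpa using hx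
  | succ n ih =>
    obtain ⟨a, ha, b, hb, rfl⟩ := Set.mem_add.1 (show y ∈ sumsetPow B n + B from hy)
    rw [← add_assoc x a b]
    exact Set.add_mem_add (ih ha) hb

theorem sp_zero {A : Type*} [AddCommGroup A] (B : Set A) (h0 : (0 : A) ∈ B) (n : ℕ) :
    (0 : A) ∈ sumsetPow B n := by
  induction n with
  | zero => exact rfl
  | succ n ih => exact Set.mem_add.2 ⟨0, ih, 0, h0, add_zero 0⟩

theorem sp_mono {A : Type*} [AddCommGroup A] (B : Set A) (h0 : (0 : A) ∈ B) {m n : ℕ}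
    (h : m ≤ n) : sumsetPow B m ⊆ sumsetPow B n := by
  intro x hx
  obtain ⟨d, rfl⟩ := Nat.exists_eq_add_of_le h
  simpa using sp_add B hx (sp_zero B h0 d)

theorem sp_neg {A : Type*} [AddCommGroup A] (B : Set A) (hn : ∀ b ∈ B, -b ∈ B) {n : ℕ} {x : A}
    (hx : x ∈ sumsetPow B n) : -x ∈ sumsetPow B n := by
  induction n generalizing x with
  | zero =>
    have : x = 0 := hx
    subst this
    exact neg_zero
  | succ n ih =>
    obtain ⟨a, ha, b, hb, rfl⟩ := Set.mem_add.1 (show x ∈ sumsetPow B n + B from hx)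
    rw [neg_add]
    exact Set.add_mem_add (ih ha) (hn b hb)

theorem sp_nsmul {A : Type*} [AddCommGroup A] (B : Set A) {n : ℕ} {x : A}
    (hx : x ∈ sumsetPow B n) (k : ℕ) : k • x ∈ sumsetPow B (k * n) := by
  induction k with
  | zero => rw [zero_smul, zero_mul]; exact rfl
  | succ k ih => rw [succ_nsmul, Nat.succ_mul]; exact sp_add B ih hx

theorem sp_sum {A ι : Type*} [AddCommGroup A] (B : Set A) {n : ℕ} (f : ι → A)
    (hf : ∀ i, f i ∈ sumsetPow B n) (s : Finset ι) :
    ∑ i ∈ s, f i ∈ sumsetPow B (s.card * n) := by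
  classical
  induction s using Finset.induction_on with
  | empty => simp [sumsetPow]
  | insert a s ha ih =>
    rw [Finset.sum_insert ha, Finset.card_insert_of_notMem ha, Nat.succ_mul, add_comm (f a)]
    exact sp_add B ih (hf a)

theorem sp_exists {A : Type*} [AddCommGroup A] (S : Set A)
    (hgen : AddSubgroup.closure S = ⊤) (x : A) :
    ∃ n, x ∈ sumsetPow (S ∪ -S ∪ {0}) n := by
  have hx : x ∈ AddSubgroup.closure S := by rw [hgen]; trivial
  induction hx using AddSubgroup.closure_induction with
  | mem x hx => exact ⟨1, Set.mem_add.2 ⟨0, rfl, x, Or.inl (Or.inl hx), zero_add x⟩⟩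
  | zero => exact ⟨0, rfl⟩
  | add x y _ _ h1 h2 =>
    obtain ⟨m, hm⟩ := h1
    obtain ⟨n, hn⟩ := h2
    exact ⟨m + n, sp_add _ hm hn⟩
  | neg x _ h =>
    obtain ⟨m, hm⟩ := h
    refine ⟨m, sp_neg _ ?_ hm⟩
    rintro b ((hb | hb) | hb)
    · exact Or.inl (Or.inr (by simpa using hb))
    · exact Or.inl (Or.inl hb)
    · right
      have : b = 0 := hb
      simp [this]

theorem sp_upper {A : Type*} [AddCommGroup A] (r : ℕ) {T : Type*} [AddCommGroup T] [Fintype T]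
    (e : A ≃+ (Fin r → ℤ) × T) (B : Set A) (hB : B.Finite) :
    ∃ M : ℕ, ∀ k, (sumsetPow B k).Finite ∧
      (sumsetPow B k).ncard ≤ (2 * (k * M) + 1) ^ r * Fintype.card T := by
  classical
  obtain ⟨M, hM⟩ : ∃ M : ℕ, ∀ b ∈ B, ∀ i, |(e b).1 i| ≤ (M : ℤ) := by
    refine ⟨∑ b ∈ hB.toFinset, ∑ i, ((e b).1 i).natAbs, fun b hb i => ?_⟩
    rw [Int.abs_eq_natAbs]
    have h1 : ((e b).1 i).natAbs ≤ ∑ i, ((e b).1 i).natAbs :=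
      Finset.single_le_sum (f := fun i => ((e b).1 i).natAbs)
        (fun _ _ => Nat.zero_le _) (Finset.mem_univ i)
    have h2 : ∑ i, ((e b).1 i).natAbs ≤ ∑ b ∈ hB.toFinset, ∑ i, ((e b).1 i).natAbs :=
      Finset.single_le_sum (f := fun b => ∑ i, ((e b).1 i).natAbs)
        (fun _ _ => Nat.zero_le _) (hB.mem_toFinset.2 hb)
    exact_mod_cast h1.trans h2
  have key : ∀ k, ∀ x ∈ sumsetPow B k, ∀ i, |(e x).1 i| ≤ ((k * M : ℕ) : ℤ) := by
    intro k
    induction k with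
    | zero =>
      intro x hx i
      have : x = 0 := hx
      simp [this]
    | succ k ih =>
      intro x hx i
      obtain ⟨a, ha, b, hb, rfl⟩ := Set.mem_add.1 (show x ∈ sumsetPow B k + B from hx)
      have h1 := ih a ha i
      have h2 := hM b hb i
      have h3 := abs_add_le ((e a).1 i) ((e b).1 i)
      rw [map_add, Prod.fst_add, Pi.add_apply]
      push_cast at *
      linarith
  refine ⟨M, fun k => ?_⟩
  let F : Finset ((Fin r → ℤ) × T) :=
    (Fintype.piFinset fun _ => Finset.Icc (-((k * M : ℕ) : ℤ)) ((k * M : ℕ) : ℤ)) ×ˢ Finset.univ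
  have hmaps : ∀ x ∈ sumsetPow B k, e x ∈ (F : Set ((Fin r → ℤ) × T)) := by
    intro x hx
    simp only [F, Finset.mem_coe, Finset.mem_product, Fintype.mem_piFinset, Finset.mem_Icc,
      Finset.mem_univ, and_true]
    exact fun i => abs_le.1 (key k x hx i)
  have hcard : F.card = (2 * (k * M) + 1) ^ r * Fintype.card T := by
    simp only [F, Finset.card_product, Fintype.card_piFinset, Int.card_Icc, Finset.prod_const,
      Finset.card_univ, Fintype.card_fin]
    congr 2
    omega
  constructor
  · exact Set.Finite.of_injOn hmaps e.injective.injOn F.finite_toSet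
  · rw [← hcard, ← Set.ncard_coe_finset]
    exact Set.ncard_le_ncard_of_injOn e hmaps e.injective.injOn F.finite_toSet

theorem sp_lower {A : Type*} [AddCommGroup A] (r : ℕ) {T : Type*} [AddCommGroup T]
    (e : A ≃+ (Fin r → ℤ) × T) (B : Set A) (h0 : (0 : A) ∈ B)
    (hB : ∀ k, (sumsetPow B k).Finite) (hex : ∀ x, ∃ n, x ∈ sumsetPow B n) :
    ∃ C : ℕ, 0 < C ∧ ∀ k, (k / C + 1) ^ r ≤ (sumsetPow B k).ncard := by
  classical
  let g : Fin r → A := fun i => e.symm (Pi.single i 1, 0)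
  choose n hn using fun i => hex (g i)
  let N := ∑ i, n i
  have hN : ∀ i, g i ∈ sumsetPow B N := fun i =>
    sp_mono B h0 (Finset.single_le_sum (f := n) (fun _ _ => Nat.zero_le _) (Finset.mem_univ i))
      (hn i)
  refine ⟨r * N + 1, Nat.succ_pos _, fun k => ?_⟩
  set m := k / (r * N + 1) with hm
  have hmk : r * (m * N) ≤ k := by
    have h : m * (r * N + 1) ≤ k := Nat.div_mul_le_self _ _
    nlinarith
  let φ : (Fin r → Fin (m + 1)) → A := fun x => ∑ i, (x i : ℕ) • g i
  have hφ : ∀ x, φ x ∈ sumsetPow B k := by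
    intro x
    have := sp_sum B (n := m * N) (fun i => (x i : ℕ) • g i)
      (fun i => sp_mono B h0 (Nat.mul_le_mul_right N (Nat.lt_succ_iff.1 (x i).2))
        (sp_nsmul B (hN i) _)) Finset.univ
    rw [Finset.card_univ, Fintype.card_fin] at this
    exact sp_mono B h0 hmk this
  have hval : ∀ x j, (e (φ x)).1 j = ((x j : ℕ) : ℤ) := by
    intro x j
    simp [φ, g, map_sum, Prod.fst_sum, Finset.sum_apply, Pi.single_apply]
  have hinj : Function.Injective φ := by
    intro x y hxy
    funext j
    have h1 := hval x j
    rw [hxy, hval y j] at h1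
    exact Fin.ext (by exact_mod_cast h1.symm)
  have h := Set.ncard_le_ncard_of_injOn (s := Set.univ) φ (fun x _ => hφ x) hinj.injOn (hB k)
  rw [Set.ncard_univ, Nat.card_eq_fintype_card] at h
  simpa using h

theorem sp_limit (r : ℕ) (β : ℕ → ℕ) (C D : ℝ) (hC : 0 < C) (hD : 0 < D)
    (h1 : ∀ k : ℕ, 1 ≤ k → ((k : ℝ) / C) ^ r ≤ β k)
    (h2 : ∀ k : ℕ, 1 ≤ k → (β k : ℝ) ≤ (k : ℝ) ^ r * D) :
    Filter.Tendsto (fun k : ℕ => Real.log (β k) / Real.log k) Filter.atTop (nhds (r : ℝ)) := by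
  have hlog : Filter.Tendsto (fun k : ℕ => Real.log (k : ℝ)) Filter.atTop Filter.atTop :=
    Real.tendsto_log_atTop.comp tendsto_natCast_atTop_atTop
  have hc : ∀ c : ℝ, Filter.Tendsto (fun k : ℕ => (r : ℝ) + c / Real.log k) Filter.atTop
      (nhds (r : ℝ)) := by
    intro c
    simpa using (hlog.const_div_atTop c).const_add (r : ℝ)
  refine tendsto_of_tendsto_of_tendsto_of_le_of_le' (hc (-(r * Real.log C))) (hc (Real.log D)) ?_ ?_
  all_goals
    filter_upwards [Filter.eventually_ge_atTop 2] with k hk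
    have hk0 : (0 : ℝ) < k := by positivity
    have hl : 0 < Real.log k := Real.log_pos (by exact_mod_cast hk)
    have hp : 0 < ((k : ℝ) / C) ^ r := by positivity
    have hb := h1 k (by omega)
    have hb2 := h2 k (by omega)
    have e1 := Real.log_le_log hp hb
    have e2 := Real.log_le_log (hp.trans_le hb) hb2
    rw [Real.log_pow, Real.log_div hk0.ne' hC.ne'] at e1
    rw [Real.log_mul (by positivity) hD.ne', Real.log_pow] at e2
  · rw [le_div_iff₀ hl, add_mul, div_mul_cancel₀ _ hl.ne']
    linarith
  · rw [div_le_iff₀ hl, add_mul, div_mul_cancel₀ _ hl.ne']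
    linarith

/-- Krause (1953): if `Γ` is a finitely generated abelian group of free rank `r`
(so `Γ ≅ ℤ^r ⊕ T` with `T` finite) and `S` is a finite generating set, then the
cardinality `β(k)` of the ball of radius `k` (sums of at most `k` elements of `S ∪ (−S)`)
satisfies `lim_{k→∞} (log β(k)) / (log k) = r`. -/
theorem krause_polynomial_growth_rate {A : Type*} [AddCommGroup A] (r : ℕ)
    {T : Type*} [AddCommGroup T] [Fintype T]
    (hiso : Nonempty (A ≃+ (Fin r → ℤ) × T))
    (S : Finset A) (hgen : AddSubgroup.closure (S : Set A) = ⊤) :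
    Filter.Tendsto
      (fun k : ℕ =>
        Real.log ((sumsetPow ((S : Set A) ∪ -(S : Set A) ∪ {0}) k).ncard) / Real.log k)
      Filter.atTop (nhds (r : ℝ)) := by
  obtain ⟨e⟩ := hiso
  have hfin : ((S : Set A) ∪ -(S : Set A) ∪ {0}).Finite :=
    (S.finite_toSet.union S.finite_toSet.neg).union (Set.finite_singleton 0)
  obtain ⟨M, hM⟩ := sp_upper r e _ hfin
  obtain ⟨C, hC, hlow⟩ := sp_lower r e ((S : Set A) ∪ -(S : Set A) ∪ {0}) (Or.inr rfl)
    (fun k => (hM k).1) (sp_exists _ hgen)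
  have hT : (0 : ℝ) < Fintype.card T := by exact_mod_cast Fintype.card_pos
  refine sp_limit r _ C ((2 * M + 1) ^ r * Fintype.card T) (by exact_mod_cast hC)
    (by positivity) ?_ ?_
  · intro k _
    have h : (((k / C + 1 : ℕ) : ℝ)) ^ r ≤
        ((sumsetPow ((S : Set A) ∪ -(S : Set A) ∪ {0}) k).ncard : ℝ) := by
      exact_mod_cast hlow k
    refine le_trans ?_ h
    have hC' : (0 : ℝ) < C := by exact_mod_cast hC
    have : (k : ℝ) / C ≤ ((k / C + 1 : ℕ) : ℝ) := by
      rw [div_le_iff₀ hC']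
      have := (Nat.lt_div_mul_add (a := k) hC).le
      have h3 : k ≤ (k / C + 1) * C := by rw [add_mul, one_mul]; exact this
      exact_mod_cast h3
    gcongr
  · intro k hk
    have h : ((sumsetPow ((S : Set A) ∪ -(S : Set A) ∪ {0}) k).ncard : ℝ) ≤
        (2 * (k * M) + 1) ^ r * Fintype.card T := by exact_mod_cast (hM k).2
    refine h.trans ?_
    rw [← mul_assoc ((k : ℝ) ^ r), ← mul_pow]
    have hk' : (1 : ℝ) ≤ k := by exact_mod_cast hk
    have : (2 * (k * M) + 1 : ℝ) ≤ k * (2 * M + 1) := by nlinarith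
    gcongr
end

section
/- Let Γ be a group generated by a finite set S, and suppose Γ has subexponential growth: for every ε > 0, |B_S(k)| = o(e^{εk}) as k → ∞. Then Γ satisfies the Følner condition: for every finite subset F ⊆ Γ and every ε > 0, there exists a nonempty finite subset A ⊆ Γ such that |gA △ A| ≤ ε·|A| for every g ∈ F. (A group satisfying the Følner condition is amenable.) -/
open Pointwise

/-- Adel'son–Vel'skii and Sreider (1957), Theorem 2: a finitely generated group of
subexponential growth satisfies the Følner condition (hence is amenable): for every finite
`F ⊆ Γ` and every `ε > 0` there is a nonempty finite `A ⊆ Γ` with `|gA △ A| ≤ ε|A|`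
for all `g ∈ F`. -/
theorem subexponential_growth_implies_folner {Γ : Type*} [Group Γ] [DecidableEq Γ]
    (S : Finset Γ) (hgen : Subgroup.closure (S : Set Γ) = ⊤)
    (hsub : ∀ ε : ℝ, 0 < ε →
      Filter.Tendsto
        (fun k : ℕ => (((((S : Set Γ) ∪ (S : Set Γ)⁻¹ ∪ {1}) ^ k).ncard : ℝ)) / Real.exp (ε * k))
        Filter.atTop (nhds 0)) :
    ∀ (F : Finset Γ) (ε : ℝ), 0 < ε → ∃ A : Finset Γ, A.Nonempty ∧
      ∀ g ∈ F, ((symmDiff (g • A) A).card : ℝ) ≤ ε * A.card := by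
  intro F ε hε
  obtain ⟨T, hT⟩ : ∃ T : Finset Γ, T = S ∪ S⁻¹ ∪ {1} := ⟨_, rfl⟩
  have hTc : ((S : Set Γ) ∪ (S : Set Γ)⁻¹ ∪ {1}) = (T : Set Γ) := by
    rw [hT]; push_cast; rfl
  have h1 : (1 : Γ) ∈ T := by simp [hT]
  have hinv : T⁻¹ = T := by
    ext x
    simp only [hT, Finset.mem_inv', Finset.mem_union, Finset.mem_singleton, inv_inv, inv_eq_one]
    tauto
  have hmono : ∀ {a b : ℕ}, a ≤ b → T ^ a ⊆ T ^ b := fun h => Finset.pow_subset_pow_right h1 h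
  have hne : ∀ n : ℕ, (T ^ n).Nonempty := fun n => Finset.Nonempty.pow ⟨1, h1⟩
  have hcov : ∀ g : Γ, ∃ n : ℕ, g ∈ T ^ n := by
    intro g
    have hg : g ∈ Subgroup.closure (S : Set Γ) := by rw [hgen]; trivial
    induction hg using Subgroup.closure_induction with
    | mem x hx =>
      refine ⟨1, ?_⟩
      have hx2 : x ∈ S := hx
      simp [hT, hx2]
    | one => exact ⟨0, by simp⟩
    | mul x y _ _ hx hy =>
      obtain ⟨a, ha⟩ := hx
      obtain ⟨b, hb⟩ := hy
      exact ⟨a + b, by rw [pow_add]; exact Finset.mul_mem_mul ha hb⟩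
    | inv x _ hx =>
      obtain ⟨a, ha⟩ := hx
      refine ⟨a, ?_⟩
      rw [← hinv, inv_pow]
      exact Finset.inv_mem_inv ha
  choose N hN using hcov
  obtain ⟨m, hm⟩ : ∃ m : ℕ, m = F.sup N + 1 := ⟨_, rfl⟩
  have hF : ∀ g ∈ F, g ∈ T ^ m := fun g hg =>
    hmono (by have := Finset.le_sup (f := N) hg; omega) (hN g)
  have hm0 : (0 : ℝ) < m := by rw [hm]; positivity
  have key : ∃ n : ℕ, ((T ^ (m + n)).card : ℝ) ≤ (1 + ε / 2) * (T ^ n).card := by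
    by_contra! hcon
    have hgrow : ∀ j : ℕ, (1 + ε / 2) ^ j ≤ ((T ^ (m * j)).card : ℝ) := by
      intro j
      induction j with
      | zero => simp
      | succ j ih =>
        have h := hcon (m * j)
        rw [show m * (j + 1) = m + m * j by ring, pow_succ']
        refine le_trans ?_ h.le
        gcongr
    have hl : 0 < Real.log (1 + ε / 2) := Real.log_pos (by linarith)
    have ht := hsub (Real.log (1 + ε / 2) / m) (by positivity)
    have ht2 := ht.eventually (gt_mem_nhds (show (0 : ℝ) < 1 by norm_num))
    obtain ⟨K, hK⟩ := Filter.eventually_atTop.1 ht2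
    have h := hK (m * K) (by nlinarith [show 1 ≤ m by omega])
    rw [hTc, ← Finset.coe_pow, Set.ncard_coe_finset, div_lt_one (Real.exp_pos _)] at h
    have he : Real.exp (Real.log (1 + ε / 2) / m * ((m * K : ℕ) : ℝ)) = (1 + ε / 2) ^ K := by
      rw [show Real.log (1 + ε / 2) / m * ((m * K : ℕ) : ℝ) = K * Real.log (1 + ε / 2) by
        push_cast; field_simp]
      rw [Real.exp_nat_mul, Real.exp_log (by linarith)]
    rw [he] at h
    exact absurd (hgrow K) (not_le.2 h)
  obtain ⟨n, hn⟩ := key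
  refine ⟨T ^ n, hne n, fun g hg => ?_⟩
  have hA : T ^ n ⊆ T ^ (m + n) := hmono (by omega)
  have hgA : g • T ^ n ⊆ T ^ (m + n) := by
    rw [pow_add]
    exact Finset.smul_finset_subset_mul (hF g hg)
  have c1 : (g • T ^ n \ T ^ n).card + (T ^ n).card ≤ (T ^ (m + n)).card := by
    rw [Finset.card_sdiff_add_card]
    exact Finset.card_le_card (Finset.union_subset hgA hA)
  have c2 : (T ^ n \ g • T ^ n).card + (T ^ n).card ≤ (T ^ (m + n)).card := by
    have := Finset.card_sdiff_add_card (T ^ n) (g • T ^ n)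
    rw [Finset.card_smul_finset] at this
    rw [this]
    exact Finset.card_le_card (Finset.union_subset hA hgA)
  have c3 : (symmDiff (g • T ^ n) (T ^ n)).card
      ≤ (g • T ^ n \ T ^ n).card + (T ^ n \ g • T ^ n).card := Finset.card_union_le _ _
  have c1' : ((g • T ^ n \ T ^ n).card : ℝ) + (T ^ n).card ≤ (T ^ (m + n)).card := by
    exact_mod_cast c1
  have c2' : ((T ^ n \ g • T ^ n).card : ℝ) + (T ^ n).card ≤ (T ^ (m + n)).card := by
    exact_mod_cast c2
  have c3' : ((symmDiff (g • T ^ n) (T ^ n)).card : ℝ)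
      ≤ (g • T ^ n \ T ^ n).card + (T ^ n \ g • T ^ n).card := by
    exact_mod_cast c3
  linarith
end

section
/- Let Γ be a group generated by a finite subset F, and define h₁ = |F| and h_k = |F^k ∖ F^{k−1}| for k ≥ 2. Suppose Γ has polynomial growth: there exist C > 0 and d ≥ 0 with |F^k| ≤ C·k^d for all k ≥ 1. Then inf_{k ≥ 1} h_{2k}/(h₁ + h₂ + ⋯ + h_k) = 0; that is, for every ε > 0 there exists k ≥ 1 with h_{2k} ≤ ε·(h₁ + ⋯ + h_k). -/
open Pointwise

/-- Dye (1963): let `Γ` be generated by a finite set `F`, with `h₁ = |F|` and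
`h_k = |F^k ∖ F^{k−1}|` for `k ≥ 2`. If `Γ` has polynomial growth (`|F^k| ≤ C·k^d`),
then `inf_{k≥1} h_{2k}/(h₁ + ⋯ + h_k) = 0`: for every `ε > 0` there is `k ≥ 1` with
`h_{2k} ≤ ε·(h₁ + ⋯ + h_k)`. -/
theorem dye_polynomial_growth_condition {Γ : Type*} [Group Γ] (F : Finset Γ)
    (hgen : Subgroup.closure (F : Set Γ) = ⊤)
    (h : ℕ → ℕ) (h1 : h 1 = F.card)
    (hk : ∀ k : ℕ, 2 ≤ k → h k = ((((F : Set Γ)) ^ k) \ (((F : Set Γ)) ^ (k - 1))).ncard)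
    (C : ℝ) (hC : 0 < C) (d : ℕ)
    (hpoly : ∀ k : ℕ, 1 ≤ k → ((((F : Set Γ)) ^ k).ncard : ℝ) ≤ C * (k : ℝ) ^ d) :
    ∀ ε : ℝ, 0 < ε → ∃ k : ℕ, 1 ≤ k ∧
      (h (2 * k) : ℝ) ≤ ε * ∑ j ∈ Finset.Icc 1 k, (h j : ℝ) := by
  intro ε hε
  by_contra! hcon
  set s : ℕ → ℝ := fun k => ∑ j ∈ Finset.Icc 1 k, (h j : ℝ) with hs
  have hcon' : ∀ k, 1 ≤ k → ε * s k < (h (2 * k) : ℝ) := hcon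
  have hmono : ∀ m n, m ≤ n → s m ≤ s n := by
    intro m n hmn
    exact Finset.sum_le_sum_of_subset_of_nonneg (Finset.Icc_subset_Icc_right hmn)
      (fun _ _ _ => Nat.cast_nonneg _)
  have hpos1 : 0 < s 1 := by
    have e : s 1 = (F.card : ℝ) := by simp [hs, h1]
    rw [e]
    rcases F.eq_empty_or_nonempty with rfl | hne
    · exfalso
      have h2 := hcon' 1 le_rfl
      rw [e] at h2
      have h3 := hk 2 le_rfl
      simp [h3] at h2
    · exact_mod_cast hne.card_pos
  have hle : ∀ k, 1 ≤ k → (h k : ℝ) ≤ C * (k : ℝ) ^ d := by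
    intro k hk1
    refine le_trans ?_ (hpoly k hk1)
    rcases Nat.lt_or_ge 1 k with h2 | h2
    · rw [hk k h2]
      have hfin : ((F : Set Γ) ^ k).Finite := by
        classical
        rw [← Finset.coe_pow]
        exact Finset.finite_toSet _
      exact_mod_cast Set.ncard_le_ncard Set.sdiff_subset hfin
    · obtain rfl : k = 1 := by omega
      simp [h1]
  have hsle : ∀ k, 1 ≤ k → s k ≤ C * (k : ℝ) ^ (d + 1) := by
    intro k hk1
    calc s k ≤ ∑ j ∈ Finset.Icc 1 k, C * (k : ℝ) ^ d := by
          refine Finset.sum_le_sum fun j hj => ?_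
          rw [Finset.mem_Icc] at hj
          refine (hle j hj.1).trans ?_
          have : (j : ℝ) ≤ k := by exact_mod_cast hj.2
          gcongr
      _ = C * (k : ℝ) ^ (d + 1) := by simp; ring
  have hstep : ∀ m, 1 ≤ m → ε * m * s m ≤ s (4 * m) := by
    intro m hm
    calc ε * m * s m = ∑ j ∈ Finset.Ioc m (2 * m), ε * s m := by
          have : 2 * m - m = m := by omega
          simp [this]; ring
      _ ≤ ∑ j ∈ Finset.Ioc m (2 * m), (h (2 * j) : ℝ) := by
          refine Finset.sum_le_sum fun j hj => ?_
          rw [Finset.mem_Ioc] at hj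
          have := hmono m j hj.1.le
          exact le_trans (by gcongr) (hcon' j (by omega)).le
      _ = ∑ i ∈ (Finset.Ioc m (2 * m)).image (fun j => 2 * j), (h i : ℝ) := by
          rw [Finset.sum_image]
          intro a _ b _ hab
          simpa using hab
      _ ≤ s (4 * m) := by
          refine Finset.sum_le_sum_of_subset_of_nonneg ?_ (fun _ _ _ => Nat.cast_nonneg _)
          intro i hi
          simp only [Finset.mem_image, Finset.mem_Ioc, Finset.mem_Icc] at hi ⊢
          obtain ⟨j, hj, rfl⟩ := hi
          omega
  set K : ℝ := 4 ^ (d + 1) with hK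
  have hKpos : 0 < K := by positivity
  obtain ⟨N, hN⟩ := pow_unbounded_of_one_lt (2 * K / ε) (by norm_num : (1 : ℝ) < 4)
  have hsp : ∀ k, 1 ≤ k → 0 < s k := fun k hk1 => hpos1.trans_le (hmono 1 k hk1)
  have hp4 : ∀ n : ℕ, 1 ≤ 4 ^ n := fun n => Nat.one_le_pow _ _ (by norm_num)
  have hgrow : ∀ n, (2 * K) ^ n * s (4 ^ N) ≤ s (4 ^ (N + n)) := by
    intro n
    induction n with
    | zero => simp
    | succ n ih =>
      have h2 := hstep (4 ^ (N + n)) (hp4 _)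
      have e : 4 * 4 ^ (N + n) = 4 ^ (N + (n + 1)) := by ring
      rw [e] at h2
      refine le_trans ?_ h2
      have h3 : 2 * K ≤ ε * ((4 ^ (N + n) : ℕ) : ℝ) := by
        rw [div_lt_iff₀ hε] at hN
        have h4 : (4 : ℝ) ^ N ≤ 4 ^ (N + n) :=
          pow_le_pow_right₀ (by norm_num) (by omega)
        push_cast
        nlinarith
      calc (2 * K) ^ (n + 1) * s (4 ^ N) = (2 * K) * ((2 * K) ^ n * s (4 ^ N)) := by ring
        _ ≤ (2 * K) * s (4 ^ (N + n)) := by gcongr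
        _ ≤ _ := mul_le_mul_of_nonneg_right h3 (hsp _ (hp4 _)).le
  have hN0 := hsp _ (hp4 N)
  obtain ⟨n, hn⟩ := pow_unbounded_of_one_lt (C * K ^ N / s (4 ^ N)) (by norm_num : (1 : ℝ) < 2)
  rw [div_lt_iff₀ hN0] at hn
  have h5 := (hgrow n).trans (hsle _ (hp4 _))
  have e : C * ((4 ^ (N + n) : ℕ) : ℝ) ^ (d + 1) = K ^ n * (C * K ^ N) := by
    rw [hK]; push_cast; ring
  rw [e, mul_pow, mul_comm (2 ^ n), mul_assoc] at h5
  have h6 := le_of_mul_le_mul_left h5 (by positivity)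
  linarith
end

section
/- Let n ≥ 1 and let S be any finite generating set of ℤ^n. Then there exists a polynomial P with integer coefficients such that, as formal power series, (1−z)^n · Σ(ℤ^n, S; z) = P(z), where Σ(ℤ^n, S; z) = ∑_{k=0}^∞ σ(k) z^k and σ(k) is the number of elements of ℤ^n of word length exactly k with respect to S. -/
open Pointwise

/-- Hilbert series of a set of exponent vectors. -/
noncomputable def hilbSer {m : ℕ} (A : Set (Fin m → ℕ)) : PowerSeries ℤ :=
  PowerSeries.mk (fun k : ℕ => (({a | a ∈ A ∧ ∑ i, a i = k} : Set (Fin m → ℕ)).ncard : ℤ))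

theorem finite_deg {m : ℕ} (A : Set (Fin m → ℕ)) (k : ℕ) :
    ({a | a ∈ A ∧ ∑ i, a i = k} : Set (Fin m → ℕ)).Finite := by
  apply (Set.finite_Iic (fun _ : Fin m => k)).subset
  rintro a ⟨-, h⟩ i
  rw [← h]
  exact Finset.single_le_sum (f := a) (fun _ _ => Nat.zero_le _) (Finset.mem_univ i)

/-- slice at first coordinate zero -/
def slice0 {m : ℕ} (A : Set (Fin (m+1) → ℕ)) : Set (Fin m → ℕ) :=
  {a | (Fin.cons 0 a : Fin (m+1) → ℕ) ∈ A}

/-- shift in the first coordinate -/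
def shift0 {m : ℕ} (A : Set (Fin (m+1) → ℕ)) : Set (Fin (m+1) → ℕ) :=
  {a | (Fin.cons (a 0 + 1) (Fin.tail a) : Fin (m+1) → ℕ) ∈ A}

theorem hilbSer_step {m : ℕ} (A : Set (Fin (m+1) → ℕ)) :
    hilbSer A = hilbSer (slice0 A) + PowerSeries.X * hilbSer (shift0 A) := by
  have inj0 : Function.Injective (fun a : Fin m → ℕ => (Fin.cons 0 a : Fin (m+1) → ℕ)) :=
    Fin.cons_right_injective (α := fun _ => ℕ) 0
  have inj1 : Function.Injective
      (fun a : Fin (m+1) → ℕ => (Fin.cons (a 0 + 1) (Fin.tail a) : Fin (m+1) → ℕ)) := by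
    intro a b h
    have h0 := congrFun h 0
    have h1 := congrArg Fin.tail h
    simp only [Fin.cons_zero, Fin.tail_cons, add_left_inj] at h0 h1
    rw [← Fin.cons_self_tail a, ← Fin.cons_self_tail b, h0, h1]
  ext k
  cases k with
  | zero =>
    simp only [hilbSer, map_add, PowerSeries.coeff_mk, PowerSeries.coeff_zero_X_mul, add_zero]
    rw [← Set.ncard_image_of_injective _ inj0]
    congr 2
    ext a
    constructor
    · rintro ⟨ha, hs⟩
      have h0 : a 0 = 0 := by
        rw [Fin.sum_univ_succ] at hs; omega
      have e : (Fin.cons 0 (Fin.tail a) : Fin (m+1) → ℕ) = a := by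
        rw [← h0, Fin.cons_self_tail]
      refine ⟨Fin.tail a, ⟨?_, ?_⟩, e⟩
      · change (Fin.cons 0 (Fin.tail a) : Fin (m+1) → ℕ) ∈ A
        rwa [e]
      · rw [Fin.sum_univ_succ, h0, zero_add] at hs
        exact hs
    · rintro ⟨b, ⟨hb, hs⟩, rfl⟩
      exact ⟨hb, by simpa [Fin.sum_univ_succ] using hs⟩
  | succ k =>
    simp only [hilbSer, map_add, PowerSeries.coeff_mk, PowerSeries.coeff_succ_X_mul]
    rw [← Set.ncard_image_of_injective _ inj0,
      ← Set.ncard_image_of_injective {a | a ∈ shift0 A ∧ ∑ i, a i = k} inj1,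
      ← Nat.cast_add, ← Set.ncard_union_eq _ ((finite_deg _ _).image _) ((finite_deg _ _).image _)]
    · congr 2
      ext a
      constructor
      · rintro ⟨ha, hs⟩
        rcases Nat.eq_zero_or_pos (a 0) with h0 | h0
        · left
          have e : (Fin.cons 0 (Fin.tail a) : Fin (m+1) → ℕ) = a := by
            rw [← h0, Fin.cons_self_tail]
          refine ⟨Fin.tail a, ⟨?_, ?_⟩, e⟩
          · change (Fin.cons 0 (Fin.tail a) : Fin (m+1) → ℕ) ∈ A
            rwa [e]
          · rw [Fin.sum_univ_succ, h0, zero_add] at hs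
            exact hs
        · right
          have e : (Fin.cons (a 0 - 1 + 1) (Fin.tail a) : Fin (m+1) → ℕ) = a := by
            rw [Nat.sub_add_cancel h0, Fin.cons_self_tail]
          refine ⟨Fin.cons (a 0 - 1) (Fin.tail a), ⟨?_, ?_⟩, ?_⟩
          · simpa [shift0, e] using ha
          · rw [Fin.sum_univ_succ] at hs ⊢
            simp only [Fin.cons_zero, Fin.cons_succ, Fin.tail]
            omega
          · simpa using e
      · rintro (⟨b, ⟨hb, hs⟩, rfl⟩ | ⟨b, ⟨hb, hs⟩, rfl⟩)
        · exact ⟨hb, by simpa [Fin.sum_univ_succ] using hs⟩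
        · refine ⟨hb, ?_⟩
          rw [Fin.sum_univ_succ] at hs ⊢
          simp only [Fin.cons_zero, Fin.cons_succ, Fin.tail]
          omega
    · rw [Set.disjoint_left]
      rintro _ ⟨b, -, rfl⟩ ⟨c, -, h⟩
      have := congrFun h 0
      simp at this

/-- every free orthant in `A` has dimension at most `d` -/
def RankLE {m : ℕ} (A : Set (Fin m → ℕ)) (d : ℕ) : Prop :=
  ∀ (I : Finset (Fin m)) (a : Fin m → ℕ),
    (∀ c : Fin m → ℕ, (∀ i, i ∉ I → c i = 0) → a + c ∈ A) → I.card ≤ d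

theorem stab {m : ℕ} (A : Set (Fin (m+1) → ℕ)) (hA : IsLowerSet A) :
    ∃ J : ℕ, ∀ j, J ≤ j → ∀ a : Fin m → ℕ, (Fin.cons J a : Fin (m+1) → ℕ) ∈ A →
      (Fin.cons j a : Fin (m+1) → ℕ) ∈ A := by
  let U : Set (Fin m → ℕ) := {a | ∃ j, (Fin.cons j a : Fin (m+1) → ℕ) ∉ A}
  have hfin : {a | Minimal (· ∈ U) a}.Finite :=
    WellQuasiOrderedLE.finite_of_isAntichain (setOfPred_minimal_antichain _)
  have hex : ∀ a : Fin m → ℕ, ∃ j, a ∈ U → (Fin.cons j a : Fin (m+1) → ℕ) ∉ A := by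
    intro a
    by_cases h : a ∈ U
    · obtain ⟨j, hj⟩ := h
      exact ⟨j, fun _ => hj⟩
    · exact ⟨0, fun h' => absurd h' h⟩
  choose f hf using hex
  obtain ⟨J, hJ⟩ := (hfin.image f).bddAbove
  refine ⟨J, fun j hj a ha => ?_⟩
  by_contra hcon
  obtain ⟨b, hba, hb⟩ := exists_minimal_le_of_wellFoundedLT (· ∈ U) a ⟨j, hcon⟩
  have h1 : f b ≤ J := hJ ⟨b, hb, rfl⟩
  refine hf b hb.prop (hA ?_ ha)
  exact Fin.cons_le_cons.2 ⟨h1, hba⟩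

theorem lower_slice {m : ℕ} {A : Set (Fin (m+1) → ℕ)} (hA : IsLowerSet A) :
    IsLowerSet (slice0 A) := by
  intro a b hba ha
  exact hA (Fin.cons_le_cons.2 ⟨le_rfl, hba⟩) ha

theorem lower_shift {m : ℕ} {A : Set (Fin (m+1) → ℕ)} (hA : IsLowerSet A) :
    IsLowerSet (shift0 A) := by
  intro a b hba ha
  exact hA (Fin.cons_le_cons.2 ⟨Nat.add_le_add_right (hba 0) 1, fun i => hba i.succ⟩) ha

theorem rank_slice {m : ℕ} {A : Set (Fin (m+1) → ℕ)} {d : ℕ} (h : RankLE A d) :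
    RankLE (slice0 A) d := by
  intro I a hI
  have := h (I.map (Fin.succEmb m)) (Fin.cons 0 a) ?_
  · simpa using this
  · intro c hc
    have h0 : c 0 = 0 := hc 0 (by simp)
    have := hI (Fin.tail c) (fun i hi => hc i.succ (by simpa using hi))
    change (Fin.cons 0 (a + Fin.tail c) : Fin (m+1) → ℕ) ∈ A at this
    convert this using 1
    ext i
    refine Fin.cases ?_ (fun i => ?_) i <;> simp [h0, Fin.tail]

theorem rank_shift {m : ℕ} {A : Set (Fin (m+1) → ℕ)} {d : ℕ} (h : RankLE A d) :
    RankLE (shift0 A) d := by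
  intro I a hI
  refine h I (Fin.cons (a 0 + 1) (Fin.tail a)) ?_
  intro c hc
  have := hI c hc
  simp only [shift0, Set.mem_ofPred_eq] at this
  convert this using 1
  ext i
  refine Fin.cases ?_ (fun i => ?_) i
  · simp; ring
  · simp [Fin.tail]

theorem rank_slice_stable {m : ℕ} {A : Set (Fin (m+1) → ℕ)} {d : ℕ} (h : RankLE A d)
    (hs : ∀ j, ∀ a : Fin m → ℕ, (Fin.cons 0 a : Fin (m+1) → ℕ) ∈ A →
      (Fin.cons j a : Fin (m+1) → ℕ) ∈ A) (hne : (slice0 A).Nonempty) :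
    ∃ e, d = e + 1 ∧ RankLE (slice0 A) e := by
  have key : ∀ (I : Finset (Fin m)) (a : Fin m → ℕ),
      (∀ c : Fin m → ℕ, (∀ i, i ∉ I → c i = 0) → a + c ∈ slice0 A) → I.card + 1 ≤ d := by
    intro I a hI
    have := h (insert 0 (I.map (Fin.succEmb m))) (Fin.cons 0 a) ?_
    · rw [Finset.card_insert_of_notMem (by simp)] at this
      simpa using this
    · intro c hc
      have := hI (Fin.tail c) (fun i hi => hc i.succ (by simpa using hi))
      have := hs (c 0) _ this
      convert this using 1
      ext i
      refine Fin.cases ?_ (fun i => ?_) i <;> simp [Fin.tail]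
  obtain ⟨a, ha⟩ := hne
  have h1 := key ∅ a (fun c hc => by
    have : c = 0 := by ext i; exact hc i (by simp)
    simpa [this] using ha)
  refine ⟨d - 1, by simp at h1; omega, fun I a hI => ?_⟩
  have := key I a hI
  omega

theorem hilb_main : ∀ (m d : ℕ) (A : Set (Fin m → ℕ)), IsLowerSet A → RankLE A d →
    ∃ P : Polynomial ℤ, (1 - PowerSeries.X) ^ d * hilbSer A = (P : PowerSeries ℤ) := by
  intro m
  induction m with
  | zero =>
    intro d A _ _
    refine ⟨(1 - Polynomial.X) ^ d * Polynomial.C (A.ncard : ℤ), ?_⟩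
    have : hilbSer A = PowerSeries.C (A.ncard : ℤ) := by
      ext k
      rw [PowerSeries.coeff_C]
      cases k with
      | zero => simp [hilbSer]
      | succ k => simp [hilbSer]
    rw [this, Polynomial.coe_mul, Polynomial.coe_C, Polynomial.coe_pow, Polynomial.coe_sub,
      Polynomial.coe_one, Polynomial.coe_X]
  | succ m ih =>
    have inner : ∀ (J d : ℕ) (A : Set (Fin (m+1) → ℕ)), IsLowerSet A → RankLE A d →
        (∀ j, J ≤ j → ∀ a : Fin m → ℕ, (Fin.cons J a : Fin (m+1) → ℕ) ∈ A →
          (Fin.cons j a : Fin (m+1) → ℕ) ∈ A) →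
        ∃ P : Polynomial ℤ, (1 - PowerSeries.X) ^ d * hilbSer A = (P : PowerSeries ℤ) := by
      intro J
      induction J with
      | zero =>
        intro d A hA hr hs
        have hs' : ∀ j, ∀ a : Fin m → ℕ, (Fin.cons 0 a : Fin (m+1) → ℕ) ∈ A →
            (Fin.cons j a : Fin (m+1) → ℕ) ∈ A := fun j => hs j (Nat.zero_le _)
        have hsh : shift0 A = A := by
          ext a
          constructor
          · intro ha
            refine hA ?_ ha
            rw [Fin.le_cons]
            exact ⟨Nat.le_succ _, le_rfl⟩
          · intro ha
            refine hs' _ _ (hA ?_ ha)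
            rw [Fin.cons_le]
            exact ⟨Nat.zero_le _, le_rfl⟩
        have hstep := hilbSer_step A
        rw [hsh] at hstep
        have hstep' : (1 - PowerSeries.X) * hilbSer A = hilbSer (slice0 A) := by
          linear_combination hstep
        by_cases hne : (slice0 A).Nonempty
        · obtain ⟨e, rfl, he⟩ := rank_slice_stable hr hs' hne
          obtain ⟨P, hP⟩ := ih e _ (lower_slice hA) he
          exact ⟨P, by rw [pow_succ, mul_assoc, hstep', hP]⟩
        · have hA0 : A = ∅ := by
            rw [Set.eq_empty_iff_forall_notMem]
            intro a ha
            refine hne ⟨Fin.tail a, hA ?_ ha⟩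
            rw [Fin.cons_le]
            exact ⟨Nat.zero_le _, le_rfl⟩
          refine ⟨0, ?_⟩
          have : hilbSer A = 0 := by
            ext k
            simp [hilbSer, hA0]
          simp [this]
      | succ J ihJ =>
        intro d A hA hr hs
        obtain ⟨P, hP⟩ := ih d _ (lower_slice hA) (rank_slice hr)
        obtain ⟨Q, hQ⟩ := ihJ d _ (lower_shift hA) (rank_shift hr) (by
          intro j hj a ha
          exact hs (j+1) (by omega) a ha)
        refine ⟨P + Polynomial.X * Q, ?_⟩
        rw [hilbSer_step A, Polynomial.coe_add, Polynomial.coe_mul, Polynomial.coe_X, ← hP, ← hQ]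
        ring
    intro d A hA hr
    obtain ⟨J, hJ⟩ := stab A hA
    exact inner J d A hA hr hJ

/-- deg-lex key -/
noncomputable def dkey {m : ℕ} (a : Fin m → ℕ) : DegLex (Fin m →₀ ℕ) :=
  toDegLex (Finsupp.equivFunOnFinite.symm a)

theorem dkey_add {m : ℕ} (a b : Fin m → ℕ) : dkey (a + b) = dkey a + dkey b := by
  unfold dkey
  rw [← toDegLex_add]
  congr 1
  ext i
  simp

theorem dkey_inj {m : ℕ} : Function.Injective (dkey (m := m)) :=
  toDegLex_injective.comp Finsupp.equivFunOnFinite.symm.injective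

theorem dkey_deg {m : ℕ} {a b : Fin m → ℕ} (h : dkey a ≤ dkey b) : ∑ i, a i ≤ ∑ i, b i := by
  have := Finsupp.DegLex.monotone_degree h
  simpa [dkey, Finsupp.degree_eq_sum] using this

/-- the evaluation map -/
def evalB {m n : ℕ} (b : Fin m → (Fin n → ℤ)) (a : Fin m → ℕ) : Fin n → ℤ :=
  ∑ i, a i • b i

theorem evalB_add {m n : ℕ} (b : Fin m → (Fin n → ℤ)) (a c : Fin m → ℕ) :
    evalB b (a + c) = evalB b a + evalB b c := by
  simp [evalB, add_smul, Finset.sum_add_distrib]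

/-- canonical representatives -/
def canon {m n : ℕ} (b : Fin m → (Fin n → ℤ)) : Set (Fin m → ℕ) :=
  {a | ∀ c, evalB b c = evalB b a → dkey a ≤ dkey c}

theorem canon_lower {m n : ℕ} (b : Fin m → (Fin n → ℤ)) : IsLowerSet (canon b) := by
  intro a c hca ha e he
  have h1 : c + (a - c) = a := add_tsub_cancel_of_le hca
  have := ha (e + (a - c)) (by rw [evalB_add, he, ← evalB_add, h1])
  rw [← h1, dkey_add, dkey_add, h1] at this
  exact le_of_add_le_add_right this

theorem canon_inj {m n : ℕ} (b : Fin m → (Fin n → ℤ)) : Set.InjOn (evalB b) (canon b) := by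
  intro a ha c hc h
  exact dkey_inj (le_antisymm (ha c h.symm) (hc a h))

theorem canon_exists {m n : ℕ} (b : Fin m → (Fin n → ℤ)) (a : Fin m → ℕ) :
    ∃ c ∈ canon b, evalB b c = evalB b a := by
  obtain ⟨c, hc⟩ := exists_minimalFor_of_wellFoundedLT
    (fun c => evalB b c = evalB b a) dkey ⟨a, rfl⟩
  refine ⟨c, fun e he => ?_, hc.prop⟩
  exact (le_total (dkey c) (dkey e)).elim id (fun h => hc.2 (he.trans hc.prop) h)

theorem canon_rank {m n : ℕ} (b : Fin m → (Fin n → ℤ)) : RankLE (canon b) n := by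
  intro I a hI
  have hli : LinearIndependent ℤ (fun i : I => b i) := by
    rw [Fintype.linearIndependent_iff]
    intro g hg i
    let p : Fin m → ℕ := fun j => if h : j ∈ I then (g ⟨j, h⟩).toNat else 0
    let q : Fin m → ℕ := fun j => if h : j ∈ I then (-g ⟨j, h⟩).toNat else 0
    have hp := hI p (fun j hj => by simp [p, hj])
    have hq := hI q (fun j hj => by simp [q, hj])
    have hpq : evalB b p = evalB b q := by
      rw [← sub_eq_zero, ← hg]
      unfold evalB
      rw [← Finset.sum_sub_distrib, ← Finset.sum_coe_sort I (fun j => p j • b j - q j • b j) |>.trans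
        (Finset.sum_subset (Finset.subset_univ I) (fun j _ hj => by simp [p, q, hj]))]
      refine Finset.sum_congr rfl (fun j _ => ?_)
      have : g j = ((g j).toNat : ℤ) - ((-g j).toNat : ℤ) := by omega
      simp only [p, q, j.2, dif_pos]
      conv_rhs => rw [this, sub_smul, natCast_zsmul, natCast_zsmul]
    have := canon_inj b hp hq (by rw [evalB_add, evalB_add, hpq])
    have := congrFun (add_left_cancel this) i
    simp only [p, q, i.2, dif_pos] at this
    change (g i).toNat = (-g i).toNat at this
    omega
  have := hli.fintype_card_le_finrank
  simpa using this

theorem mem_sumsetPow {m n : ℕ} (b : Fin m → (Fin n → ℤ)) (j : ℕ) (x : Fin n → ℤ) :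
    x ∈ sumsetPow (Set.range b) j ↔ ∃ a : Fin m → ℕ, ∑ i, a i = j ∧ evalB b a = x := by
  induction j generalizing x with
  | zero =>
    simp only [sumsetPow, Set.mem_singleton_iff]
    constructor
    · rintro rfl
      exact ⟨0, by simp, by simp [evalB]⟩
    · rintro ⟨a, h, rfl⟩
      have : a = 0 := by
        ext i
        exact (Finset.sum_eq_zero_iff.1 h) i (Finset.mem_univ i)
      simp [this, evalB]
  | succ j ih =>
    simp only [sumsetPow, Set.mem_add]
    constructor
    · rintro ⟨y, hy, _, ⟨i, rfl⟩, rfl⟩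
      obtain ⟨a, ha, rfl⟩ := (ih y).1 hy
      refine ⟨a + Pi.single i 1, ?_, ?_⟩
      · simp [Finset.sum_add_distrib, ha]
      · rw [evalB_add]
        simp [evalB, Pi.single_apply]
    · rintro ⟨a, ha, rfl⟩
      have : ∃ i, a i ≠ 0 := by
        by_contra! h
        simp [h] at ha
      obtain ⟨i, hi⟩ := this
      have e : (a - Pi.single i 1) + Pi.single i 1 = a := by
        apply tsub_add_cancel_of_le
        intro k
        by_cases hk : k = i
        · subst hk; simp; omega
        · simp [hk]
      refine ⟨evalB b (a - Pi.single i 1), (ih _).2 ⟨_, ?_, rfl⟩, b i, ⟨i, rfl⟩, ?_⟩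
      · rw [← e] at ha
        simp only [Pi.add_apply, Finset.sum_add_distrib] at ha
        simpa using ha
      · conv_rhs => rw [← e, evalB_add]
        simp [evalB, Pi.single_apply]

/-- For any finite generating set `S` of `ℤ^n`, there is a polynomial `P ∈ ℤ[z]` with
`(1−z)^n · Σ(ℤ^n,S;z) = P(z)` as formal power series, where `Σ(ℤ^n,S;z) = ∑_k σ(k) z^k`
and `σ(k)` is the number of elements of word length exactly `k` with respect to `S`. -/
theorem growth_series_Zn_rational (n : ℕ) (hn : 1 ≤ n)
    (S : Finset (Fin n → ℤ))
    (hgen : AddSubgroup.closure (S : Set (Fin n → ℤ)) = ⊤) :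
    ∃ P : Polynomial ℤ,
      (1 - PowerSeries.X) ^ n *
        PowerSeries.mk (fun k : ℕ =>
          ({x : Fin n → ℤ |
              sInf {j : ℕ | x ∈ sumsetPow ((S : Set (Fin n → ℤ)) ∪ -(S : Set (Fin n → ℤ))) j}
                = k}.ncard : ℤ))
        = (P : PowerSeries ℤ) := by
  classical
  obtain ⟨m, b, hb⟩ : ∃ (m : ℕ) (b : Fin m → (Fin n → ℤ)),
      Set.range b = (S : Set (Fin n → ℤ)) ∪ -(S : Set (Fin n → ℤ)) := by
    have hfin : ((S : Set (Fin n → ℤ)) ∪ -(S : Set (Fin n → ℤ))).Finite :=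
      S.finite_toSet.union S.finite_toSet.neg
    obtain ⟨m, b, -, hb⟩ := hfin.fin_param
    exact ⟨m, b, hb⟩
  rw [← hb]
  have hsurj : ∀ x : Fin n → ℤ, ∃ a, evalB b a = x := by
    intro x
    have hx : x ∈ (AddSubgroup.closure (S : Set (Fin n → ℤ))).toAddSubmonoid := by
      rw [hgen]; trivial
    rw [AddSubgroup.closure_toAddSubmonoid, ← hb] at hx
    induction hx using AddSubmonoid.closure_induction with
    | mem x hx =>
      obtain ⟨i, rfl⟩ := hx
      exact ⟨Pi.single i 1, by simp [evalB, Pi.single_apply]⟩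
    | zero => exact ⟨0, by simp [evalB]⟩
    | add x y _ _ hx hy =>
      obtain ⟨a, rfl⟩ := hx
      obtain ⟨c, rfl⟩ := hy
      exact ⟨a + c, evalB_add b a c⟩
  have hlen : ∀ a ∈ canon b, sInf {j : ℕ | evalB b a ∈ sumsetPow (Set.range b) j} = ∑ i, a i := by
    intro a ha
    refine IsLeast.csInf_eq ⟨(mem_sumsetPow b _ _).2 ⟨a, rfl, rfl⟩, ?_⟩
    intro j hj
    obtain ⟨c, rfl, hc⟩ := (mem_sumsetPow b _ _).1 hj
    exact dkey_deg (ha c hc)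
  obtain ⟨P, hP⟩ := hilb_main m n (canon b) (canon_lower b) (canon_rank b)
  refine ⟨P, ?_⟩
  rw [← hP, hilbSer]
  congr 2
  ext k
  rw [← Set.InjOn.ncard_image (f := evalB b) ((canon_inj b).mono (fun a ha => ha.1))]
  congr 2
  ext x
  constructor
  · intro hx
    obtain ⟨a, rfl⟩ := hsurj x
    obtain ⟨c, hc, hca⟩ := canon_exists b a
    refine ⟨c, ⟨hc, ?_⟩, hca⟩
    rw [← hlen c hc, hca]
    exact hx
  · rintro ⟨a, ⟨ha, hs⟩, rfl⟩
    exact (hlen a ha).trans hs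
end

section
/- Let Γ be a finitely generated group containing an abelian subgroup of finite index, and let S be any finite generating set of Γ. Then the growth series Σ(Γ,S;z) = ∑_{k=0}^∞ σ(k) z^k is a rational function: there exist polynomials P, Q with integer coefficients and Q(0) = 1 such that Q(z)·Σ(Γ,S;z) = P(z) as formal power series in ℤ[[z]]. -/
open Pointwise


namespace Benson

/-- rational power series -/
def IsRat (f : PowerSeries ℤ) : Prop :=
  ∃ P Q : Polynomial ℤ, Q.coeff 0 = 1 ∧ (Q : PowerSeries ℤ) * f = (P : PowerSeries ℤ)

theorem IsRat.add {f g : PowerSeries ℤ} (hf : IsRat f) (hg : IsRat g) : IsRat (f + g) := by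
  obtain ⟨P, Q, h1, h2⟩ := hf
  obtain ⟨P', Q', h1', h2'⟩ := hg
  refine ⟨Q' * P + Q * P', Q * Q', by simp [Polynomial.mul_coeff_zero, h1, h1'], ?_⟩
  push_cast
  rw [← h2, ← h2']; ring

theorem IsRat.polyMul {f : PowerSeries ℤ} (R : Polynomial ℤ) (hf : IsRat f) :
    IsRat ((R : PowerSeries ℤ) * f) := by
  obtain ⟨P, Q, h1, h2⟩ := hf
  refine ⟨R * P, Q, h1, ?_⟩
  push_cast
  rw [← h2]; ring

theorem IsRat.neg {f : PowerSeries ℤ} (hf : IsRat f) : IsRat (-f) := by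
  have := hf.polyMul (-1)
  simpa using this

theorem IsRat.sub {f g : PowerSeries ℤ} (hf : IsRat f) (hg : IsRat g) : IsRat (f - g) := by
  rw [sub_eq_add_neg]; exact hf.add hg.neg

theorem IsRat.zero : IsRat 0 := ⟨0, 1, by simp, by simp⟩

theorem IsRat.one : IsRat 1 := ⟨1, 1, by simp, by simp⟩

theorem IsRat.of_polyMul {f : PowerSeries ℤ} (R : Polynomial ℤ) (hR : R.coeff 0 = 1)
    (hf : IsRat ((R : PowerSeries ℤ) * f)) : IsRat f := by
  obtain ⟨P, Q, h1, h2⟩ := hf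
  refine ⟨P, Q * R, by simp [Polynomial.mul_coeff_zero, h1, hR], ?_⟩
  push_cast
  rw [← h2]; ring

/-- finite fibres -/
def FF {X : Type*} (d : X → ℕ) (T : Set X) : Prop := ∀ k, {x | x ∈ T ∧ d x = k}.Finite

/-- generating function -/
noncomputable def gf {X : Type*} (d : X → ℕ) (T : Set X) : PowerSeries ℤ :=
  PowerSeries.mk fun k => ({x | x ∈ T ∧ d x = k}.ncard : ℤ)

/-- rational set -/
def RS {X : Type*} (d : X → ℕ) (T : Set X) : Prop := FF d T ∧ IsRat (gf d T)

section
variable {X Y : Type*} {d : X → ℕ} {e : Y → ℕ}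

theorem FF.mono {T U : Set X} (h : T ⊆ U) (hU : FF d U) : FF d T := fun k =>
  (hU k).subset fun _ hx => ⟨h hx.1, hx.2⟩

theorem FF.union {T U : Set X} (hT : FF d T) (hU : FF d U) : FF d (T ∪ U) := fun k => by
  refine ((hT k).union (hU k)).subset ?_
  rintro x ⟨hx | hx, h⟩
  · exact Or.inl ⟨hx, h⟩
  · exact Or.inr ⟨hx, h⟩

theorem gf_union_add_inter {T U : Set X} (hT : FF d T) (hU : FF d U) :
    gf d (T ∪ U) + gf d (T ∩ U) = gf d T + gf d U := by
  ext k
  simp only [gf, map_add, PowerSeries.coeff_mk]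
  have := Set.ncard_union_add_ncard_inter {x | x ∈ T ∧ d x = k} {x | x ∈ U ∧ d x = k} (hT k) (hU k)
  have h1 : {x | x ∈ T ∪ U ∧ d x = k} = {x | x ∈ T ∧ d x = k} ∪ {x | x ∈ U ∧ d x = k} := by
    ext x; simp [or_and_right]
  have h2 : {x | x ∈ T ∩ U ∧ d x = k} = {x | x ∈ T ∧ d x = k} ∩ {x | x ∈ U ∧ d x = k} := by
    ext x; simp only [Set.mem_inter_iff, Set.mem_ofPred_eq]; tauto
  rw [h1, h2]
  exact_mod_cast this

theorem gf_empty : gf d (∅ : Set X) = 0 := by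
  ext k; simp [gf]

theorem gf_disjUnion {T U : Set X} (hT : FF d T) (hU : FF d U) (h : Disjoint T U) :
    gf d (T ∪ U) = gf d T + gf d U := by
  rw [← gf_union_add_inter hT hU, Set.disjoint_iff_inter_eq_empty.1 h, gf_empty, add_zero]

theorem RS.empty : RS d (∅ : Set X) := ⟨fun k => by simp, by rw [gf_empty]; exact .zero⟩

theorem RS.union {T U : Set X} (hT : RS d T) (hU : RS d U) (h : RS d (T ∩ U)) :
    RS d (T ∪ U) := by
  refine ⟨hT.1.union hU.1, ?_⟩
  rw [← add_sub_cancel_right (gf d (T ∪ U)) (gf d (T ∩ U)), gf_union_add_inter hT.1 hU.1]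
  exact (hT.2.add hU.2).sub h.2

theorem RS.disjUnion {T U : Set X} (hT : RS d T) (hU : RS d U) (h : Disjoint T U) :
    RS d (T ∪ U) := hT.union hU (by
      rw [Set.disjoint_iff_inter_eq_empty.1 h]; exact .empty)

theorem RS.diff {T U : Set X} (hT : RS d T) (hU : RS d U) (h : U ⊆ T) : RS d (T \ U) := by
  have h1 : FF d (T \ U) := hT.1.mono Set.sdiff_subset
  refine ⟨h1, ?_⟩
  have := gf_disjUnion h1 hU.1 disjoint_sdiff_self_left
  rw [Set.sdiff_union_of_subset h] at this
  rw [eq_sub_of_add_eq this.symm]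
  exact hT.2.sub hU.2

theorem FF.image {T : Set X} (f : X → Y) (w : ℕ) (hd : ∀ x, e (f x) = d x + w)
    (hT : FF d T) : FF e (f '' T) := by
  intro k
  refine ((hT (k - w)).image f).subset ?_
  rintro _ ⟨⟨x, hx, rfl⟩, h⟩
  exact ⟨x, ⟨hx, by rw [hd] at h; omega⟩, rfl⟩

theorem gf_image {T : Set X} (f : X → Y) (w : ℕ) (hd : ∀ x, e (f x) = d x + w)
    (hf : Set.InjOn f T) :
    gf e (f '' T) = (Polynomial.X ^ w : Polynomial ℤ) * gf d T := by
  ext k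
  rw [Polynomial.coe_pow, Polynomial.coe_X, PowerSeries.coeff_X_pow_mul']
  simp only [gf, PowerSeries.coeff_mk]
  split_ifs with h
  · rw [← Set.ncard_image_of_injOn (f := f) (s := {x | x ∈ T ∧ d x = k - w})
      (hf.mono fun x hx => hx.1)]
    congr 2
    ext y
    constructor
    · rintro ⟨⟨x, hx, rfl⟩, h'⟩
      exact ⟨x, ⟨hx, by rw [hd] at h'; omega⟩, rfl⟩
    · rintro ⟨x, ⟨hx, h'⟩, rfl⟩
      exact ⟨⟨x, hx, rfl⟩, by rw [hd]; omega⟩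
  · have : {x | x ∈ f '' T ∧ e x = k} = ∅ := by
      rw [Set.eq_empty_iff_forall_notMem]
      rintro _ ⟨⟨x, hx, rfl⟩, h'⟩
      rw [hd] at h'; omega
    rw [this]; simp

theorem RS.image {T : Set X} (f : X → Y) (w : ℕ) (hd : ∀ x, e (f x) = d x + w)
    (hf : Set.InjOn f T) (hT : RS d T) : RS e (f '' T) :=
  ⟨hT.1.image f w hd, by rw [gf_image f w hd hf]; exact hT.2.polyMul _⟩

theorem RS.biUnion {ι : Type*} (C : Set X → Prop) (hC : ∀ T U, C T → C U → C (T ∩ U))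
    (hR : ∀ T, C T → RS d T) (s : Finset ι) :
    ∀ (T : ι → Set X), (∀ i ∈ s, C (T i)) → RS d (⋃ i ∈ s, T i) := by
  classical
  induction s using Finset.induction_on with
  | empty => intro T _; simpa using RS.empty
  | insert a s ha ih =>
    intro T hT
    rw [Finset.set_biUnion_insert]
    refine RS.union (hR _ (hT a (by simp))) (ih T fun i hi => hT i (by simp [hi])) ?_
    rw [Set.inter_iUnion₂]
    exact ih (fun i => T a ∩ T i) fun i hi => hC _ _ (hT a (by simp)) (hT i (by simp [hi]))

end

section
variable {σ : Type*} [Finite σ] (w : (σ →₀ ℕ) →+ ℕ) (hw : ∀ i, 0 < w (Finsupp.single i 1))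
include hw

theorem FF_finsupp : FF w (Set.univ) := by
  intro k
  classical
  refine (Set.finite_Icc 0 (Finsupp.equivFunOnFinite.symm (fun _ : σ => k))).subset ?_
  rintro n ⟨-, hn⟩
  refine ⟨zero_le, fun i => ?_⟩
  have h1 : n = Finsupp.single i (n i) + (n - Finsupp.single i (n i)) := by
    ext j; by_cases h : i = j <;> simp [Finsupp.single_apply, h]
  have h2 : w n = n i * w (Finsupp.single i 1) + w (n - Finsupp.single i (n i)) := by
    conv_lhs => rw [h1, map_add]
    congr 1
    rw [← smul_eq_mul, ← map_nsmul]; simp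
  have := Nat.le_mul_of_pos_right (n i) (hw i)
  simp only [Finsupp.equivFunOnFinite_symm_apply_apply]
  omega

theorem RS_univ : RS w (Set.univ) := by
  classical
  have := Fintype.ofFinite σ
  suffices h : ∀ F : Finset σ, RS w {n : σ →₀ ℕ | ∀ i ∉ F, n i = 0} by
    have := h Finset.univ
    simpa using this
  intro F
  induction F using Finset.induction_on with
  | empty =>
    have : {n : σ →₀ ℕ | ∀ i ∉ (∅ : Finset σ), n i = 0} = {0} := by
      ext n; simp [Finsupp.ext_iff]
    rw [this]
    refine ⟨(FF_finsupp w hw).mono (Set.subset_univ _), ?_⟩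
    convert IsRat.one
    ext k
    rw [PowerSeries.coeff_one, gf, PowerSeries.coeff_mk]
    split_ifs with h
    · have : {x | x ∈ ({0} : Set (σ →₀ ℕ)) ∧ w x = k} = {0} := by
        ext x; simp [h]; rintro rfl; simp
      rw [this]; simp
    · have : {x | x ∈ ({0} : Set (σ →₀ ℕ)) ∧ w x = k} = ∅ := by
        ext x; simp; rintro rfl; simp; omega
      rw [this]; simp
  | insert a F ha ih =>
    set T := {n : σ →₀ ℕ | ∀ i ∉ insert a F, n i = 0} with hT
    set U := {n : σ →₀ ℕ | ∀ i ∉ F, n i = 0} with hU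
    have hTF : FF w T := (FF_finsupp w hw).mono (Set.subset_univ _)
    refine ⟨hTF, ?_⟩
    let s : (σ →₀ ℕ) → (σ →₀ ℕ) := fun n => n + Finsupp.single a 1
    have hs : ∀ n, w (s n) = w n + w (Finsupp.single a 1) := fun n => map_add _ _ _
    have hinj : Function.Injective s := add_left_injective _
    have key : T = U ∪ s '' T := by
      ext n
      constructor
      · intro hn
        by_cases h0 : n a = 0
        · left
          intro i hi
          by_cases hia : i = a
          · rw [hia, h0]
          · exact hn i (by simp [hi, hia])
        · right
          refine ⟨n - Finsupp.single a 1, fun i hi => ?_, ?_⟩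
          · simp [hn i hi]
          · ext j
            simp only [s, Finsupp.add_apply, Finsupp.tsub_apply, Finsupp.single_apply]
            split_ifs with h
            · subst h; omega
            · simp
      · rintro (hn | ⟨n, hn, rfl⟩)
        · intro i hi
          exact hn i (fun h => hi (by simp [h]))
        · intro i hi
          have : a ≠ i := by rintro rfl; simp at hi
          simp [s, hn i hi, this]
    have hdis : Disjoint U (s '' T) := by
      rw [Set.disjoint_left]
      rintro _ hn ⟨n, _, rfl⟩
      have := hn a ha
      simp [s] at this
    have hg := gf_disjUnion ih.1 (hTF.image s _ hs) hdis
    rw [← key, gf_image s _ hs hinj.injOn] at hg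
    refine IsRat.of_polyMul (1 - Polynomial.X ^ w (Finsupp.single a 1)) ?_ ?_
    · have := hw a
      simp [Polynomial.coeff_X_pow]; omega
    · have : ((1 - Polynomial.X ^ w (Finsupp.single a 1) : Polynomial ℤ) : PowerSeries ℤ) * gf w T
          = gf w U := by
        push_cast at hg ⊢
        rw [sub_mul, one_mul, sub_eq_iff_eq_add]; exact hg
      rw [this]; exact ih.2

theorem RS_compl_upper (I : Set (σ →₀ ℕ)) (hI : IsUpperSet I) : RS w Iᶜ := by
  have hmin : {x | Minimal (· ∈ I) x}.Finite :=
    (setOfPred_minimal_antichain _).finite_of_partiallyWellOrderedOn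
      (Set.isPWO_of_wellQuasiOrderedLE _)
  have hIeq : I = ⋃ g ∈ hmin.toFinset, Set.Ici g := by
    ext n
    simp only [Set.Finite.mem_toFinset, Set.mem_iUnion, Set.mem_Ici, exists_prop]
    constructor
    · intro hn
      obtain ⟨m, hm, hm'⟩ := exists_minimal_le_of_wellFoundedLT (· ∈ I) n hn
      exact ⟨m, hm', hm⟩
    · rintro ⟨m, hm, hmn⟩
      exact hI hmn hm.1
  have hR : RS w I := by
    rw [hIeq]
    refine RS.biUnion (fun T => ∃ g, T = Set.Ici g) ?_ ?_ _ _ (fun g _ => ⟨g, rfl⟩)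
    · rintro _ _ ⟨g, rfl⟩ ⟨g', rfl⟩
      exact ⟨g ⊔ g', Set.Ici_inter_Ici⟩
    · rintro _ ⟨g, rfl⟩
      have : Set.Ici g = (fun n => n + g) '' Set.univ := by
        ext n
        simp only [Set.mem_Ici, Set.image_univ, Set.mem_range]
        constructor
        · intro h; exact ⟨n - g, tsub_add_cancel_of_le h⟩
        · rintro ⟨m, rfl⟩; exact le_add_self
      rw [this]
      exact (RS_univ w hw).image _ (w g) (fun n => map_add _ _ _) (add_left_injective g).injOn
  rw [Set.compl_eq_univ_sdiff]
  exact (RS_univ w hw).diff hR (Set.subset_univ _)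

end
end Benson
namespace Benson
section
variable {X : Type*} [AddCommMonoid X] [IsCancelAdd X] (d : X →+ ℕ)

/-- finitely generated modules over a positively graded submonoid -/
def MC (T : Set X) : Prop :=
  ∃ (B : Set X) (H : AddSubmonoid X), B.Finite ∧ H.FG ∧ (∀ h ∈ H, d h = 0 → h = 0) ∧
    T = B + (H : Set X)

omit [IsCancelAdd X] in
theorem upper_rep {σ : Type*} (m : MonomialOrder σ) (f : (σ →₀ ℕ) →+ X) (b : X) (V : Set X)
    (hV : ∀ v ∈ V, ∀ n, v + f n ∈ V) :
    IsUpperSet {n | b + f n ∈ V ∨ ∃ n', m.toSyn n' < m.toSyn n ∧ b + f n' = b + f n} := by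
  intro n k hnk h
  obtain ⟨l, rfl⟩ := exists_add_of_le hnk
  rcases h with h | ⟨n', h1, h2⟩
  · left
    rw [map_add, ← add_assoc]; exact hV _ h _
  · right
    refine ⟨n' + l, ?_, ?_⟩
    · rw [map_add, map_add]; exact add_lt_add_left h1 _
    · rw [map_add, map_add, ← add_assoc, h2, add_assoc]

omit [IsCancelAdd X] in
theorem MC.rs {T : Set X} (hT : MC d T) : RS d T := by
  obtain ⟨B, H, hB, ⟨t, rfl⟩, hpos, rfl⟩ := hT
  let σ := {p : X // p ∈ t ∧ p ≠ 0}
  have : Finite σ := Set.Finite.subset (t.finite_toSet) (fun x hx => hx.1)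
  let f : (σ →₀ ℕ) →+ X := (Finsupp.linearCombination ℕ (Subtype.val : σ → X)).toAddMonoidHom
  have hf : ∀ x, x ∈ AddSubmonoid.closure (t : Set X) ↔ ∃ n, f n = x := by
    intro x
    have h1 : AddSubmonoid.closure (t : Set X) = AddMonoidHom.mrange f := by
      apply le_antisymm
      · rw [AddSubmonoid.closure_le]
        intro p hp
        by_cases h0 : p = 0
        · rw [h0]; exact zero_mem _
        · exact ⟨Finsupp.single ⟨p, hp, h0⟩ 1, by simp [f]⟩
      · rintro _ ⟨n, rfl⟩
        simp only [f, LinearMap.toAddMonoidHom_coe, Finsupp.linearCombination_apply]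
        exact AddSubmonoid.sum_mem _ fun p _ =>
          AddSubmonoid.nsmul_mem _ (AddSubmonoid.subset_closure p.2.1) _
    rw [h1]; rfl
  have hw : ∀ i, 0 < (d.comp f) (Finsupp.single i 1) := by
    intro i
    rw [Nat.pos_iff_ne_zero]
    intro h
    have : d i.1 = 0 := by simpa [f] using h
    exact i.2.2 (hpos _ (AddSubmonoid.subset_closure i.2.1) this)
  classical
  let _ : LinearOrder σ := linearOrderOfSTO (WellOrderingRel (α := σ))
  let m : MonomialOrder σ := MonomialOrder.lex
  induction B, hB using Set.Finite.induction_on with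
  | empty => simpa using RS.empty
  | @insert b B hb hB ih =>
    set V := B + (AddSubmonoid.closure (t : Set X) : Set X) with hVdef
    have hV : ∀ v ∈ V, ∀ n, v + f n ∈ V := by
      rintro _ ⟨a, ha, h, hh, rfl⟩ n
      exact ⟨a, ha, h + f n, add_mem hh ((hf _).2 ⟨n, rfl⟩), (add_assoc _ _ _).symm⟩
    set I := {n | b + f n ∈ V ∨ ∃ n', m.toSyn n' < m.toSyn n ∧ b + f n' = b + f n} with hI
    have hR := RS_compl_upper (d.comp f) hw I (upper_rep m f b V hV)
    have hinj : Set.InjOn (fun n => b + f n) Iᶜ := by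
      intro n hn n' hn' h
      simp only [hI, Set.mem_compl_iff, Set.mem_ofPred_eq, not_or, not_exists, not_and] at hn hn'
      rcases lt_trichotomy (m.toSyn n) (m.toSyn n') with hlt | heq | hlt
      · exact absurd h (hn'.2 n hlt)
      · exact m.toSyn.injective heq
      · exact absurd h.symm (hn.2 n' hlt)
    have hR' : RS d ((fun n => b + f n) '' Iᶜ) :=
      hR.image _ (d b) (fun n => by simp [add_comm]) hinj
    have heq : insert b B + (AddSubmonoid.closure (t : Set X) : Set X)
        = V ∪ (fun n => b + f n) '' Iᶜ := by
      ext x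
      constructor
      · rintro ⟨a, ha, h, hh, rfl⟩
        rcases ha with rfl | ha
        · obtain ⟨n, rfl⟩ := (hf h).1 hh
          by_cases hx : a + f n ∈ V
          · exact Or.inl hx
          · right
            have hne : {s : m.syn | a + f (m.toSyn.symm s) = a + f n}.Nonempty :=
              ⟨m.toSyn n, by simp⟩
            obtain ⟨s, hmin, hmin'⟩ := wellFounded_lt.has_min _ hne
            refine ⟨m.toSyn.symm s, ?_, hmin⟩
            rintro (h1 | ⟨n', h1, h2⟩)
            · rw [hmin] at h1; exact hx h1
            · refine hmin' (m.toSyn n') ?_ (by simpa using h1)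
              simp only [Set.mem_ofPred_eq, AddEquiv.symm_apply_apply]
              exact h2.trans hmin
        · exact Or.inl ⟨a, ha, h, hh, rfl⟩
      · rintro (⟨a, ha, h, hh, rfl⟩ | ⟨n, -, rfl⟩)
        · exact ⟨a, Or.inr ha, h, hh, rfl⟩
        · exact ⟨b, Or.inl rfl, f n, (hf _).2 ⟨n, rfl⟩, rfl⟩
    rw [heq]
    refine ih.disjUnion hR' ?_
    rw [Set.disjoint_right]
    rintro _ ⟨n, hn, rfl⟩ h
    exact hn (Or.inl h)

theorem inter_linear (H K : AddSubmonoid X) (hH : H.FG) (hK : K.FG) :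
    (H ⊓ K).FG ∧ ∀ b c : X, ∃ B : Set X, B.Finite ∧
      (b +ᵥ (H : Set X)) ∩ (c +ᵥ (K : Set X)) = B + ((H ⊓ K : AddSubmonoid X) : Set X) := by
  obtain ⟨n, f, rfl⟩ := AddSubmonoid.fg_iff_exists_fin_addMonoidHom.1 hH
  obtain ⟨n', g, rfl⟩ := AddSubmonoid.fg_iff_exists_fin_addMonoidHom.1 hK
  let f' : (Fin n → ℕ) × (Fin n' → ℕ) →+ X := f.comp (AddMonoidHom.fst _ _)
  let g' : (Fin n → ℕ) × (Fin n' → ℕ) →+ X := g.comp (AddMonoidHom.snd _ _)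
  constructor
  · have h := AddSubmonoid.fg_eqLocusM f' g'
    have h2 := h.map f'
    convert h2
    ext x
    constructor
    · rintro ⟨⟨u, hu⟩, ⟨v, hv⟩⟩
      exact ⟨(u, v), hu.trans hv.symm, hu⟩
    · rintro ⟨⟨u, v⟩, h1, h2⟩
      exact ⟨⟨u, h2⟩, ⟨v, Eq.trans (Eq.symm h1) h2⟩⟩
  · intro b c
    let I : Set ((Fin n → ℕ) × (Fin n' → ℕ)) := {p | b + f' p = c + g' p}
    have hmin : {x | Minimal (· ∈ I) x}.Finite :=
      (setOfPred_minimal_antichain _).finite_of_partiallyWellOrderedOn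
        (Set.isPWO_of_wellQuasiOrderedLE _)
    refine ⟨(fun p => b + f' p) '' {x | Minimal (· ∈ I) x}, hmin.image _, ?_⟩
    ext x
    constructor
    · rintro ⟨⟨_, ⟨u, rfl⟩, h1⟩, ⟨_, ⟨v, rfl⟩, h2⟩⟩
      simp only [vadd_eq_add] at h1 h2
      have hI : (u, v) ∈ I := h1.trans h2.symm
      obtain ⟨p, hp, hp'⟩ := exists_minimal_le_of_wellFoundedLT (· ∈ I) _ hI
      obtain ⟨q, hq⟩ := exists_add_of_le hp
      have hq1 : f u = f' p + f' q := by rw [← map_add, ← hq]; rfl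
      have hq2 : g v = g' p + g' q := by rw [← map_add, ← hq]; rfl
      have hpI : b + f' p = c + g' p := hp'.1
      have hqq : f' q = g' q := by
        have : b + f u = c + g v := h1.trans h2.symm
        rw [hq1, hq2, ← add_assoc, ← add_assoc, hpI] at this
        exact add_left_cancel this
      refine ⟨b + f' p, ⟨p, hp', rfl⟩, f' q, ⟨⟨q.1, rfl⟩, ⟨q.2, hqq.symm⟩⟩, ?_⟩
      rw [← h1, hq1, ← add_assoc]
    · rintro ⟨_, ⟨p, hp, rfl⟩, y, ⟨⟨u, hu⟩, ⟨v, hv⟩⟩, rfl⟩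
      have hpI : b + f' p = c + g' p := hp.1
      refine ⟨⟨f' p + y, ⟨p.1 + u, ?_⟩, ?_⟩, ⟨g' p + y, ⟨p.2 + v, ?_⟩, ?_⟩⟩
      · rw [map_add, hu]; rfl
      · simp [add_assoc]
      · rw [map_add, hv]; rfl
      · simp only [vadd_eq_add]; rw [hpI, add_assoc]

theorem MC.inter {T U : Set X} (hT : MC d T) (hU : MC d U) : MC d (T ∩ U) := by
  obtain ⟨B, H, hB, hH, hp, rfl⟩ := hT
  obtain ⟨C, K, hC, hK, -, rfl⟩ := hU
  obtain ⟨h1, h2⟩ := inter_linear H K hH hK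
  choose D hD hD' using h2
  refine ⟨⋃ b ∈ B, ⋃ c ∈ C, D b c, H ⊓ K, ?_, h1, fun h hh => hp h hh.1, ?_⟩
  · exact hB.biUnion fun b _ => hC.biUnion fun c _ => hD b c
  · simp only [Set.iUnion_add]
    simp_rw [← hD']
    ext x
    simp only [Set.mem_inter_iff, Set.mem_add, Set.mem_iUnion, Set.mem_vadd_set, vadd_eq_add,
      SetLike.mem_coe, exists_prop]
    constructor
    · rintro ⟨⟨b, hb, h, hh, e1⟩, ⟨c, hc, k, hk, e2⟩⟩
      exact ⟨b, hb, c, hc, ⟨h, hh, e1⟩, ⟨k, hk, e2⟩⟩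
    · rintro ⟨b, hb, c, hc, ⟨h, hh, e1⟩, ⟨k, hk, e2⟩⟩
      exact ⟨⟨b, hb, h, hh, e1⟩, ⟨c, hc, k, hk, e2⟩⟩

end

/-- image of a semilinear set in a free monoid, then saturated by `u` -/
theorem semilinear_rs {X M : Type*} [AddCommMonoid X] [IsCancelAdd X] (d : X →+ ℕ)
    [AddCommMonoid M] (F : M →+ X) (hF : ∀ m, d (F m) = 0 → F m = 0) (L : Set M)
    (hL : IsSemilinearSet L) (u : X) (hu : 0 < d u) :
    RS d {x | ∃ m ∈ L, ∃ n : ℕ, x = F m + n • u} := by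
  obtain ⟨S, hS, rfl⟩ := isSemilinearSet_iff.1 hL
  have : {x | ∃ m ∈ ⋃₀ (S : Set (Set M)), ∃ n : ℕ, x = F m + n • u}
      = ⋃ T ∈ S, {x | ∃ m ∈ T, ∃ n : ℕ, x = F m + n • u} := by
    ext x; simp; tauto
  rw [this]
  refine RS.biUnion (MC d) (fun _ _ h1 h2 => h1.inter d h2) (fun _ h => h.rs d) _ _ ?_
  intro T hT
  obtain ⟨a, t, rfl⟩ := isLinearSet_iff.1 (hS T hT)
  refine ⟨{F a}, (AddSubmonoid.closure (t : Set M)).map F ⊔ AddSubmonoid.closure {u},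
    Set.finite_singleton _, ?_, ?_, ?_⟩
  · exact (AddSubmonoid.FG.map ⟨t, rfl⟩ F).sup ⟨{u}, by simp⟩
  · intro h hh h0
    obtain ⟨_, ⟨m, hm, rfl⟩, z, hz, rfl⟩ := AddSubmonoid.mem_sup.1 hh
    obtain ⟨n, rfl⟩ := AddSubmonoid.mem_closure_singleton.1 hz
    simp only [map_add, map_nsmul, smul_eq_mul, Nat.add_eq_zero_iff, Nat.mul_eq_zero] at h0
    have hn : n = 0 := by omega
    rw [hF m h0.1, hn]; simp
  · ext x
    simp only [Set.mem_ofPred_eq, Set.singleton_add, Set.mem_image, SetLike.mem_coe,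
      AddSubmonoid.mem_sup]
    constructor
    · rintro ⟨_, ⟨m, hm, rfl⟩, n, rfl⟩
      exact ⟨_, ⟨F m, ⟨m, hm, rfl⟩, n • u, AddSubmonoid.mem_closure_singleton.2 ⟨n, rfl⟩, rfl⟩,
        by simp [add_assoc]⟩
    · rintro ⟨_, ⟨_, ⟨m, hm, rfl⟩, z, hz, rfl⟩, rfl⟩
      obtain ⟨n, rfl⟩ := AddSubmonoid.mem_closure_singleton.1 hz
      exact ⟨_, ⟨m, hm, rfl⟩, n, by simp [add_assoc]⟩

end Benson
namespace Benson

/-- edge-count vectors of paths with intermediate vertices in `V` -/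
inductive Pth {E Q : Type*} (src tgt : E → Q) (V : Set Q) : Q → Q → (E →₀ ℕ) → Prop
  | nil (q : Q) : Pth src tgt V q q 0
  | edge (e : E) : Pth src tgt V (src e) (tgt e) (Finsupp.single e 1)
  | snoc {q : Q} {m : E →₀ ℕ} (e : E) (h : Pth src tgt V q (src e) m) (hV : src e ∈ V) :
      Pth src tgt V q (tgt e) (m + Finsupp.single e 1)

section
variable {E Q : Type*} {src tgt : E → Q}

theorem Pth.mono {V W : Set Q} (hVW : V ⊆ W) {q q' : Q} {m : E →₀ ℕ}
    (h : Pth src tgt V q q' m) : Pth src tgt W q q' m := by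
  induction h with
  | nil q => exact .nil q
  | edge e => exact .edge e
  | snoc e h hV ih => exact .snoc e ih (hVW hV)

theorem Pth.trans {V : Set Q} {q v q' : Q} {m n : E →₀ ℕ}
    (h : Pth src tgt V q v m) (hv : v ∈ V) (h' : Pth src tgt V v q' n) :
    Pth src tgt V q q' (m + n) := by
  induction h' with
  | nil q => simpa using h
  | edge e => exact .snoc e h hv
  | snoc e h' hV ih => rw [← add_assoc]; exact .snoc e (ih h hv) hV

theorem Pth.insert_eq (V : Set Q) (v q q' : Q) :
    {m | Pth src tgt (insert v V) q q' m} = {m | Pth src tgt V q q' m} ∪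
      ({m | Pth src tgt V q v m} + (AddSubmonoid.closure {m | Pth src tgt V v v m} : Set (E →₀ ℕ))
        + {m | Pth src tgt V v q' m}) := by
  ext m
  constructor
  · intro h
    change Pth src tgt (insert v V) q q' m at h
    induction h with
    | nil q => exact Or.inl (.nil q)
    | edge e => exact Or.inl (.edge e)
    | @snoc q m e h hV ih =>
      rcases hV with hv | hV
      · right
        rcases ih with ih | ⟨_, ⟨a, ha, c, hc, rfl⟩, b, hb, rfl⟩
        · rw [hv] at ih
          refine ⟨m + 0, ⟨m, ih, 0, zero_mem _, rfl⟩, Finsupp.single e 1, ?_, by simp⟩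
          rw [← hv]; exact .edge e
        · rw [hv] at hb
          refine ⟨a + (c + b), ⟨a, ha, c + b, add_mem hc (AddSubmonoid.subset_closure hb), rfl⟩,
            Finsupp.single e 1, ?_, by simp [add_assoc]⟩
          rw [← hv]; exact .edge e
      · rcases ih with ih | ⟨_, ⟨a, ha, c, hc, rfl⟩, b, hb, rfl⟩
        · exact Or.inl (.snoc e ih hV)
        · right
          exact ⟨a + c, ⟨a, ha, c, hc, rfl⟩, b + Finsupp.single e 1, .snoc e hb hV,
            by simp [add_assoc]⟩
  · rintro (h | ⟨_, ⟨a, ha, c, hc, rfl⟩, b, hb, rfl⟩)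
    · exact Pth.mono (Set.subset_insert _ _) h
    · have hc' : Pth src tgt (insert v V) v v c := by
        induction hc using AddSubmonoid.closure_induction with
        | mem x hx => exact Pth.mono (Set.subset_insert _ _) hx
        | zero => exact .nil v
        | add x y _ _ hx hy => exact hx.trans (Set.mem_insert _ _) hy
      exact (((Pth.mono (Set.subset_insert _ _) ha).trans (Set.mem_insert _ _) hc').trans
        (Set.mem_insert _ _) (Pth.mono (Set.subset_insert _ _) hb))

theorem Pth.semilinear [Finite E] {V : Set Q} (hV : V.Finite) :
    ∀ q q', IsSemilinearSet {m | Pth src tgt V q q' m} := by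
  induction V, hV using Set.Finite.induction_on with
  | empty =>
    intro q q'
    refine IsSemilinearSet.of_finite (((Set.finite_range
      (fun e : E => Finsupp.single e 1)).insert (0 : E →₀ ℕ)).subset ?_)
    rintro m (_ | e | ⟨_, _, h⟩)
    · exact Or.inl rfl
    · exact Or.inr ⟨e, rfl⟩
    · exact absurd h (by simp)
  | @insert v V _ _ ih =>
    intro q q'
    rw [Pth.insert_eq]
    exact (ih _ _).union (((ih _ _).add (ih _ _).closure).add (ih _ _))

end

section
variable {Γ : Type*} [Group Γ] (N : Subgroup Γ) [N.Normal] (Z : Set Γ)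

/-- transversal -/
noncomputable def tv (q : Γ ⧸ N) : Γ := Quotient.out q

theorem mk_tv (q : Γ ⧸ N) : ((tv N q : Γ) : Γ ⧸ N) = q := Quotient.out_eq' q

/-- edge label -/
noncomputable def lab (e : (Γ ⧸ N) × Z) : N :=
  ⟨tv N e.1 * e.2 * (tv N (e.1 * ((e.2 : Γ) : Γ ⧸ N)))⁻¹, by
    rw [← QuotientGroup.eq_one_iff]
    simp [mk_tv]⟩

/-- first coordinate of an element -/
noncomputable def bet (γ : Γ) : N :=
  ⟨tv N 1 * γ * (tv N (γ : Γ ⧸ N))⁻¹, by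
    rw [← QuotientGroup.eq_one_iff]
    simp [mk_tv]⟩

theorem bet_one : bet N 1 = 1 := by
  ext; simp [bet]

theorem bet_mul (γ : Γ) (s : Z) : bet N (γ * s) = bet N γ * lab N Z ((γ : Γ ⧸ N), s) := by
  ext
  simp [bet, lab, mul_assoc]

theorem bet_inv (γ : Γ) : (tv N 1)⁻¹ * (bet N γ : Γ) * tv N (γ : Γ ⧸ N) = γ := by
  simp [bet, mul_assoc]

variable [IsMulCommutative N]
open scoped IsMulCommutative

/-- evaluation of an edge-count vector -/
noncomputable def ev : ((Γ ⧸ N) × Z →₀ ℕ) →+ Additive N × ℕ :=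
  (Finsupp.linearCombination ℕ
    (fun e : (Γ ⧸ N) × Z => ((Additive.ofMul (lab N Z e), 1) : Additive N × ℕ))).toAddMonoidHom

theorem ev_single (e) : ev N Z (Finsupp.single e 1) = (Additive.ofMul (lab N Z e), 1) := by
  simp [ev]

theorem ev_zero (m) (h : (ev N Z m).2 = 0) : ev N Z m = 0 := by
  have : m = 0 := by
    by_contra hm
    obtain ⟨e, he⟩ := Finsupp.ne_iff.1 hm
    have h1 : m = Finsupp.single e 1 + (m - Finsupp.single e 1) := by
      classical
      ext j
      simp only [Finsupp.add_apply, Finsupp.tsub_apply, Finsupp.single_apply]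
      split_ifs with h'
      · subst h'
        have : m e ≠ 0 := he
        omega
      · simp
    rw [h1, map_add, ev_single] at h
    simp at h
  rw [this, map_zero]

/-- source -/
def srcE (e : (Γ ⧸ N) × Z) : Γ ⧸ N := e.1
/-- target -/
def tgtE (e : (Γ ⧸ N) × Z) : Γ ⧸ N := e.1 * ((e.2 : Γ) : Γ ⧸ N)

theorem path_of_mem (k : ℕ) : ∀ γ ∈ Z ^ k, ∃ m, Pth (srcE N Z) (tgtE N Z) Set.univ 1 (γ : Γ ⧸ N) m ∧
    ev N Z m = (Additive.ofMul (bet N γ), k) := by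
  induction k with
  | zero =>
    intro γ hγ
    rw [pow_zero, Set.mem_one] at hγ
    subst hγ
    exact ⟨0, .nil _, by rw [map_zero, bet_one]; rfl⟩
  | succ k ih =>
    intro γ hγ
    rw [pow_succ] at hγ
    obtain ⟨γ, h1, s, hs, rfl⟩ := hγ
    obtain ⟨m, hm, hm'⟩ := ih γ h1
    refine ⟨m + Finsupp.single ((γ : Γ ⧸ N), ⟨s, hs⟩) 1, ?_, ?_⟩
    · exact Pth.snoc (src := srcE N Z) (tgt := tgtE N Z) ((γ : Γ ⧸ N), ⟨s, hs⟩) hm trivial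
    · have := bet_mul N Z γ ⟨s, hs⟩
      simp only at this ⊢
      rw [map_add, hm', ev_single, this]
      rfl

theorem mem_of_path {q q' : Γ ⧸ N} {m} (h : Pth (srcE N Z) (tgtE N Z) Set.univ q q' m)
    (hq : q = 1) : ∃ γ : Γ, (γ : Γ ⧸ N) = q' ∧ γ ∈ Z ^ (ev N Z m).2 ∧
      Additive.ofMul (bet N γ) = (ev N Z m).1 := by
  have step : ∀ (e : (Γ ⧸ N) × Z) (m), (∃ γ : Γ, (γ : Γ ⧸ N) = srcE N Z e ∧
      γ ∈ Z ^ (ev N Z m).2 ∧ Additive.ofMul (bet N γ) = (ev N Z m).1) →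
      ∃ γ : Γ, (γ : Γ ⧸ N) = tgtE N Z e ∧ γ ∈ Z ^ (ev N Z (m + Finsupp.single e 1)).2 ∧
      Additive.ofMul (bet N γ) = (ev N Z (m + Finsupp.single e 1)).1 := by
    rintro ⟨q, s⟩ m ⟨γ, h1, h2, h3⟩
    have h1' : (γ : Γ ⧸ N) = q := h1
    subst h1'
    refine ⟨γ * s, rfl, ?_, ?_⟩
    · rw [map_add, ev_single, Prod.snd_add, pow_succ]
      exact Set.mul_mem_mul h2 s.2
    · rw [map_add, ev_single, Prod.fst_add, ← h3, bet_mul]; rfl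
  have h0 : ∃ γ : Γ, (γ : Γ ⧸ N) = 1 ∧ γ ∈ Z ^ (ev N Z 0).2 ∧
      Additive.ofMul (bet N γ) = (ev N Z 0).1 :=
    ⟨1, rfl, by simp, by rw [map_zero, bet_one]; rfl⟩
  induction h with
  | nil q => subst hq; exact h0
  | edge e =>
    have := step e 0 (by rw [hq]; exact h0)
    rwa [zero_add] at this
  | snoc e h hV ih => exact step e _ (ih hq)

theorem ball_coset_rs [Finite (Γ ⧸ N)] [Finite Z] (q : Γ ⧸ N) :
    RS Prod.snd {p : Γ × ℕ | (p.1 : Γ ⧸ N) = q ∧ ∃ j ≤ p.2, p.1 ∈ Z ^ j} := by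
  have h := semilinear_rs (AddMonoidHom.snd (Additive N) ℕ) (ev N Z) (ev_zero N Z) _
    (Pth.semilinear (src := srcE N Z) (tgt := tgtE N Z) (Set.finite_univ) 1 q) (0, 1) (by simp)
  have h' := h.image (e := (Prod.snd : Γ × ℕ → ℕ))
    (fun p => ((tv N 1)⁻¹ * (p.1.toMul : Γ) * tv N q, p.2)) 0 (fun _ => rfl) (by
      rintro ⟨a, k⟩ - ⟨b, l⟩ - hh
      simpa using hh)
  convert h' using 1
  ext ⟨γ, k⟩
  simp only [Set.mem_ofPred_eq, Set.mem_image]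
  constructor
  · rintro ⟨rfl, j, hj, hγ⟩
    obtain ⟨m, hm, hm'⟩ := path_of_mem N Z j γ hγ
    refine ⟨_, ⟨m, hm, k - j, rfl⟩, ?_⟩
    rw [hm']
    ext
    · simp [bet_inv]
    · simp; omega
  · rintro ⟨_, ⟨m, hm, n, rfl⟩, h⟩
    obtain ⟨γ', rfl, h2, h3⟩ := mem_of_path N Z hm rfl
    obtain ⟨h4, h5⟩ := Prod.ext_iff.1 h
    simp [← h3, bet_inv] at h4 h5
    subst h4
    exact ⟨rfl, _, by omega, h2⟩

theorem ball_rs [Finite (Γ ⧸ N)] [Finite Z] :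
    RS Prod.snd {p : Γ × ℕ | ∃ j ≤ p.2, p.1 ∈ Z ^ j} := by
  have := Fintype.ofFinite (Γ ⧸ N)
  have h := RS.biUnion (d := (Prod.snd : Γ × ℕ → ℕ)) (fun T => T = ∅ ∨ ∃ q : Γ ⧸ N,
    T = {p : Γ × ℕ | (p.1 : Γ ⧸ N) = q ∧ ∃ j ≤ p.2, p.1 ∈ Z ^ j}) ?_ ?_ Finset.univ
    (fun q : Γ ⧸ N => {p : Γ × ℕ | (p.1 : Γ ⧸ N) = q ∧ ∃ j ≤ p.2, p.1 ∈ Z ^ j})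
    (fun q _ => Or.inr ⟨q, rfl⟩)
  · convert h using 1
    ext p; simp
  · rintro _ _ (rfl | ⟨q, rfl⟩) (rfl | ⟨q', rfl⟩)
    · simp
    · simp
    · simp
    · by_cases hq : q = q'
      · subst hq; right; exact ⟨q, Set.inter_self _⟩
      · left
        ext p
        simp only [Set.mem_inter_iff, Set.mem_ofPred_eq, Set.mem_empty_iff_false, iff_false]
        rintro ⟨⟨h1, -⟩, ⟨h2, -⟩⟩
        exact hq (h1.symm.trans h2)
  · rintro _ (rfl | ⟨q, rfl⟩)
    · exact .empty
    · exact ball_coset_rs N Z q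

theorem sphere_rat [Finite (Γ ⧸ N)] [Finite Z] (hZ : ∀ γ, ∃ j, γ ∈ Z ^ j) :
    IsRat (PowerSeries.mk (fun k : ℕ =>
      ({γ : Γ | sInf {j : ℕ | γ ∈ Z ^ j} = k}.ncard : ℤ))) := by
  have hB := ball_rs N Z
  set B := {p : Γ × ℕ | ∃ j ≤ p.2, p.1 ∈ Z ^ j} with hBdef
  have hBB : ∀ γ k, (γ, k) ∈ B ↔ sInf {j : ℕ | γ ∈ Z ^ j} ≤ k := by
    intro γ k
    constructor
    · rintro ⟨j, hj, h⟩
      exact (Nat.sInf_le h).trans hj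
    · intro h
      exact ⟨_, h, Nat.sInf_mem (s := {j : ℕ | γ ∈ Z ^ j}) (hZ γ)⟩
  let s : Γ × ℕ → Γ × ℕ := fun p => (p.1, p.2 + 1)
  have hs : RS Prod.snd (s '' B) := hB.image s 1 (fun _ => rfl) (by
    rintro ⟨a, k⟩ - ⟨b, l⟩ - hh
    simpa [s] using hh)
  have hD := hB.diff hs (by
    rintro _ ⟨⟨γ, k⟩, hp, rfl⟩
    rw [hBB] at hp
    exact (hBB γ (k + 1)).2 (by omega))
  have hmem : ∀ γ k, (γ, k) ∈ B \ s '' B ↔ sInf {j : ℕ | γ ∈ Z ^ j} = k := by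
    intro γ k
    rw [Set.mem_sdiff, hBB]
    constructor
    · rintro ⟨h1, h2⟩
      by_contra h3
      refine h2 ⟨(γ, k - 1), (hBB γ (k - 1)).2 (by omega), ?_⟩
      simp only [s, Prod.mk.injEq, true_and]; omega
    · rintro rfl
      refine ⟨le_rfl, ?_⟩
      rintro ⟨⟨γ', k⟩, h1, h2⟩
      simp only [s, Prod.mk.injEq] at h2
      obtain ⟨rfl, h2⟩ := h2
      rw [hBB] at h1; omega
  convert hD.2 using 1
  ext k
  simp only [gf, PowerSeries.coeff_mk]
  rw [← Set.ncard_image_of_injective (f := fun γ : Γ => (γ, k)) _ (fun a b h => (Prod.ext_iff.1 h).1)]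
  congr 2
  ext ⟨γ, l⟩
  simp only [Set.mem_image, Set.mem_ofPred_eq, Prod.mk.injEq, hmem]
  constructor
  · rintro ⟨γ', h, rfl, rfl⟩; exact ⟨h, rfl⟩
  · rintro ⟨h, rfl⟩; exact ⟨γ, h, rfl, rfl⟩

end
end Benson

/-- Benson (1983): if `Γ` is finitely generated and contains an abelian subgroup of finite
index, then for any finite generating set `S` the growth series `∑_k σ(k) z^k` is rational:
there are `P, Q ∈ ℤ[z]` with `Q(0) = 1` and `Q(z)·Σ(Γ,S;z) = P(z)` as formal power series. -/
theorem benson_virtually_abelian_rational_growth {Γ : Type*} [Group Γ]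
    (A : Subgroup Γ) (hA : A.index ≠ 0) (hcomm : ∀ x y : A, x * y = y * x)
    (S : Finset Γ) (hgen : Subgroup.closure (S : Set Γ) = ⊤) :
    ∃ P Q : Polynomial ℤ, Q.coeff 0 = 1 ∧
      (Q : PowerSeries ℤ) *
        PowerSeries.mk (fun k : ℕ =>
          ({γ : Γ | sInf {j : ℕ | γ ∈ ((S : Set Γ) ∪ (S : Set Γ)⁻¹) ^ j} = k}.ncard : ℤ))
        = (P : PowerSeries ℤ) := by
  have hfi : A.FiniteIndex := ⟨hA⟩
  have hc : IsMulCommutative A.normalCore := ⟨⟨fun x y => by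
    have := hcomm ⟨x, A.normalCore_le x.2⟩ ⟨y, A.normalCore_le y.2⟩
    ext
    simpa [Subtype.ext_iff] using this⟩⟩
  have hQ : Finite (Γ ⧸ A.normalCore) := inferInstance
  have hZf : Finite ((S : Set Γ) ∪ (S : Set Γ)⁻¹ : Set Γ) :=
    (S.finite_toSet.union S.finite_toSet.inv).to_subtype
  refine Benson.sphere_rat A.normalCore _ fun γ => ?_
  have hγ : γ ∈ Submonoid.closure ((S : Set Γ) ∪ (S : Set Γ)⁻¹) := by
    rw [← Subgroup.closure_toSubmonoid, hgen]; trivial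
  induction hγ using Submonoid.closure_induction with
  | mem x hx => exact ⟨1, by rwa [pow_one]⟩
  | one => exact ⟨0, by simp⟩
  | mul x y _ _ hx hy =>
    obtain ⟨i, hi⟩ := hx
    obtain ⟨j, hj⟩ := hy
    exact ⟨i + j, by rw [pow_add]; exact Set.mul_mem_mul hi hj⟩
end

section
/- Let (W, S) be a Coxeter system with S finite, and let ℓ : W → ℕ be its length function. Then every sphere {w ∈ W : ℓ(w) = k} is finite, and the growth series Σ(W,S;z) = ∑_{k=0}^∞ |{w ∈ W : ℓ(w) = k}| z^k is a rational function: there exist polynomials P, Q with integer coefficients and Q(0) = 1 such that Q(z)·Σ(W,S;z) = P(z) as formal power series in ℤ[[z]]. -/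
namespace CoxGrowth
open scoped Classical in
/-- The sign-permutation action of a simple reflection. -/
noncomputable def act {B : Type*} {M : CoxeterMatrix B} {W : Type*} [Group W]
    (cs : CoxeterSystem M W) (i : B) : Function.End (W × ZMod 2) :=
  fun p => (cs.simple i * p.1 * cs.simple i, p.2 + if p.1 = cs.simple i then 1 else 0)

section
variable {B : Type*} {M : CoxeterMatrix B} {W : Type*} [Group W] (cs : CoxeterSystem M W)

lemma flip_pow (i j : B) (m : ℕ) : ((cs.simple i * cs.simple j) ^ m)⁻¹ = (cs.simple j * cs.simple i) ^ m := by
  rw [← inv_pow]; simp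

lemma flip_mul (i j : B) (m : ℕ) :
    cs.simple j * (cs.simple i * cs.simple j) ^ m = (cs.simple j * cs.simple i) ^ m * cs.simple j := by
  induction m with
  | zero => simp
  | succ m ih => rw [pow_succ, ← mul_assoc, ih, pow_succ]; simp [mul_assoc]

open scoped Classical in
lemma act_pow (i j : B) (m : ℕ) (p : W × ZMod 2) :
    ((act cs i * act cs j) ^ m) p =
      ((cs.simple i * cs.simple j) ^ m * p.1 * ((cs.simple i * cs.simple j) ^ m)⁻¹,
        p.2 + ∑ k ∈ Finset.range (2 * m),
          if p.1 = (cs.simple j * cs.simple i) ^ k * cs.simple j then 1 else 0) := by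
  induction m with
  | zero => simp; rfl
  | succ m ih =>
    rw [pow_succ']
    change (act cs i) ((act cs j) (((act cs i * act cs j) ^ m) p)) = _
    rw [ih]
    have h1 : ((cs.simple i * cs.simple j) ^ m * p.1 * ((cs.simple i * cs.simple j) ^ m)⁻¹
        = cs.simple j) ↔ p.1 = (cs.simple j * cs.simple i) ^ (2 * m) * cs.simple j := by
      rw [mul_inv_eq_iff_eq_mul, flip_mul, ← eq_inv_mul_iff_mul_eq, flip_pow, two_mul, pow_add,
        mul_assoc]
    have h2 : (cs.simple j * ((cs.simple i * cs.simple j) ^ m * p.1 *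
        ((cs.simple i * cs.simple j) ^ m)⁻¹) * cs.simple j = cs.simple i) ↔
        p.1 = (cs.simple j * cs.simple i) ^ (2 * m + 1) * cs.simple j := by
      rw [← eq_mul_inv_iff_mul_eq, ← eq_inv_mul_iff_mul_eq, mul_inv_eq_iff_eq_mul,
        ← eq_inv_mul_iff_mul_eq, flip_pow]
      simp only [cs.inv_simple]
      have : (cs.simple j * cs.simple i) ^ m * (cs.simple j * (cs.simple i * cs.simple j) * (cs.simple i * cs.simple j) ^ m) = (cs.simple j * cs.simple i) ^ (2 * m + 1) * cs.simple j := by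
        have e := flip_mul cs i j m
        rw [show 2 * m + 1 = m + 1 + m by ring, pow_add,
          mul_assoc (_ ^ (m + 1)), ← e, pow_succ]
        simp [mul_assoc]
      rw [this]
    simp only [act, h1, h2]
    rw [show 2 * (m+1) = 2 * m + 1 + 1 by ring, Finset.sum_range_succ, Finset.sum_range_succ]
    refine Prod.ext ?_ ?_
    · simp [pow_succ', mul_assoc]
    · simp [add_assoc]

lemma act_liftable : M.IsLiftable (act cs) := by
  classical
  intro i j
  funext p
  rw [act_pow, cs.simple_mul_simple_pow, two_mul, Finset.sum_range_add]
  have : ∀ k, (cs.simple j * cs.simple i) ^ (M i j + k) = (cs.simple j * cs.simple i) ^ k := by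
    intro k; rw [pow_add, cs.simple_mul_simple_pow', one_mul]
  simp only [this, CharTwo.add_self_eq_zero]
  simp
  rfl

/-- The sign-permutation representation. -/
noncomputable def rep : W →* Function.End (W × ZMod 2) := cs.lift ⟨act cs, act_liftable cs⟩

lemma rep_simple (i : B) : rep cs (cs.simple i) = act cs i := cs.lift_apply_simple _ i

lemma rep_mul (x y : W) (p : W × ZMod 2) : rep cs (x * y) p = rep cs x (rep cs y p) := by
  rw [map_mul]; rfl

open scoped Classical in
lemma rep_word (ω : List B) (p : W × ZMod 2) :
    rep cs (cs.wordProd ω) p = (cs.wordProd ω * p.1 * (cs.wordProd ω)⁻¹,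
      p.2 + ((cs.rightInvSeq ω).count p.1 : ℕ)) := by
  induction ω with
  | nil => simp; rfl
  | cons i ω ih =>
    rw [cs.wordProd_cons, rep_mul, ih, rep_simple]
    have h : (cs.wordProd ω * p.1 * (cs.wordProd ω)⁻¹ = cs.simple i) ↔
      ((cs.wordProd ω)⁻¹ * cs.simple i * cs.wordProd ω = p.1) := by
      rw [mul_inv_eq_iff_eq_mul, ← eq_inv_mul_iff_mul_eq, mul_assoc, eq_comm]
    simp only [act, h, CoxeterSystem.rightInvSeq, List.count_cons]
    refine Prod.ext ?_ ?_
    · simp [mul_assoc]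
    · simp only [beq_iff_eq]; push_cast; simp [add_assoc]

lemma rep_snd (w : W) (t : W) (e : ZMod 2) :
    rep cs w (t, e) = (w * t * w⁻¹, e + (rep cs w (t, 0)).2) := by
  classical
  obtain ⟨ω, rfl⟩ := cs.wordProd_surjective w
  simp [rep_word]

lemma rep_refl {t : W} (ht : cs.IsReflection t) : (rep cs t (t, 0)).2 = 1 := by
  obtain ⟨u, i, rfl⟩ := ht
  set t := u * cs.simple i * u⁻¹ with ht
  have h0 : rep cs u⁻¹ (t, 0) = (cs.simple i, (rep cs u⁻¹ (t, 0)).2) := by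
    rw [rep_snd]; simp [ht, mul_assoc]
  have h1 : rep cs u (rep cs u⁻¹ (t, 0)) = (t, 0) := by
    rw [← rep_mul]; simp; rfl
  rw [h0, rep_snd] at h1
  have h1' := congrArg Prod.snd h1
  have : rep cs t (t, 0) = rep cs u (rep cs (cs.simple i) (rep cs u⁻¹ (t, 0))) := by
    rw [← rep_mul, ← rep_mul]
  rw [this, h0, rep_simple, act, rep_snd]
  simp only [if_true] at *
  simp only [cs.simple_mul_simple_self, one_mul]
  linear_combination h1'

lemma mem_ris {t : W} (ω : List B) (h : (rep cs (cs.wordProd ω) (t, 0)).2 = 1) :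
    t ∈ cs.rightInvSeq ω := by
  classical
  by_contra hc
  rw [rep_word] at h
  simp [List.count_eq_zero_of_not_mem hc] at h

/-- Strong exchange. -/
lemma strong_exchange {t : W} (ht : cs.IsReflection t) (ω : List B)
    (h : cs.length (cs.wordProd ω * t) < cs.length (cs.wordProd ω)) :
    ∃ j < ω.length, cs.wordProd ω * t = cs.wordProd (ω.eraseIdx j) := by
  have key : (rep cs (cs.wordProd ω) (t, 0)).2 = 1 := by
    by_contra hc
    have h0 : (rep cs (cs.wordProd ω) (t, 0)).2 = 0 := by
      generalize (rep cs (cs.wordProd ω) (t, 0)).2 = a at *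
      revert a; decide
    have h1 : (rep cs (cs.wordProd ω * t) (t, 0)).2 = 1 := by
      rw [rep_mul, rep_snd, rep_snd, rep_refl cs ht, ]
      simp [h0]
    obtain ⟨α, hα, hα'⟩ := cs.exists_isReduced (cs.wordProd ω * t)
    rw [hα'] at h1
    have := (cs.isRightInversion_of_mem_rightInvSeq hα (mem_ris cs α h1)).2
    rw [← hα', mul_assoc, ht.mul_self, mul_one] at this
    omega
  have hm := mem_ris cs ω key
  obtain ⟨j, hj, hj'⟩ := List.getElem_of_mem hm
  rw [cs.length_rightInvSeq] at hj
  refine ⟨j, hj, ?_⟩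
  rw [← cs.wordProd_mul_getD_rightInvSeq, List.getD_eq_getElem _ _ (by simpa using hj), hj']

/-- The elements that are products of words with letters in `J`. -/
def par (J : Finset B) (w : W) : Prop := ∃ ω : List B, (∀ i ∈ ω, i ∈ J) ∧ cs.wordProd ω = w

variable {cs} in
lemma par.mul {J : Finset B} {x y : W} (hx : par cs J x) (hy : par cs J y) : par cs J (x * y) := by
  obtain ⟨a, ha, rfl⟩ := hx
  obtain ⟨b, hb, rfl⟩ := hy
  exact ⟨a ++ b, by simp only [List.mem_append]; rintro i (h | h) <;> grind, cs.wordProd_append _ _⟩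

variable {cs} in
lemma par.inv {J : Finset B} {x : W} (hx : par cs J x) : par cs J x⁻¹ := by
  obtain ⟨a, ha, rfl⟩ := hx
  exact ⟨a.reverse, by simpa using ha, cs.wordProd_reverse _⟩

lemma par.one (J : Finset B) : par cs J 1 := ⟨[], by simp, by simp⟩

lemma par.simple {J : Finset B} {i : B} (h : i ∈ J) : par cs J (cs.simple i) :=
  ⟨[i], by simpa using h, by simp⟩

variable {cs} in
lemma par.mono {J K : Finset B} (h : K ⊆ J) {x : W} (hx : par cs K x) : par cs J x := by
  obtain ⟨a, ha, rfl⟩ := hx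
  exact ⟨a, fun i hi => h (ha i hi), rfl⟩

lemma par_reduced_aux {J : Finset B} (ω : List B) (h : ∀ i ∈ ω, i ∈ J) :
    ∃ α : List B, (∀ i ∈ α, i ∈ J) ∧ cs.IsReduced α ∧ cs.wordProd α = cs.wordProd ω := by
  induction ω using List.reverseRecOn with
  | nil => exact ⟨[], by simp, by simp [CoxeterSystem.IsReduced], rfl⟩
  | append_singleton ω i ih =>
    obtain ⟨α, hα, hr, he⟩ := ih (fun i hi => h i (by simp [hi]))
    have hi : i ∈ J := h i (by simp)
    rcases cs.length_mul_simple (cs.wordProd α) i with hl | hl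
    · refine ⟨α ++ [i], ?_, ?_, ?_⟩
      · simp only [List.mem_append, List.mem_singleton]; grind
      · rw [CoxeterSystem.IsReduced, cs.wordProd_append, cs.wordProd_singleton, hl, hr]; simp
      · simp [cs.wordProd_append, he]
    · obtain ⟨j, hj, hj'⟩ := strong_exchange cs (cs.isReflection_simple i) α (by omega)
      refine ⟨α.eraseIdx j, fun k hk => hα k (List.mem_of_mem_eraseIdx hk), ?_, ?_⟩
      · rw [CoxeterSystem.IsReduced, ← hj', List.length_eraseIdx_of_lt hj]
        rw [hr] at hl; omega
      · rw [← hj', he, cs.wordProd_append, cs.wordProd_singleton]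

variable {cs} in
lemma par.reduced {J : Finset B} {x : W} (hx : par cs J x) :
    ∃ α : List B, (∀ i ∈ α, i ∈ J) ∧ cs.IsReduced α ∧ cs.wordProd α = x := by
  obtain ⟨a, ha, rfl⟩ := hx
  exact par_reduced_aux cs a ha

lemma exch (α β : List B) (i : B) (hr : cs.IsReduced (β ++ [i]))
    (h : cs.length (cs.wordProd α * cs.wordProd β * cs.simple i) <
      cs.length (cs.wordProd α * cs.wordProd β)) :
    ∃ α' : List B, α'.length + 1 = α.length ∧
      cs.wordProd α * cs.wordProd β * cs.simple i = cs.wordProd α' * cs.wordProd β := by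
  rw [← cs.wordProd_append] at h ⊢
  obtain ⟨j, hj, hj'⟩ := strong_exchange cs (cs.isReflection_simple i) _ h
  rw [hj']
  by_cases hja : j < α.length
  · refine ⟨α.eraseIdx j, ?_, ?_⟩
    · rw [List.length_eraseIdx_of_lt hja]; omega
    · rw [List.eraseIdx_append_of_lt_length hja, cs.wordProd_append]
  · exfalso
    rw [List.eraseIdx_append_of_length_le (by omega), cs.wordProd_append, cs.wordProd_append,
      mul_assoc, mul_left_cancel_iff] at hj'
    have h1 := hr.eq
    rw [cs.wordProd_append, cs.wordProd_singleton, hj'] at h1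
    have h2 := cs.length_wordProd_le (β.eraseIdx (j - α.length))
    rw [List.length_eraseIdx_of_lt (by simp at hj; omega)] at h2
    simp at h1
    omega

/-- No right descents in `J`. -/
def minl (J : Finset B) (w : W) : Prop := ∀ i ∈ J, ¬ cs.IsRightDescent w i

lemma add_of_min_word {J : Finset B} (u : W)
    (hu : ∀ v, par cs J v → cs.length u ≤ cs.length (u * v)) (β : List B) (hβ : ∀ i ∈ β, i ∈ J)
    (hr : cs.IsReduced β) : cs.length (u * cs.wordProd β) = cs.length u + β.length := by
  induction β using List.reverseRecOn with
  | nil => simp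
  | append_singleton β i ih =>
    have hr' : cs.IsReduced β := by simpa using hr.take β.length
    have hβ' : ∀ i ∈ β, i ∈ J := fun i hi => hβ i (by simp [hi])
    have hi : i ∈ J := hβ i (by simp)
    have ih := ih hβ' hr'
    rw [cs.wordProd_append, cs.wordProd_singleton, ← mul_assoc]
    rcases cs.length_mul_simple (u * cs.wordProd β) i with hl | hl
    · rw [hl, ih]; simp [add_assoc]
    · exfalso
      obtain ⟨α, hα, rfl⟩ := cs.exists_isReduced u
      obtain ⟨α', h1, h2⟩ := exch cs α β i hr (by omega)
      have hp : par cs J (cs.wordProd β) := ⟨β, hβ', rfl⟩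
      have h3 := hu (cs.wordProd β * cs.simple i * (cs.wordProd β)⁻¹)
        ((hp.mul (par.simple cs hi)).mul hp.inv)
      rw [← mul_assoc, ← mul_assoc, h2, mul_inv_cancel_right, hα] at h3
      have := cs.length_wordProd_le α'
      omega

lemma exists_min (J : Finset B) (w : W) : ∃ u v, par cs J v ∧ w = u * v ∧
    ∀ v, par cs J v → cs.length u ≤ cs.length (u * v) := by
  classical
  have hex : ∃ n, ∃ v, par cs J v ∧ cs.length (w * v) = n := ⟨_, 1, par.one cs J, rfl⟩
  obtain ⟨v, hv, hl⟩ := Nat.find_spec hex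
  refine ⟨w * v, v⁻¹, hv.inv, by simp, fun x hx => ?_⟩
  rw [hl]
  exact Nat.find_min' hex ⟨v * x, hv.mul hx, by rw [mul_assoc]⟩

lemma add_of_min {J : Finset B} (u : W)
    (hu : ∀ v, par cs J v → cs.length u ≤ cs.length (u * v)) {v : W} (hv : par cs J v) :
    cs.length (u * v) = cs.length u + cs.length v := by
  obtain ⟨β, hβ, hr, rfl⟩ := hv.reduced
  rw [add_of_min_word cs u hu β hβ hr, hr]

lemma min_of_minl {J : Finset B} {u : W} (h : minl cs J u) :
    ∀ v, par cs J v → cs.length u ≤ cs.length (u * v) := by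
  obtain ⟨u0, v, hv, rfl, hm⟩ := exists_min cs J u
  suffices v = 1 by subst this; simpa using hm
  obtain ⟨β, hβ, hr, rfl⟩ := hv.reduced
  rcases List.eq_nil_or_concat' β with rfl | ⟨β, i, rfl⟩
  · simp
  exfalso
  have hi : i ∈ J := hβ i (by simp)
  refine h i hi ?_
  have h1 := add_of_min cs u0 hm hv
  have h2 := add_of_min cs u0 hm (hv.mul (par.simple cs hi))
  rw [CoxeterSystem.IsRightDescent, mul_assoc, h1, h2, hr]
  rw [cs.wordProd_append, cs.wordProd_singleton, cs.simple_mul_simple_cancel_right]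
  have := cs.length_wordProd_le β
  simp; omega

lemma minl_of_min {J : Finset B} {u : W}
    (h : ∀ v, par cs J v → cs.length u ≤ cs.length (u * v)) : minl cs J u := by
  intro i hi hd
  have := h _ (par.simple cs hi)
  rw [CoxeterSystem.IsRightDescent] at hd
  omega

lemma length_mul_of_minl {J : Finset B} {u v : W} (h : minl cs J u) (hv : par cs J v) :
    cs.length (u * v) = cs.length u + cs.length v := add_of_min cs u (min_of_minl cs h) hv

lemma decomp (J : Finset B) (w : W) : ∃ u v, minl cs J u ∧ par cs J v ∧ u * v = w := by
  obtain ⟨u, v, hv, rfl, hm⟩ := exists_min cs J w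
  exact ⟨u, v, minl_of_min cs hm, hv, rfl⟩

lemma decomp_unique {J : Finset B} {u v u' v' : W} (hu : minl cs J u) (hv : par cs J v)
    (hu' : minl cs J u') (hv' : par cs J v') (h : u * v = u' * v') : u = u' ∧ v = v' := by
  have e : u' = u * (v * v'⁻¹) := by rw [← mul_assoc, h]; simp
  have e' : u = u' * (v' * v⁻¹) := by rw [← mul_assoc, ← h]; simp
  have h1 := length_mul_of_minl cs hu (hv.mul hv'.inv)
  have h2 := length_mul_of_minl cs hu' (hv'.mul hv.inv)
  rw [← e] at h1
  rw [← e'] at h2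
  have h3 : cs.length (v * v'⁻¹) = 0 := by omega
  rw [cs.length_eq_zero_iff, mul_inv_eq_one] at h3
  subst h3
  exact ⟨mul_right_cancel h, rfl⟩

lemma bound_word {J : Finset B} {w : W} (hw : ∀ i ∈ J, cs.IsRightDescent w i) (β : List B)
    (hβ : ∀ i ∈ β, i ∈ J) (hr : cs.IsReduced β) :
    ∃ α : List B, w = cs.wordProd α * cs.wordProd β ∧ α.length + β.length = cs.length w := by
  induction β using List.reverseRecOn with
  | nil =>
    obtain ⟨α, hα, h⟩ := cs.exists_isReduced w
    exact ⟨α, by simp [h], by rw [h, hα]; simp⟩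
  | append_singleton β i ih =>
    have hr' : cs.IsReduced β := by simpa using hr.take β.length
    obtain ⟨α, h, hl⟩ := ih (fun i hi => hβ i (by simp [hi])) hr'
    have hd := hw i (hβ i (by simp))
    rw [CoxeterSystem.IsRightDescent] at hd
    rw [h] at hd
    obtain ⟨α', h1, h2⟩ := exch cs α β i hr hd
    refine ⟨α', ?_, ?_⟩
    · rw [cs.wordProd_append, cs.wordProd_singleton, ← mul_assoc, ← h2, h]; simp
    · simp; omega

lemma bound {J : Finset B} {w : W} (hw : ∀ i ∈ J, cs.IsRightDescent w i) {v : W}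
    (hv : par cs J v) : cs.length v ≤ cs.length w := by
  obtain ⟨β, hβ, hr, rfl⟩ := hv.reduced
  obtain ⟨α, -, h⟩ := bound_word cs hw β hβ hr
  rw [hr]; omega

end

/-- Rational power series with denominators of constant coefficient one. -/
def IsRat (f : PowerSeries ℤ) : Prop :=
  ∃ P Q : Polynomial ℤ, Q.coeff 0 = 1 ∧ (Q : PowerSeries ℤ) * f = (P : PowerSeries ℤ)

lemma IsRat.poly (P : Polynomial ℤ) : IsRat (P : PowerSeries ℤ) := ⟨P, 1, by simp, by simp⟩

lemma IsRat.mul {f g : PowerSeries ℤ} (hf : IsRat f) (hg : IsRat g) : IsRat (f * g) := by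
  obtain ⟨P, Q, h0, h⟩ := hf
  obtain ⟨P', Q', h0', h'⟩ := hg
  refine ⟨P * P', Q * Q', by simp [Polynomial.mul_coeff_zero, h0, h0'], ?_⟩
  push_cast
  rw [← h, ← h']; ring

lemma IsRat.add {f g : PowerSeries ℤ} (hf : IsRat f) (hg : IsRat g) : IsRat (f + g) := by
  obtain ⟨P, Q, h0, h⟩ := hf
  obtain ⟨P', Q', h0', h'⟩ := hg
  refine ⟨P * Q' + P' * Q, Q * Q', by simp [Polynomial.mul_coeff_zero, h0, h0'], ?_⟩
  push_cast
  rw [← h, ← h']; ring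

lemma IsRat.negpow (n : ℕ) : IsRat ((-1) ^ n) := by
  simpa using IsRat.poly ((-1) ^ n)

lemma IsRat.sum {ι : Type*} (s : Finset ι) (f : ι → PowerSeries ℤ) (h : ∀ i ∈ s, IsRat (f i)) :
    IsRat (∑ i ∈ s, f i) :=
  Finset.sum_induction f IsRat (fun _ _ => IsRat.add) (by simpa using IsRat.poly 0) h

lemma IsRat.inv {f g : PowerSeries ℤ} (hf : IsRat f) (hfg : f * g = 1)
    (hg : PowerSeries.constantCoeff g = 1) : IsRat g := by
  obtain ⟨P, Q, h0, h⟩ := hf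
  refine ⟨Q, P, ?_, ?_⟩
  · have h1 := congrArg PowerSeries.constantCoeff h
    have h2 := congrArg PowerSeries.constantCoeff hfg
    simp [hg] at h1 h2
    rw [h2, h0] at h1
    simpa using h1.symm
  · rw [← h, mul_assoc, hfg, mul_one]

section
variable {B : Type*} [Fintype B] {M : CoxeterMatrix B} {W : Type*} [Group W]
  (cs : CoxeterSystem M W)

lemma sphere_finite (k : ℕ) : {w : W | cs.length w = k}.Finite := by
  refine ((List.finite_length_eq B k).image cs.wordProd).subset ?_
  intro w hw
  obtain ⟨α, hα, rfl⟩ := cs.exists_isReduced w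
  exact ⟨α, hα.symm.trans hw, rfl⟩

/-- Sphere as a finset. -/
noncomputable def sph (k : ℕ) : Finset W := (sphere_finite cs k).toFinset

lemma mem_sph (k : ℕ) (w : W) : w ∈ sph cs k ↔ cs.length w = k := by simp [sph]

/-- Weighted growth series. -/
noncomputable def gs (f : W → ℤ) : PowerSeries ℤ := PowerSeries.mk fun k => ∑ w ∈ sph cs k, f w

open scoped Classical in
/-- Growth series of a parabolic subgroup. -/
noncomputable def pg (J : Finset B) : PowerSeries ℤ := gs cs fun w => if par cs J w then 1 else 0

lemma sph_zero : sph cs 0 = {1} := by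
  ext w; simp [mem_sph]

lemma pg_const (J : Finset B) : PowerSeries.constantCoeff (pg cs J) = 1 := by
  rw [← PowerSeries.coeff_zero_eq_constantCoeff_apply, pg, gs, PowerSeries.coeff_mk, sph_zero,
    Finset.sum_singleton, if_pos (par.one cs J)]

open scoped Classical in
lemma gs_mul {J K : Finset B} (h : K ⊆ J) :
    gs cs (fun w => if par cs J w ∧ minl cs K w then 1 else 0) * pg cs K = pg cs J := by
  ext n
  rw [PowerSeries.coeff_mul]
  simp only [pg, gs, PowerSeries.coeff_mk, Finset.sum_boole]
  norm_cast
  simp only [← Finset.card_product]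
  rw [← Finset.card_sigma]
  refine Finset.card_bij (fun x _ => x.2.1 * x.2.2) ?_ ?_ ?_
  · rintro ⟨⟨a, b⟩, u, v⟩ hx
    simp only [Finset.mem_sigma, Finset.mem_product, Finset.mem_filter, mem_sph] at hx ⊢
    obtain ⟨hn, ⟨hu, hu1, hu2⟩, hv, hv1⟩ := hx
    exact ⟨by rw [length_mul_of_minl cs hu2 hv1, hu, hv]; exact Finset.HasAntidiagonal.mem_antidiagonal.1 hn, hu1.mul (hv1.mono h)⟩
  · rintro ⟨⟨a, b⟩, u, v⟩ hx ⟨⟨a', b'⟩, u', v'⟩ hx' he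
    simp only [Finset.mem_sigma, Finset.mem_product, Finset.mem_filter, mem_sph] at hx hx' he
    obtain ⟨hn, ⟨hu, hu1, hu2⟩, hv, hv1⟩ := hx
    obtain ⟨hn', ⟨hu', hu1', hu2'⟩, hv', hv1'⟩ := hx'
    obtain ⟨rfl, rfl⟩ := decomp_unique cs hu2 hv1 hu2' hv1' he
    subst hu hv hu' hv'
    rfl
  · intro w hw
    simp only [Finset.mem_filter, mem_sph] at hw
    obtain ⟨u, v, hu, hv, rfl⟩ := decomp cs K w
    refine ⟨⟨(cs.length u, cs.length v), u, v⟩, ?_, rfl⟩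
    simp only [Finset.mem_sigma, Finset.mem_product, Finset.mem_filter, mem_sph]
    refine ⟨Finset.HasAntidiagonal.mem_antidiagonal.2 (by rw [← hw.1, length_mul_of_minl cs hu hv]),
      ⟨trivial, ?_, hu⟩, trivial, hv⟩
    simpa using hw.2.mul (hv.mono h).inv

open scoped Classical in
lemma alt_sum (J : Finset B) (w : W) :
    ∑ K ∈ J.powerset, (-1 : ℤ) ^ K.card * (if par cs J w ∧ minl cs K w then 1 else 0) =
      if par cs J w ∧ ∀ i ∈ J, cs.IsRightDescent w i then 1 else 0 := by
  by_cases hp : par cs J w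
  · simp only [hp, true_and, mul_ite, mul_one, mul_zero]
    rw [← Finset.sum_filter]
    have : J.powerset.filter (fun K => minl cs K w) =
        (J.filter fun i => ¬ cs.IsRightDescent w i).powerset := by
      ext K
      simp only [Finset.mem_filter, Finset.mem_powerset, minl, Finset.subset_iff]
      grind
    rw [this, Finset.sum_powerset_neg_one_pow_card]
    simp [Finset.filter_eq_empty_iff]
  · simp [hp]

lemma pg_rat (J : Finset B) : IsRat (pg cs J) := by
  classical
  induction J using Finset.strongInduction with
  | H J ih =>
  by_cases hw : ∃ w : W, ∀ i ∈ J, cs.IsRightDescent w i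
  · obtain ⟨w, hw⟩ := hw
    have : pg cs J = (PowerSeries.trunc (cs.length w + 1) (pg cs J) : Polynomial ℤ) := by
      ext n
      rw [Polynomial.coeff_coe, PowerSeries.coeff_trunc]
      split_ifs with hn
      · rfl
      · rw [pg, gs, PowerSeries.coeff_mk]
        refine Finset.sum_eq_zero fun v hv => if_neg fun hp => ?_
        rw [mem_sph] at hv
        have := bound cs hw hp
        omega
    rw [this]
    exact IsRat.poly _
  · push Not at hw
    let I : Finset B → PowerSeries ℤ := fun K => PowerSeries.invOfUnit (pg cs K) 1
    have hI : ∀ K, pg cs K * I K = 1 := fun K =>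
      PowerSeries.mul_invOfUnit _ _ (by simp [pg_const])
    have hIc : ∀ K, PowerSeries.constantCoeff (I K) = 1 := fun K => by simp [I]
    have hsum : ∑ K ∈ J.powerset, (-1 : PowerSeries ℤ) ^ K.card * (pg cs J * I K) = 0 := by
      have : ∀ K ∈ J.powerset, (-1 : PowerSeries ℤ) ^ K.card * (pg cs J * I K) =
          (PowerSeries.C ((-1 : ℤ) ^ K.card)) *
            gs cs (fun w => if par cs J w ∧ minl cs K w then 1 else 0) := by
        intro K hK
        rw [← gs_mul cs (Finset.mem_powerset.1 hK), mul_assoc, hI]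
        simp
      rw [Finset.sum_congr rfl this]
      ext n
      simp only [map_sum, PowerSeries.coeff_C_mul, gs, PowerSeries.coeff_mk, Finset.mul_sum]
      rw [Finset.sum_comm]
      simp only [alt_sum]
      refine Finset.sum_eq_zero fun w _ => if_neg ?_
      rintro ⟨-, h⟩
      obtain ⟨i, hi, h'⟩ := hw w
      exact h' (h i hi)
    rw [← Finset.insert_erase (Finset.mem_powerset_self J), Finset.sum_insert (by simp), hI] at hsum
    set F := ∑ K ∈ J.powerset.erase J, (-1 : PowerSeries ℤ) ^ K.card * I K with hF
    have hFr : IsRat F := by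
      refine IsRat.sum _ _ fun K hK => (IsRat.negpow _).mul ?_
      rw [Finset.mem_erase, Finset.mem_powerset] at hK
      exact (ih K (Finset.ssubset_iff_subset_ne.2 ⟨hK.2, hK.1⟩)).inv (hI K) (hIc K)
    have e : ∑ K ∈ J.powerset.erase J, (-1 : PowerSeries ℤ) ^ K.card * (pg cs J * I K)
        = pg cs J * F := by
      rw [hF, Finset.mul_sum]
      exact Finset.sum_congr rfl fun K _ => by ring
    rw [e] at hsum
    refine ((IsRat.negpow (J.card + 1)).mul hFr).inv ?_ (pg_const cs J)
    have h1 : ((-1 : PowerSeries ℤ) ^ J.card) * (-1) ^ J.card = 1 := by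
      rw [← mul_pow]; simp
    rw [pow_succ]
    linear_combination (-(-1 : PowerSeries ℤ) ^ J.card) * hsum + h1

end
end CoxGrowth


/-- For a Coxeter system `(W,S)` with `S` finite, every sphere `{w : ℓ(w) = k}` is finite and
the growth series `∑_k |{w : ℓ(w) = k}| z^k` is rational: there are `P, Q ∈ ℤ[z]` with
`Q(0) = 1` and `Q(z)·Σ(W,S;z) = P(z)` as formal power series (Bourbaki). -/
theorem coxeter_growth_series_rational {B : Type*} [Fintype B] (M : CoxeterMatrix B)
    {W : Type*} [Group W] (cs : CoxeterSystem M W) :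
    (∀ k : ℕ, {w : W | cs.length w = k}.Finite) ∧
    ∃ P Q : Polynomial ℤ, Q.coeff 0 = 1 ∧
      (Q : PowerSeries ℤ) *
        PowerSeries.mk (fun k : ℕ => ({w : W | cs.length w = k}.ncard : ℤ))
        = (P : PowerSeries ℤ) := by
  refine ⟨CoxGrowth.sphere_finite cs, ?_⟩
  obtain ⟨P, Q, h0, h⟩ := CoxGrowth.pg_rat cs Finset.univ
  refine ⟨P, Q, h0, ?_⟩
  rw [← h]
  congr 1
  ext n
  rw [CoxGrowth.pg, CoxGrowth.gs, PowerSeries.coeff_mk, PowerSeries.coeff_mk,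
    Set.ncard_eq_toFinset_card _ (CoxGrowth.sphere_finite cs n)]
  have hp : ∀ w, CoxGrowth.par cs Finset.univ w := fun w => by
    obtain ⟨ω, h⟩ := cs.wordProd_surjective w
    exact ⟨ω, by simp, h⟩
  simp [hp, CoxGrowth.sph]
end
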